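/- arXiv:2406.19278 — 3 statements merged into one kernel-verified Lean document; each statement's English description precedes it below -/
import Mathlib

section
/- Let G be a connected subcubic graph on n vertices with at least 7 edges, not isomorphic to the complete bipartite graph K_{3,3}, and having no open twins of degree 1 and no open twins of degree 2. Then γ^LD(G) ≤ n/2 (open twins of degree 3 and closed twins of any degree are allowed). -/
open SimpleGraph

/-- The closed neighbourhood `N[v] = N(v) ∪ {v}` of a vertex. -/
def closedNbhd {V : Type*} (G : SimpleGraph V) (v : V) : Set V :=
  insert v (G.neighborSet v)

/-- The degree of a vertex, as the cardinality of its open neighbourhood. -/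
noncomputable def deg {V : Type*} (G : SimpleGraph V) (v : V) : ℕ :=
  (G.neighborSet v).ncard

/-- `S` is a dominating set: every vertex has a member of `S` in its closed neighbourhood. -/
def IsDominating {V : Type*} (G : SimpleGraph V) (S : Set V) : Prop :=
  ∀ v : V, (closedNbhd G v ∩ S).Nonempty

/-- `S` is a locating-dominating set: it dominates and separates all pairs of
vertices outside `S` by their closed neighbourhoods intersected with `S`. -/
def IsLDSet {V : Type*} (G : SimpleGraph V) (S : Set V) : Prop :=
  IsDominating G S ∧
    ∀ u ∉ S, ∀ v ∉ S, u ≠ v → closedNbhd G u ∩ S ≠ closedNbhd G v ∩ S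

/-- The location-domination number `γ^LD(G)`. -/
noncomputable def ldNum {V : Type*} (G : SimpleGraph V) : ℕ :=
  sInf {k : ℕ | ∃ S : Set V, IsLDSet G S ∧ S.ncard = k}

/-- A graph is subcubic if every vertex has degree at most 3. -/
def Subcubic {V : Type*} (G : SimpleGraph V) : Prop :=
  ∀ v : V, deg G v ≤ 3

/-- `u` and `v` are open twins: distinct vertices with the same open neighbourhood. -/
def OpenTwins {V : Type*} (G : SimpleGraph V) (u v : V) : Prop :=
  u ≠ v ∧ G.neighborSet u = G.neighborSet v

/-- `u` and `v` are closed twins: distinct vertices with the same closed neighbourhood. -/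
def ClosedTwins {V : Type*} (G : SimpleGraph V) (u v : V) : Prop :=
  u ≠ v ∧ closedNbhd G u = closedNbhd G v

/-- A graph is twin-free if it has neither open twins nor closed twins. -/
def TwinFree {V : Type*} (G : SimpleGraph V) : Prop :=
  (¬ ∃ u v : V, OpenTwins G u v) ∧ (¬ ∃ u v : V, ClosedTwins G u v)

namespace LD
variable {V : Type*}

/-- `u` and `v` have the same colour and the same neighbours of the other colour. -/
def Same (G : SimpleGraph V) (c : V → Bool) (u v : V) : Prop :=
  c u = c v ∧ ∀ x, c x ≠ c u → (G.Adj u x ↔ G.Adj v x)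

/-- All neighbours of `u` have the colour of `u`. -/
def Emp (G : SimpleGraph V) (c : V → Bool) (u : V) : Prop :=
  ∀ x, G.Adj u x → c x = c u

/-- `u` is not located or not dominated by the other colour class. -/
def Bad (G : SimpleGraph V) (c : V → Bool) (u : V) : Prop :=
  Emp G c u ∨ ∃ v, v ≠ u ∧ Same G c u v

/-- The set of neighbours is altered by recolouring in a possibly harmful way. -/
def Touched (G : SimpleGraph V) (c c' : V → Bool) (x : V) : Prop :=
  c' x ≠ c x ∨ ∃ f, G.Adj x f ∧ c' f ≠ c f ∧ c f ≠ c x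

def Twin (G : SimpleGraph V) (u v : V) : Prop :=
  u ≠ v ∧ ∀ x, G.Adj u x ↔ G.Adj v x

def Leaf (G : SimpleGraph V) (l : V) : Prop := ∃ m, ∀ x, G.Adj l x ↔ x = m

def Supp (G : SimpleGraph V) (s : V) : Prop := ∃ l, G.Adj s l ∧ Leaf G l

def Special (G : SimpleGraph V) (p : V) : Prop := ∀ m, G.Adj p m → Supp G m

structure Adm (G : SimpleGraph V) (c : V → Bool) : Prop where
  spec : ∀ p m, Special G p → G.Adj p m → c p ≠ c m
  twin : ∀ t t', Twin G t t' → c t ≠ c t'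

section count
variable (G : SimpleGraph V)

open Classical in
/-- The number of distinct nonempty signatures on `A`. -/
noncomputable def D (c : V → Bool) (A : Finset V) : ℕ :=
  ((A.filter (fun x => ¬ Emp G c x)).image
    (fun x => (c x, {z | G.Adj x z ∧ c z ≠ c x}))).card

theorem same_iff (c : V → Bool) (x y : V) :
    (c x, {z | G.Adj x z ∧ c z ≠ c x}) = (c y, {z | G.Adj y z ∧ c z ≠ c y}) ↔ Same G c x y := by
  simp only [Prod.mk.injEq, Set.ext_iff, Set.mem_ofPred_eq, Same]
  constructor
  · rintro ⟨h, h'⟩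
    refine ⟨h, fun x hx => ?_⟩
    have := h' x
    grind
  · rintro ⟨h, h'⟩
    refine ⟨h, fun x => ?_⟩
    have := h' x
    grind

theorem image_card_le {α β : Type*} [DecidableEq α] [DecidableEq β]
    (f : V → α) (f' : V → β) (B B' : Finset V) (hB : B ⊆ B')
    (h : ∀ x ∈ B, ∀ y ∈ B, f' x = f' y → f x = f y) :
    (B.image f).card ≤ (B'.image f').card ∧
      ((∃ z ∈ B', (∀ w ∈ B, f' w ≠ f' z) ∨ (z ∈ B ∧ ∃ w ∈ B, f z = f w ∧ f' z ≠ f' w)) →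
        (B.image f).card < (B'.image f').card) := by
  obtain rfl | ⟨x₀, -⟩ := B.eq_empty_or_nonempty
  · refine ⟨by simp, ?_⟩
    rintro ⟨z, hz, -⟩
    simpa [Finset.card_pos] using ⟨z, hz⟩
  have : Nonempty V := ⟨x₀⟩
  choose! g hg using fun a (ha : a ∈ B.image f) => Finset.mem_image.1 ha
  have hinj : Set.InjOn (fun a => f' (g a)) (B.image f : Finset α) := by
    intro a ha b hb hab
    have := h _ (hg a ha).1 _ (hg b hb).1 hab
    rwa [(hg a ha).2, (hg b hb).2] at this
  have hsub : (B.image f).image (fun a => f' (g a)) ⊆ B'.image f' := by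
    intro b hb
    obtain ⟨a, ha, rfl⟩ := Finset.mem_image.1 hb
    exact Finset.mem_image_of_mem _ (hB (hg a ha).1)
  rw [← Finset.card_image_of_injOn hinj]
  refine ⟨Finset.card_le_card hsub, fun hz => Finset.card_lt_card (hsub.ssubset_of_ne ?_)⟩
  intro heq
  have key : ∀ z ∈ B', ∃ a ∈ B.image f, f' (g a) = f' z := by
    intro z hz
    have := Finset.mem_image_of_mem f' hz
    rw [← heq] at this
    exact Finset.mem_image.1 this
  obtain ⟨z, hzB', hz | ⟨hzB, w, hw, hzw, hzw'⟩⟩ := hz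
  · obtain ⟨a, ha, h'⟩ := key z hzB'
    exact hz _ (hg a ha).1 h'
  · obtain ⟨a, ha, h₁⟩ := key z hzB'
    obtain ⟨b, hb, h₂⟩ := key w (hB hw)
    have ha' := h _ (hg a ha).1 _ hzB h₁
    have hb' := h _ (hg b hb).1 _ hw h₂
    rw [(hg a ha).2] at ha'
    rw [(hg b hb).2] at hb'
    have : a = b := by rw [ha', hb', hzw]
    subst this
    exact hzw' (h₁.symm.trans h₂)

theorem same_symm {G : SimpleGraph V} {c : V → Bool} {x y : V} (h : Same G c x y) :
    Same G c y x :=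
  ⟨h.1.symm, fun z hz => (h.2 z (by rw [h.1]; exact hz)).symm⟩

theorem same_emp {G : SimpleGraph V} {c : V → Bool} {x y : V} (h : Same G c x y)
    (h' : Emp G c x) : Emp G c y := by
  intro z hz
  by_contra hne
  rw [← h.1] at hne
  exact hne (h' z ((h.2 z hne).2 hz))

/-- A pair or a vertex that is bad for `c` and repaired by `c'`, inside `A`. -/
def Repaired (G : SimpleGraph V) (c c' : V → Bool) (A : V → Prop) : Prop :=
  (∃ z, A z ∧ Emp G c z ∧ ¬ Emp G c' z) ∨
    ∃ u v, A u ∧ A v ∧ Same G c u v ∧ ¬ Emp G c u ∧ ¬ Same G c' u v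

theorem D_mono (c c' : V → Bool) (A : Finset V)
    (h1 : ∀ x ∈ A, ∀ y ∈ A, Same G c' x y → Same G c x y)
    (h2 : ∀ x ∈ A, Emp G c' x → Emp G c x) :
    D G c A ≤ D G c' A ∧ (Repaired G c c' (· ∈ A) → D G c A < D G c' A) := by
  classical
  unfold D
  have := image_card_le (fun x => (c x, {z | G.Adj x z ∧ c z ≠ c x}))
    (fun x => (c' x, {z | G.Adj x z ∧ c' z ≠ c' x})) (A.filter (fun x => ¬ Emp G c x))
    (A.filter (fun x => ¬ Emp G c' x)) ?_ ?_
  · refine ⟨this.1, fun h => this.2 ?_⟩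
    obtain ⟨z, hz, hz1, hz2⟩ | ⟨u, v, hu, hv, huv, hu1, huv'⟩ := h
    · refine ⟨z, by simp [hz, hz2], Or.inl ?_⟩
      intro w hw hwz
      rw [same_iff] at hwz
      simp only [Finset.mem_filter] at hw
      exact hw.2 (same_emp (same_symm (h1 w hw.1 z hz hwz)) hz1)
    · refine ⟨u, by simpa [hu] using fun h => hu1 (h2 u hu h),
        Or.inr ⟨by simp [hu, hu1], v, ?_, ?_, ?_⟩⟩
      · simpa [hv] using fun h => hu1 (same_emp (same_symm huv) h)
      · rwa [same_iff]
      · rwa [Ne, same_iff]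
  · intro x hx
    simp only [Finset.mem_filter] at hx ⊢
    exact ⟨hx.1, fun h => hx.2 (h2 x hx.1 h)⟩
  · intro x hx y hy
    simp only [Finset.mem_filter] at hx hy
    rw [same_iff, same_iff]
    exact h1 x hx.1 y hy.1

theorem D_erase_bad (c : V → Bool) (A : Finset V) [DecidableEq V] (u : V)
    (hu : Emp G c u ∨ ∃ v ∈ A, v ≠ u ∧ Same G c u v) : D G c A ≤ D G c (A.erase u) := by
  classical
  unfold D
  apply Finset.card_le_card
  intro s hs
  simp only [Finset.mem_image, Finset.mem_filter, Finset.mem_erase] at hs ⊢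
  obtain ⟨x, ⟨hx, hx'⟩, rfl⟩ := hs
  by_cases hxu : x = u
  · subst hxu
    obtain hu | ⟨v, hv, hvx, hs⟩ := hu
    · exact absurd hu hx'
    · exact ⟨v, ⟨⟨hvx, hv⟩, fun h => hx' (same_emp (same_symm hs) h)⟩,
        (same_iff G c v x).2 (same_symm hs)⟩
  · exact ⟨x, ⟨⟨hxu, hx⟩, hx'⟩, rfl⟩

theorem D_insert_fine (c : V → Bool) (A : Finset V) [DecidableEq V] (u : V) (huA : u ∈ A)
    (hu : ¬ Emp G c u) (hu' : ∀ v ∈ A, v ≠ u → ¬ Same G c v u) :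
    D G c (A.erase u) + 1 ≤ D G c A := by
  classical
  unfold D
  rw [← Finset.card_insert_of_notMem (a := (c u, {z | G.Adj u z ∧ c z ≠ c u}))]
  · apply Finset.card_le_card
    intro s hs
    simp only [Finset.mem_insert, Finset.mem_image, Finset.mem_filter, Finset.mem_erase] at hs ⊢
    obtain rfl | ⟨x, ⟨⟨_, hx⟩, hx'⟩, rfl⟩ := hs
    · exact ⟨u, ⟨huA, hu⟩, rfl⟩
    · exact ⟨x, ⟨hx, hx'⟩, rfl⟩
  · simp only [Finset.mem_image, Finset.mem_filter, Finset.mem_erase, not_exists, not_and]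
    rintro x ⟨⟨hxu, hx⟩, hx'⟩ h
    exact hu' x hx hxu ((same_iff G c x u).1 h)

theorem D_insert_le (c : V → Bool) (A : Finset V) [DecidableEq V] (u : V) :
    D G c A ≤ D G c (A.erase u) + 1 := by
  classical
  unfold D
  refine le_trans (Finset.card_le_card ?_)
    (Finset.card_insert_le (c u, {z | G.Adj u z ∧ c z ≠ c u}) _)
  intro s hs
  simp only [Finset.mem_insert, Finset.mem_image, Finset.mem_filter, Finset.mem_erase] at hs ⊢
  obtain ⟨x, ⟨hx, hx'⟩, rfl⟩ := hs
  by_cases hxu : x = u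
  · subst hxu; exact Or.inl rfl
  · exact Or.inr ⟨x, ⟨⟨hxu, hx⟩, hx'⟩, rfl⟩

end count

theorem same_refl (G : SimpleGraph V) (c : V → Bool) (x : V) : Same G c x x :=
  ⟨rfl, fun _ _ => Iff.rfl⟩

theorem same_of_untouched {G : SimpleGraph V} {c c' : V → Bool} {x y : V}
    (hx : ¬ Touched G c c' x) (hy : ¬ Touched G c c' y) (h : Same G c' x y) : Same G c x y := by
  simp only [Touched, not_or, not_exists, not_and, not_not] at hx hy
  have hxy : c x = c y := by rw [← hx.1, ← hy.1, h.1]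
  refine ⟨hxy, fun z hz => ?_⟩
  by_cases hcz : c' z = c z
  · exact h.2 z (by rw [hcz, hx.1]; exact hz)
  · constructor
    · intro h'; exact absurd (hx.2 z h' hcz) hz
    · intro h'; exact absurd ((hy.2 z h' hcz).trans hxy.symm) hz

theorem emp_of_untouched {G : SimpleGraph V} {c c' : V → Bool} {x : V}
    (hx : ¬ Touched G c c' x) (h : Emp G c' x) : Emp G c x := by
  simp only [Touched, not_or, not_exists, not_and, not_not] at hx
  intro z hz
  by_cases hcz : c' z = c z
  · rw [← hcz, ← hx.1]; exact h z hz
  · exact hx.2 z hz hcz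

section adm
variable {G : SimpleGraph V} {c c' : V → Bool}

theorem mono_of_touched {A : Finset V}
    (key : ∀ x ∈ A, Touched G c c' x → ¬ Bad G c' x) :
    D G c A ≤ D G c' A ∧ (Repaired G c c' (· ∈ A) → D G c A < D G c' A) := by
  apply D_mono
  · intro x hx y hy h
    by_cases hxy : x = y
    · subst hxy; exact same_refl _ _ _
    by_cases htx : Touched G c c' x
    · exact absurd (Or.inr ⟨y, Ne.symm hxy, h⟩) (key x hx htx)
    by_cases hty : Touched G c c' y
    · exact absurd (Or.inr ⟨x, hxy, same_symm h⟩) (key y hy hty)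
    exact same_of_untouched htx hty h
  · intro x hx h
    by_cases htx : Touched G c c' x
    · exact absurd (Or.inl h) (key x hx htx)
    · exact emp_of_untouched htx h

theorem Repaired.mono {P Q : V → Prop} (h : Repaired G c c' P) (hPQ : ∀ x, P x → Q x) :
    Repaired G c c' Q := by
  obtain ⟨z, hz, h⟩ | ⟨u, v, hu, hv, h⟩ := h
  · exact Or.inl ⟨z, hPQ z hz, h⟩
  · exact Or.inr ⟨u, v, hPQ u hu, hPQ v hv, h⟩

theorem exists_flip (c : V → Bool) (F : V → Prop) :
    ∃ c' : V → Bool, (∀ x, F x → c' x = !c x) ∧ ∀ x, ¬ F x → c' x = c x := by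
  classical
  exact ⟨fun x => if F x then !c x else c x, fun x hx => by simp [hx], fun x hx => by simp [hx]⟩

theorem leaf_opp (h : Adm G c) {l m : V} (hl : Leaf G l) (hlm : G.Adj l m) : c l ≠ c m := by
  refine h.spec l m (fun m' hm' => ⟨l, hm'.symm, hl⟩) hlm

theorem not_supp_of_bad (h : Adm G c) {x : V} (hx : Bad G c x) : ¬ Supp G x := by
  rintro ⟨l, hxl, hl⟩
  have hne := leaf_opp h hl hxl.symm
  obtain hx | ⟨v, hv, hs⟩ := hx
  · exact hne (hx l hxl)
  · have := (hs.2 l hne).1 hxl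
    obtain ⟨m, hm⟩ := hl
    exact hv (((hm v).1 this.symm).trans ((hm x).1 hxl.symm).symm)

theorem not_special (h : Adm G c) {x m : V} (hm : G.Adj x m) (hcm : c m = c x) :
    ¬ Special G x := fun hs => h.spec x m hs hm hcm.symm

theorem adm_of_flip (h : Adm G c) (ht : ∀ x y, c' x ≠ c x → ¬ Twin G x y)
    (hs : ∀ p m, Special G p → G.Adj p m → (c' p = c p ↔ c' m = c m)) : Adm G c' := by
  constructor
  · intro p m hp hpm
    have e1 := h.spec p m hp hpm
    have e2 := hs p m hp hpm
    revert e1 e2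
    cases c p <;> cases c m <;> cases c' p <;> cases c' m <;> simp
  · intro t t' htt
    have h1 : c' t = c t := by
      by_contra hne; exact ht t t' hne htt
    have h2 : c' t' = c t' := by
      by_contra hne; exact ht t' t hne ⟨htt.1.symm, fun x => (htt.2 x).symm⟩
    rw [h1, h2]
    exact h.twin t t' htt

end adm

section opt
variable [Fintype V] {G : SimpleGraph V} {c c' : V → Bool}

/-- Admissible colourings with the largest number of signatures. -/
structure Opt (G : SimpleGraph V) (c : V → Bool) : Prop where
  adm : Adm G c
  max : ∀ c', Adm G c' → D G c' Finset.univ ≤ D G c Finset.univ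

theorem Opt.improve (h : Opt G c) (h' : Adm G c') (key : ∀ x, Touched G c c' x → ¬ Bad G c' x)
    (hr : Repaired G c c' (fun _ => True)) : False := by
  have := (mono_of_touched (A := Finset.univ) fun x _ => key x).2 (by simpa using hr)
  have := h.max c' h'
  omega

theorem Opt.step (h : Opt G c) (h' : Adm G c') (e : V)
    (key : ∀ x, x ≠ e → Touched G c c' x → ¬ Bad G c' x)
    (hr : Repaired G c c' (· ≠ e)) : Opt G c' ∧ Touched G c c' e ∧ Bad G c' e := by
  classical
  have hmain : ¬ ¬ (Touched G c c' e ∧ Bad G c' e) := by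
    intro hne
    refine h.improve h' (fun x hx hb => ?_) (hr.mono fun _ _ => trivial)
    by_cases hxe : x = e
    · subst hxe; exact hne ⟨hx, hb⟩
    · exact key x hxe hx hb
  refine ⟨⟨h', fun c'' h'' => ?_⟩, not_not.1 hmain⟩
  have h1 := (mono_of_touched (A := Finset.univ.erase e)
    fun x hx => key x (by simpa using hx)).2 (by simpa using hr)
  have h2 := D_insert_le G c Finset.univ e
  have h3 : D G c' (Finset.univ.erase e) ≤ D G c' Finset.univ := by
    classical
    unfold D
    exact Finset.card_le_card (Finset.image_subset_image
      (Finset.filter_subset_filter _ (Finset.erase_subset _ _)))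
  have := h.max c'' h''
  omega

/-- Recolouring a single bad vertex. -/
theorem Opt.flip_bad (h : Opt G c) {x m : V} (hx : Bad G c x) (hm : G.Adj x m) (hcm : c m = c x)
    (ht : ∀ y, ¬ Twin G x y) :
    ∃ c' : V → Bool, Opt G c' ∧ c' x = (!c x) ∧ (∀ y, y ≠ x → c' y = c y) ∧
      ∃ s, c s ≠ c x ∧ Same G c' x s ∧ ∀ z, c z = c x → z ≠ x → (G.Adj s z ↔ G.Adj x z) := by
  classical
  obtain ⟨c', h1, h2⟩ := exists_flip c (· = x)
  have h1 := h1 x rfl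
  have hadm : Adm G c' := by
    refine adm_of_flip h.adm (fun y z hy => ?_) (fun p q hp hpq => ?_)
    · by_cases hyx : y = x
      · subst hyx; exact ht z
      · exact absurd (h2 y hyx) hy
    · have hpx : p ≠ x := by rintro rfl; exact not_special h.adm hm hcm hp
      have hqx : q ≠ x := by
        rintro rfl; exact not_supp_of_bad h.adm hx (hp q hpq)
      simp [h2 p hpx, h2 q hqx]
  have hA : D G c (Finset.univ.erase x) ≤ D G c' (Finset.univ.erase x) := by
    refine (D_mono G c c' _ ?_ ?_).1
    · intro y hy z hz hs
      have hy : y ≠ x := by simpa using hy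
      have hz : z ≠ x := by simpa using hz
      have hyz : c y = c z := by rw [← h2 y hy, ← h2 z hz, hs.1]
      have aux : ∀ y z, y ≠ x → z ≠ x → Same G c' y z → c x ≠ c y → G.Adj y x → G.Adj z x := by
        intro y z hy hz hs hxy hyx
        have hyz : c y = c z := by rw [← h2 y hy, ← h2 z hz, hs.1]
        obtain hx | ⟨v, hv, hxv⟩ := hx
        · exact absurd (hx y hyx.symm).symm hxy
        · have hvy := (hxv.2 y (Ne.symm hxy)).1 hyx.symm
          have := (hs.2 v (by rw [h2 v hv, h2 y hy, ← hxv.1]; exact hxy)).1 hvy.symm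
          exact ((hxv.2 z (by rw [← hyz]; exact Ne.symm hxy)).2 this.symm).symm
      refine ⟨hyz, fun w hw => ?_⟩
      by_cases hwx : w = x
      · subst hwx
        exact ⟨aux y z hy hz hs hw, aux z y hz hy (same_symm hs) (by rwa [← hyz])⟩
      · exact hs.2 w (by rwa [h2 w hwx, h2 y hy])
    · intro y hy he w hw
      have hy : y ≠ x := by simpa using hy
      by_cases hwx : w = x
      · subst hwx
        by_contra hne
        obtain hx | ⟨v, hv, hxv⟩ := hx
        · exact hne (hx y hw.symm).symm
        · have hvy := (hxv.2 y (Ne.symm hne)).1 hw.symm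
          have := he v hvy.symm
          rw [h2 v hv, h2 y hy, ← hxv.1] at this
          exact hne this
      · rw [← h2 w hwx, ← h2 y hy]; exact he w hw
  have hB : D G c Finset.univ ≤ D G c (Finset.univ.erase x) := by
    refine D_erase_bad G c _ x ?_
    obtain hx | ⟨v, hv, hxv⟩ := hx
    · exact Or.inl hx
    · exact Or.inr ⟨v, Finset.mem_univ _, hv, hxv⟩
  have hne : ¬ Emp G c' x := by
    intro he
    have := he m hm
    rw [h2 m hm.ne', h1, hcm] at this
    simp at this
  have hbad : ∃ s, s ≠ x ∧ Same G c' s x := by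
    by_contra hcon
    push Not at hcon
    have := D_insert_fine G c' Finset.univ x (Finset.mem_univ _) hne fun v _ => hcon v
    have := h.max c' hadm
    omega
  refine ⟨c', ⟨hadm, fun c'' h'' => ?_⟩, h1, h2, ?_⟩
  · have h3 : D G c' (Finset.univ.erase x) ≤ D G c' Finset.univ := by
      unfold D
      exact Finset.card_le_card (Finset.image_subset_image
        (Finset.filter_subset_filter _ (Finset.erase_subset _ _)))
    have := h.max c'' h''
    omega
  · obtain ⟨s, hs, hsx⟩ := hbad
    have hcs : c s ≠ c x := by
      have := hsx.1
      rw [h2 s hs, h1] at this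
      rw [this]; simp
    refine ⟨s, hcs, same_symm hsx, fun z hz hzx => hsx.2 z ?_⟩
    rw [h2 z hzx, h2 s hs, hz]
    exact hcs.symm

end opt
end LD

namespace LD
variable {V : Type*}

/-- The properties of the graph used by the recolouring argument. -/
structure Ctx (G : SimpleGraph V) : Prop where
  sub : ∀ x a b d e, G.Adj x a → G.Adj x b → G.Adj x d → G.Adj x e →
    a ≠ b → a ≠ d → b ≠ d → e = a ∨ e = b ∨ e = d
  tw : ∀ t t', Twin G t t' →
    ∃ a b d, a ≠ b ∧ a ≠ d ∧ b ≠ d ∧ ∀ x, G.Adj t x ↔ x = a ∨ x = b ∨ x = d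
  small : ∀ a b d e, ¬ ∀ x y, x = a ∨ x = b ∨ x = d ∨ x = e → G.Adj x y →
    y = a ∨ y = b ∨ y = d ∨ y = e

section
variable {G : SimpleGraph V} {c c' : V → Bool}

theorem bool_eq {i j k : Bool} (h : i ≠ j) (h' : k ≠ j) : i = k := by
  revert h h'; cases i <;> cases j <;> cases k <;> simp

theorem Twin.symm {u v : V} (h : Twin G u v) : Twin G v u :=
  ⟨h.1.symm, fun x => (h.2 x).symm⟩

/-- Neighbourhood of a vertex with two known neighbours. -/
theorem Ctx.nbr2 (hG : Ctx G) {x a b : V} (ha : G.Adj x a) (hb : G.Adj x b) (hab : a ≠ b) :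
    (∀ z, G.Adj x z ↔ z = a ∨ z = b) ∨
      ∃ d, d ≠ a ∧ d ≠ b ∧ ∀ z, G.Adj x z ↔ z = a ∨ z = b ∨ z = d := by
  by_cases h : ∃ d, G.Adj x d ∧ d ≠ a ∧ d ≠ b
  · obtain ⟨d, hd, hda, hdb⟩ := h
    refine Or.inr ⟨d, hda, hdb, fun z => ⟨fun hz => ?_, ?_⟩⟩
    · exact hG.sub x a b d z ha hb hd hz hab hda.symm hdb.symm
    · rintro (rfl | rfl | rfl) <;> assumption
  · push Not at h
    refine Or.inl fun z => ⟨fun hz => ?_, ?_⟩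
    · grind
    · rintro (rfl | rfl) <;> assumption

theorem Ctx.nbr3 (hG : Ctx G) {x a b d : V} (ha : G.Adj x a) (hb : G.Adj x b) (hd : G.Adj x d)
    (hab : a ≠ b) (had : a ≠ d) (hbd : b ≠ d) :
    ∀ z, G.Adj x z ↔ z = a ∨ z = b ∨ z = d := by
  intro z
  refine ⟨fun hz => hG.sub x a b d z ha hb hd hz hab had hbd, ?_⟩
  rintro (rfl | rfl | rfl) <;> assumption

theorem Twin.third {t t' : V} (hG : Ctx G) (h : Twin G t t') {a b : V} (ha : G.Adj t a)
    (hb : G.Adj t b) (hab : a ≠ b) :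
    ∃ d, d ≠ a ∧ d ≠ b ∧ ∀ z, G.Adj t z ↔ z = a ∨ z = b ∨ z = d := by
  obtain ⟨p, q, r, h1, h2, h3, h4⟩ := hG.tw t t' h
  obtain h5 | h5 := hG.nbr2 ha hb hab
  · have := (h4 p).2 (by simp)
    have := (h4 q).2 (by simp)
    have := (h4 r).2 (by simp)
    grind
  · exact h5

theorem adm_of_flip' (h : Adm G c) (H : ∀ x, c' x ≠ c x → (∀ y, ¬ Twin G x y) ∧
    (Special G x → ∀ m, G.Adj x m → c' m ≠ c m) ∧
    (Supp G x → ∀ p, G.Adj x p → Special G p → c' p ≠ c p)) : Adm G c' := by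
  refine adm_of_flip h (fun x y hx => (H x hx).1 y) (fun p m hp hpm => ?_)
  by_cases h1 : c' p = c p
  · simp only [h1, true_iff]
    by_contra h2
    exact (H m h2).2.2 (hp m hpm) p hpm.symm hp h1
  · simpa [h1] using (H p h1).2.1 hp m hpm

theorem not_bad_of (x z : V) (hz : G.Adj x z) (hcz : c' z ≠ c' x)
    (h : ∀ v, G.Adj z v → v ≠ x → c' v = c' x → ∃ y, c' y ≠ c' x ∧ ¬ (G.Adj x y ↔ G.Adj v y)) :
    ¬ Bad G c' x := by
  rintro (he | ⟨v, hv, hs⟩)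
  · exact hcz (he z hz)
  · obtain ⟨y, hy, hn⟩ := h v ((hs.2 z hcz).1 hz).symm hv hs.1.symm
    exact hn (hs.2 y hy)

variable [Fintype V]

/-- A vertex of an unlocated pair has no neighbour with an open twin. -/
theorem Opt.conflict_not_adj_twin (hG : Ctx G) (h : Opt G c) {u v t t' : V} (huv : u ≠ v)
    (hs : Same G c u v) (ht : Twin G t t') (htu : G.Adj t u) : False := by
  obtain ⟨p, q, hpq, hpu, hqu, hpp⟩ : ∃ p q, Twin G p q ∧ G.Adj p u ∧ c p = c u ∧ c q ≠ c u := by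
    have := h.adm.twin t t' ht
    by_cases htc : c t = c u
    · exact ⟨t, t', ht, htu, htc, by rw [← htc]; exact this.symm⟩
    · exact ⟨t', t, ht.symm, (ht.2 u).1 htu, bool_eq this.symm (Ne.symm htc), htc⟩
  have hqv : G.Adj q v := ((hs.2 q hpp).1 ((hpq.2 u).1 hpu).symm).symm
  have hpv : G.Adj p v := (hpq.2 v).2 hqv
  obtain ⟨d, hdu, hdv, hN⟩ := hpq.third hG hpu hpv huv
  have key : ∀ x y, x ≠ y → Same G c x y → (x = u ∧ y = v) ∨ (x = v ∧ y = u) →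
      c d ≠ c x ∧ ∀ z, c z = c x → z ≠ x → (G.Adj d z ↔ G.Adj x z) := by
    intro x y hxy hsxy hor
    have hNx : ∀ z, G.Adj p z ↔ z = x ∨ z = y ∨ z = d := by grind
    have hpx : G.Adj p x := (hNx x).2 (by simp)
    by_cases htx : ∃ x', Twin G x x'
    · obtain ⟨x', hx'⟩ := htx
      have h1 := h.adm.twin x x' hx'
      have h2 := (hNx x').1 ((hx'.2 p).1 hpx.symm).symm
      have : x' = d := by
        have := hx'.1
        have := hsxy.1
        grind
      subst this
      exact ⟨h1.symm, fun z _ _ => (hx'.2 z).symm⟩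
    · push Not at htx
      obtain ⟨c', -, -, -, s, hs1, -, hs3⟩ := h.flip_bad (Or.inr ⟨y, hxy.symm, hsxy⟩)
        hpx.symm (by have := hs.1; grind) htx
      have h1 := (hs3 p (by have := hs.1; grind) hpx.ne).2 hpx.symm
      have h2 := (hNx s).1 h1.symm
      have : s = d := by
        have := hsxy.1
        grind
      subst this
      exact ⟨hs1, hs3⟩
  obtain ⟨hd1, hu⟩ := key u v huv hs (by simp)
  obtain ⟨-, hv⟩ := key v u huv.symm (same_symm hs) (by simp)
  have hcuv := hs.1
  have hpd := (hN d).2 (by simp)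
  have hqd := (hpq.2 d).1 hpd
  have hnadj : ¬ G.Adj u v := by
    intro hadj
    have h1 := (hu v hcuv.symm huv.symm).2 hadj
    have h2 := (hv u hcuv huv).2 hadj.symm
    have h3 := hG.sub d p q u v hpd.symm hqd.symm h2 h1 hpq.1 hpu.ne ((hpq.2 u).1 hpu).ne
    have := hpv.ne
    have := hqv.ne
    grind
  refine h.adm.twin u v ⟨huv, fun z => ?_⟩ hcuv
  by_cases hcz : c z = c u
  · by_cases hzu : z = u
    · subst hzu; simpa using fun h => hnadj h.symm
    by_cases hzv : z = v
    · subst hzv; simpa using hnadj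
    rw [← hu z hcz hzu, ← hv z (hcz.trans hcuv) hzv]
  · exact hs.2 z hcz

end
end LD

namespace LD
section
variable {V : Type*} {G : SimpleGraph V} {c c' : V → Bool} [Fintype V]

theorem Opt.conflict_not_adj_single (hG : Ctx G) (h : Opt G c) {u v w : V} (hs : Same G c u v)
    (huv : G.Adj u v) (huw : G.Adj u w) (hcw : c w ≠ c u)
    (hw : ∀ x, G.Adj u x → c x ≠ c u → x = w) : False := by
  have hne := huv.ne
  have hntu : ∀ y, ¬ Twin G u y := fun y hy =>
    h.conflict_not_adj_twin hG hne.symm (same_symm hs) hy huv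
  have hntv : ∀ y, ¬ Twin G v y := fun y hy =>
    h.conflict_not_adj_twin hG hne hs hy huv.symm
  have hbu : Bad G c u := Or.inr ⟨v, hne.symm, hs⟩
  have hbv : Bad G c v := Or.inr ⟨u, hne, same_symm hs⟩
  have hcv := hs.1
  have hvw := (hs.2 w hcw).1 huw
  have hwv : ∀ x, G.Adj v x → c x ≠ c u → x = w := fun x hx hcx => hw x ((hs.2 x hcx).2 hx) hcx
  have fr : ∀ u v, Same G c u v → G.Adj u v → G.Adj v w → c w ≠ c u →
      (∀ x, G.Adj v x → c x ≠ c u → x = w) → (∀ y, ¬ Twin G u y) →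
      ∀ z, c z = c u → z ≠ u → (G.Adj w z ↔ G.Adj u z) := by
    intro u v hs huv hvw hcw hwv hntu
    obtain ⟨c', -, -, -, s, hs1, -, hs3⟩ :=
      h.flip_bad (Or.inr ⟨v, huv.ne', hs⟩) huv hs.1.symm hntu
    have h1 := (hs3 v hs.1.symm huv.ne').2 huv
    have : s = w := hwv s h1.symm hs1
    subst this
    exact hs3
  have hMu := fr u v hs huv hvw hcw hwv hntu
  have hMv := fr v u (same_symm hs) huv.symm huw (by rwa [← hcv]) (by rwa [← hcv]) hntv
  obtain hNu | ⟨p, hpv, hpw, hNu⟩ := hG.nbr2 huv huw (by grind)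
  · have hNv : ∀ x, G.Adj v x ↔ x = u ∨ x = w := by
      intro x
      constructor
      · intro hx
        by_cases hcx : c x = c v
        · by_cases hxu : x = u
          · exact Or.inl hxu
          have h2 := (hMu x (by rw [hcx, hcv]) hxu).1 ((hMv x hcx hx.ne').2 hx)
          exact absurd (((hNu x).1 h2).resolve_left hx.ne') (fun e => hcw (by rw [← e, hcx, hcv]))
        · exact Or.inr (hwv x hx (by rwa [hcv]))
      · rintro (rfl | rfl)
        · exact huv.symm
        · exact hvw
    obtain hNw | ⟨q, hqu, hqv, hNw⟩ := hG.nbr2 huw.symm hvw.symm hne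
    · exact hG.small u v w w (by grind)
    · have hcq : c q = c w := by
        by_contra hcq
        have := (hMu q (bool_eq hcq hcw.symm) hqu).1 ((hNw q).2 (by simp))
        grind
      obtain ⟨c', h1, h2⟩ := exists_flip c (fun x => x = u ∨ x = w)
      have e1 := h1 u (by simp)
      have e2 := h1 w (by simp)
      have e3 := h2 v (by grind)
      have := ((hNw q).2 (by simp)).ne
      have e4 := h2 q (by grind)
      have hcw' := Bool.eq_not_of_ne hcw
      refine h.improve (c' := c') (adm_of_flip' h.adm ?_) ?_ ?_
      · intro x hx
        have : x = u ∨ x = w := by grind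
        obtain rfl | rfl := this
        · exact ⟨hntu, fun h' => absurd h' (not_special h.adm huv hcv.symm),
            fun h' => absurd h' (not_supp_of_bad h.adm hbu)⟩
        · exact ⟨fun y hy => h.conflict_not_adj_twin hG hne hs hy huw.symm,
            fun h' => absurd (h' u huw.symm) (not_supp_of_bad h.adm hbu),
            fun h' p hp hsp => by
              have := (hNw p).1 hp
              have h5 := not_special h.adm huv hcv.symm
              have h6 := not_special h.adm huv.symm hcv
              have h7 := not_special h.adm ((hNw q).2 (by simp)).symm hcq.symm
              grind⟩
      · intro x hx
        have : x = u ∨ x = v ∨ x = w := by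
          obtain hx | ⟨f, hf, hf1, hf2⟩ := hx
          · grind
          · have : f = u ∨ f = w := by grind
            have := hf.symm
            grind
        obtain rfl | rfl | rfl := this
        · refine not_bad_of x v huv (by grind) ?_
          grind
        · refine not_bad_of x u huv.symm (by grind) ?_
          intro y hy _ _
          refine ⟨q, ?_, ?_⟩ <;> grind
        · refine not_bad_of x u huw.symm (by grind) ?_
          intro y hy _ _
          refine ⟨q, ?_, ?_⟩ <;> grind
      · refine Or.inr ⟨u, v, trivial, trivial, hs, fun he => hcw (he w huw), fun h' => ?_⟩
        have := h'.1
        grind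
  · have hcp : c p = c u := by
      by_contra hcp
      exact hpw (hw p ((hNu p).2 (by simp)) hcp)
    have hup := (hNu p).2 (by simp)
    have hwp := (hMu p hcp hup.ne').2 hup
    have hvp := (hMv p (by rw [hcp, hcv]) hpv).1 hwp
    have := hG.nbr3 hvp huv.symm hvw hup.ne' hwp.ne' huw.ne
    have := hG.nbr3 hwp huw.symm hvw.symm hup.ne' hpv hne
    have := hG.nbr3 hwp.symm hup.symm hvp.symm huw.ne' hvw.ne' hne
    exact hG.small u v w p (by grind)

/-- The vertices of an unlocated pair are not adjacent. -/
theorem Opt.conflict_not_adj (hG : Ctx G) (h : Opt G c) {u v : V} (hs : Same G c u v)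
    (huv : G.Adj u v) : False := by
  have hne := huv.ne
  have hntu : ∀ y, ¬ Twin G u y := fun y hy =>
    h.conflict_not_adj_twin hG hne.symm (same_symm hs) hy huv
  have hcv := hs.1
  obtain ⟨c', h', e1, e2, s, hs1, hs2, hs3⟩ :=
    h.flip_bad (Or.inr ⟨v, huv.ne', hs⟩) huv hs.1.symm hntu
  have hsv := (hs3 v hs.1.symm huv.ne').2 huv
  have hsu := (hs.2 s hs1).2 hsv.symm
  by_cases hex : ∃ w, G.Adj u w ∧ c w ≠ c u ∧ w ≠ s
  · obtain ⟨w, huw, hcw, hws⟩ := hex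
    have hNu := hG.nbr3 huv hsu huw (by grind) (by grind) hws.symm
    refine h'.conflict_not_adj_single hG hs2 hsu huv ?_ ?_
    · rw [e2 v hne.symm, e1, hcv]; simp
    · intro x hx hcx
      rw [e2 x hx.ne', e1] at hcx
      have := Bool.eq_not_of_ne hs1
      have := Bool.eq_not_of_ne hcw
      have := (hNu x).1 hx
      grind
  · push Not at hex
    exact h.conflict_not_adj_single hG hs huv hsu hs1 hex

end
end LD

namespace LD
variable {V : Type*} {G : SimpleGraph V} {c c' : V → Bool}

theorem adm_of_losers (h : Adm G c) (ht : ∀ x y, c' x ≠ c x → ¬ Twin G x y)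
    (hl : ∀ x m, c' x = (!c x) → G.Adj x m → c m = (!c x) → c' m = c m →
      ¬ Special G x ∧ ¬ Special G m) : Adm G c' := by
  refine adm_of_flip h ht fun p m hp hpm => ?_
  have hcpm := h.spec p m hp hpm
  constructor
  · intro h1
    by_contra h2
    exact (hl m p (Bool.eq_not_of_ne h2) hpm.symm (Bool.eq_not_of_ne hcpm) h1).2 hp
  · intro h1
    by_contra h2
    exact (hl p m (Bool.eq_not_of_ne h2) hpm (Bool.eq_not_of_ne hcpm.symm) h1).1 hp

theorem Touched.cases {x : V} (h : Touched G c c' x) :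
    c' x = (!c x) ∨ ∃ f, G.Adj f x ∧ c' f = (!c f) ∧ c x = !c f := by
  obtain h | ⟨f, h1, h2, h3⟩ := h
  · exact Or.inl (Bool.eq_not_of_ne h)
  · exact Or.inr ⟨f, h1.symm, Bool.eq_not_of_ne h2, Bool.eq_not_of_ne h3.symm⟩

/-- A vertex with two neighbours is not a leaf. -/
theorem not_leaf {x a b : V} (ha : G.Adj x a) (hb : G.Adj x b) (hab : a ≠ b) : ¬ Leaf G x := by
  rintro ⟨m, hm⟩
  exact hab (((hm a).1 ha).trans ((hm b).1 hb).symm)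

/-- An unlocated pair `u`, `v` whose first member has one neighbour `w` of the other colour
and two neighbours `y`, `y'` of its own colour `k`; recolouring `u` creates a pair with `s`. -/
structure PConf (G : SimpleGraph V) (c : V → Bool) (k : Bool) (u v w y y' s : V) : Prop where
  ne_uv : u ≠ v
  same : Same G c u v
  nt_u : ∀ x, ¬ Twin G u x
  nt_y : ∀ x, ¬ Twin G y x
  nt_y' : ∀ x, ¬ Twin G y' x
  nbr_u : ∀ x, G.Adj u x ↔ x = w ∨ x = y ∨ x = y'
  cu : c u = k
  cv : c v = k
  cw : c w = !k
  cy : c y = k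
  cy' : c y' = k
  cs : c s = !k
  ne_yy : y ≠ y'
  ne_sw : s ≠ w
  nadj : ¬ G.Adj u v
  vw : G.Adj v w
  vy : ¬ G.Adj v y
  vy' : ¬ G.Adj v y'
  sy : G.Adj s y
  sy' : G.Adj s y'
  opp_s : ∀ x, c x = k → G.Adj s x → x = y ∨ x = y'
  common : ∀ x, G.Adj y x → G.Adj y' x → x = u ∨ x = s

theorem PConf.symm {k : Bool} {u v w y y' s : V} (p : PConf G c k u v w y y' s) :
    PConf G c k u v w y' y s where
  ne_uv := p.ne_uv
  same := p.same
  nt_u := p.nt_u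
  nt_y := p.nt_y'
  nt_y' := p.nt_y
  nbr_u x := by rw [p.nbr_u x, or_comm (a := x = y)]
  cu := p.cu
  cv := p.cv
  cw := p.cw
  cy := p.cy'
  cy' := p.cy
  cs := p.cs
  ne_yy := p.ne_yy.symm
  ne_sw := p.ne_sw
  nadj := p.nadj
  vw := p.vw
  vy := p.vy'
  vy' := p.vy
  sy := p.sy'
  sy' := p.sy
  opp_s x hx hs := (p.opp_s x hx hs).symm
  common x hx hx' := p.common x hx' hx

section
variable [Fintype V]

theorem Opt.pconf (hG : Ctx G) (h : Opt G c) {u v w y y' : V} (huv : u ≠ v) (hs : Same G c u v)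
    (hut : ∀ x, ¬ Twin G u x) (hN : ∀ x, G.Adj u x ↔ x = w ∨ x = y ∨ x = y') (hyy : y ≠ y')
    (hcw : c w ≠ c u) (hcy : c y = c u) (hcy' : c y' = c u) :
    ∃ s, PConf G c (c u) u v w y y' s := by
  have hcv := hs.1
  have huw := (hN w).2 (by simp)
  have huy := (hN y).2 (by simp)
  have huy' := (hN y').2 (by simp)
  have hnadj := fun e => h.conflict_not_adj hG hs e
  have hnt : ∀ x y, G.Adj u x → ¬ Twin G x y := fun x y hx ht =>
    h.conflict_not_adj_twin hG huv hs ht hx.symm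
  have hntv : ∀ x y, G.Adj v x → ¬ Twin G x y := fun x y hx ht =>
    h.conflict_not_adj_twin hG huv.symm (same_symm hs) ht hx.symm
  have hvw := (hs.2 w hcw).1 huw
  obtain ⟨-, -, -, -, s, hs1, -, hs3⟩ := h.flip_bad (Or.inr ⟨v, huv.symm, hs⟩) huy hcy hut
  have hsy := (hs3 y hcy huy.ne').2 huy
  have hsy' := (hs3 y' hcy' huy'.ne').2 huy'
  have hsw : s ≠ w := by
    rintro rfl
    exact hnadj ((hs3 v hcv.symm huv.symm).1 hvw.symm)
  have hus : ¬ G.Adj u s := by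
    intro hus
    have := (hN s).1 hus
    grind
  have hcommon : ∀ x, G.Adj y x → G.Adj y' x → x = u ∨ x = s := by
    intro x hx hx'
    by_contra hcon
    push Not at hcon
    have hsu : s ≠ u := by rintro rfl; exact hs1 rfl
    have h1 := hG.nbr3 huy.symm hsy.symm hx hsu.symm hcon.1.symm hcon.2.symm
    have h2 := hG.nbr3 huy'.symm hsy'.symm hx' hsu.symm hcon.1.symm hcon.2.symm
    exact hnt y y' huy ⟨hyy, fun z => by rw [h1, h2]⟩
  have hvyy : ∀ y y', G.Adj u y → G.Adj u y' → c y = c u → c y' = c u → y ≠ y' → G.Adj s y →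
      G.Adj s y' → (∀ x, G.Adj y x → G.Adj y' x → x = u ∨ x = s) → ¬ G.Adj v y := by
    intro y y' huy huy' hcy hcy' hyy hsy hsy' hcommon hvy
    have hsu : s ≠ u := by rintro rfl; exact hs1 rfl
    have hsv : s ≠ v := by rintro rfl; exact hs1 hcv.symm
    have hNy := hG.nbr3 huy.symm hsy.symm hvy.symm hsu.symm huv hsv
    have hsv' : G.Adj v y' := by
      by_cases hvt : ∃ v', Twin G v v'
      · obtain ⟨v', hv'⟩ := hvt
        have h1 := h.adm.twin v v' hv'
        have h2 := (hNy v').1 ((hv'.2 y).1 hvy).symm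
        have : v' = s := by
          have := hv'.1
          grind
        subst this
        exact (hv'.2 y').2 hsy'
      · push Not at hvt
        obtain ⟨-, -, -, -, r, hr1, -, hr3⟩ :=
          h.flip_bad (Or.inr ⟨u, huv, same_symm hs⟩) hvy (hcy.trans hcv) hvt
        have h1 := (hr3 y (hcy.trans hcv) hvy.ne').2 hvy
        have h2 := (hNy r).1 h1.symm
        have : r = s := by grind
        subst this
        refine (hr3 y' (hcy'.trans hcv) ?_).1 hsy'
        rintro rfl
        exact hnadj huy'
    have := hcommon v hvy.symm hsv'.symm
    grind
  refine ⟨s, huv, hs, hut, fun x => hnt y x huy, fun x => hnt y' x huy', hN, rfl, hcv.symm,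
    Bool.eq_not_of_ne hcw, hcy, hcy', Bool.eq_not_of_ne hs1, hyy, hsw, hnadj, hvw,
    hvyy y y' huy huy' hcy hcy' hyy hsy hsy' hcommon,
    hvyy y' y huy' huy hcy' hcy hyy.symm hsy' hsy fun x hx hx' => hcommon x hx' hx,
    hsy, hsy', fun x hx hsx => ?_, hcommon⟩
  by_cases hxu : x = u
  · subst hxu; exact absurd hsx.symm hus
  · have h1 := (hs3 x hx hxu).1 hsx
    have h2 := (hN x).1 h1
    grind

end
end LD

namespace LD
variable {V : Type*} {G : SimpleGraph V} {c c' : V → Bool} {k : Bool} {u v w y y' s : V}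

theorem PConf.not_bad_y (p : PConf G c k u v w y y' s) (hu : c' u = k) (hv : c' v = k)
    (hy : c' y = !k) (h : c' y' = !k → ∃ q, c' q = k ∧ ¬ (G.Adj y q ↔ G.Adj y' q)) :
    ¬ Bad G c' y := by
  have h1 := p.nbr_u
  have h2 := p.vw
  have h3 := p.vy
  refine not_bad_of y u ((p.nbr_u y).2 (by simp)).symm (by simp [hu, hy]) fun x hx hxy hcx => ?_
  obtain rfl | rfl | rfl := (p.nbr_u x).1 hx
  · exact ⟨v, by simp [hv, hy], fun h => p.vy (h.2 p.vw.symm).symm⟩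
  · exact absurd rfl hxy
  · obtain ⟨q, hq, hq'⟩ := h (hcx.trans hy)
    exact ⟨q, by simp [hq, hy], hq'⟩

theorem PConf.repaired (p : PConf G c k u v w y y' s) {A : V → Prop} (hAu : A u) (hAv : A v)
    (hu : c' u = k) (hy : c' y = !k) : Repaired G c c' A := by
  refine Or.inr ⟨u, v, hAu, hAv, p.same, fun he => ?_, fun h' => ?_⟩
  · have := he w ((p.nbr_u w).2 (by simp))
    rw [p.cw, p.cu] at this
    simp at this
  · exact p.vy ((h'.2 y (by simp [hu, hy])).1 ((p.nbr_u y).2 (by simp)))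

/-- The vertex `s` is told apart from `u` by `w`. -/
theorem PConf.not_sw (hG : Ctx G) (p : PConf G c k u v w y y' s) : ¬ G.Adj s w := by
  intro hsw
  have h1 := p.nbr_u
  have h2 := ((p.nbr_u w).2 (by simp)).ne
  have hk := p.cw
  have h3 := p.cy
  have h4 := p.cy'
  have h5 := p.cs
  have h6 := p.cu
  have h7 := hG.nbr3 p.sy p.sy' hsw p.ne_yy (by grind) (by grind)
  refine p.nt_u s ⟨by grind, fun x => by rw [h1, h7]; grind⟩

theorem PConf.nt_s (p : PConf G c k u v w y y' s) : ∀ x, ¬ Twin G s x := by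
  intro x hx
  obtain rfl | rfl := p.common x ((hx.2 y).1 p.sy).symm ((hx.2 y').1 p.sy').symm
  · exact p.nt_u s hx.symm
  · exact hx.1 rfl

theorem PConf.distinct (p : PConf G c k u v w y y' s) : u ≠ y ∧ u ≠ y' ∧ u ≠ w ∧ u ≠ s ∧
    v ≠ y ∧ v ≠ y' ∧ v ≠ w ∧ v ≠ s ∧ y ≠ w ∧ y ≠ s ∧ y' ≠ w ∧ y' ≠ s := by
  have h1 := p.nbr_u
  have h2 := G.irrefl (v := u)
  have h3 := p.nadj
  have h4 := p.cu
  have h5 := p.cv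
  have h6 := p.cw
  have h7 := p.cy
  have h8 := p.cy'
  have h9 := p.cs
  grind

theorem PConf.ne_us (p : PConf G c k u v w y y' s) : u ≠ s := by
  rintro rfl
  have h1 := p.cu
  have h2 := p.cs
  rw [h1] at h2
  simp at h2

section
variable [Fintype V]

theorem PConf.priv_of_free (h : Opt G c) (p : PConf G c k u v w y y' s)
    (hno : ∀ x, G.Adj y' x → c x = !k → x = s) :
    ∃ q, G.Adj y q ∧ q ≠ s ∧ c q = !k ∧ ∀ x, G.Adj q x → c x = k → x = y := by
  by_contra hcon
  push Not at hcon
  obtain ⟨c', h1, h2⟩ := exists_flip c (fun x => x = y')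
  obtain ⟨huv, hs, hut, hnty, hnty', hN, hu, hv, hw, hy, hy', hcs, hyy, hsw,
    huv', hvw, hvy, hvy', hsy,
    hsy', hos, hcom⟩ := p
  have p : PConf G c k u v w y y' s := by constructor <;> assumption
  have hd := p.distinct
  have e0 := h1 y' rfl
  have e1 := h2 y (by grind)
  have e2 := h2 u (by grind)
  have e3 := h2 v (by grind)
  have e4 := h2 s (by grind)
  have hus := p.ne_us
  have huy := (hN y).2 (by simp)
  have huy' := (hN y').2 (by simp)
  refine h.improve (c' := c') (adm_of_losers h.adm ?_ ?_) ?_ ?_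
  · grind
  · intro x m hx hxm hcm hm
    have : x = y' := by grind
    subst this
    have : m = s := hno m hxm (by grind)
    subst this
    refine ⟨not_special h.adm huy'.symm (by grind), fun hsp => ?_⟩
    obtain ⟨l, hl, hl'⟩ := hsp x hsy'
    have h3 := Bool.eq_not_of_ne (leaf_opp h.adm hl' hl.symm)
    have h4 := hno l hl (by grind)
    subst h4
    exact not_leaf hsy hsy' hyy hl'
  · intro x hx
    have : x = y' ∨ x = s := by
      obtain hx | ⟨f, hf, hf1, hf2⟩ := hx.cases
      · grind
      · have : f = y' := by grind
        subst this
        exact Or.inr (hno x hf (by grind))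
    obtain rfl | rfl := this
    · exact p.symm.not_bad_y (by grind) (by grind) (by grind) (by grind)
    · refine not_bad_of x y hsy (by grind) fun q hq hqs hcq => ?_
      by_cases hqy' : q = y'
      · subst hqy'
        exact ⟨u, by grind, by grind [G.adj_comm]⟩
      obtain ⟨z, hz, hz1, hz2⟩ := hcon q hq hqs (by grind)
      have : z ≠ y' := by
        rintro rfl
        have := hcom q hq hz.symm
        grind
      have := hos z hz1
      exact ⟨z, by grind, by grind⟩
  · exact p.symm.repaired trivial trivial (by grind) (by grind)

theorem PConf.flip_four (hG : Ctx G) (h : Opt G c) (p : PConf G c k u v w y y' s) {q e : V}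
    (hyq : G.Adj y q) (hqs : q ≠ s) (hcq : c q = !k) (hq : ∀ x, G.Adj q x → c x = k → x = y)
    (he : ∀ x, G.Adj y' x → c x = !k → x = s ∨ x = e) (hce : c e = !k)
    (hes : e ≠ s) (heq : e ≠ q) (hsp : G.Adj y' e → ¬ Special G e) :
    ∃ c', Opt G c' ∧ (∀ x, x = y ∨ x = y' ∨ x = s ∨ x = q → c' x = !c x) ∧
      (∀ x, ¬ (x = y ∨ x = y' ∨ x = s ∨ x = q) → c' x = c x) ∧ Touched G c c' e ∧
      Bad G c' e := by
  obtain ⟨c', h1, h2⟩ := exists_flip c (fun x => x = y ∨ x = y' ∨ x = s ∨ x = q)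
  have hnsw := p.not_sw hG
  have hnts := p.nt_s
  obtain ⟨huv, hs, hut, hnty, hnty', hN, hu, hv, hw, hy, hy', hcs, hyy, hsw,
    huv', hvw, hvy, hvy', hsy,
    hsy', hos, hcom⟩ := p
  have p : PConf G c k u v w y y' s := by constructor <;> assumption
  have hd := p.distinct
  have e0 := h1 y' (by simp)
  have e1 := h1 y (by simp)
  have e2 := h2 u (by grind)
  have e3 := h2 v (by grind)
  have e4 := h1 s (by simp)
  have e5 := h1 q (by simp)
  have hus := p.ne_us
  have huy := (hN y).2 (by simp)
  have huy' := (hN y').2 (by simp)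
  have hqy' : ¬ G.Adj y' q := fun hq' => by
    have := hcom q hyq hq'
    grind
  have hqu : q ≠ u := by grind
  have hNy := hG.nbr3 huy.symm hsy.symm hyq hus hqu.symm hqs.symm
  have hwq : w ≠ q := by
    rintro rfl
    have := hq u ((hN w).2 (by simp)).symm hu
    grind
  have e6 := h2 w (by grind)
  simp only [hu, hv, hw, hy, hy', hcs, hcq, Bool.not_not] at e0 e1 e2 e3 e4 e5 e6
  have hntq : ∀ x, ¬ Twin G q x := by
    intro x hx
    have h3 := h.adm.twin q x hx
    have h4 := (hNy x).1 ((hx.2 y).1 hyq.symm).symm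
    have h5 := hx.1
    have : x = u := by grind
    subst this
    exact hut q hx.symm
  have hstep := h.step (c' := c') (adm_of_losers h.adm ?_ ?_) e ?_ ?_
  · exact ⟨c', hstep.1, h1, h2, hstep.2⟩
  · intro x t hx
    have : x = y ∨ x = y' ∨ x = s ∨ x = q := by grind
    obtain rfl | rfl | rfl | rfl := this
    · exact hnty t
    · exact hnty' t
    · exact hnts t
    · exact hntq t
  · intro x m hx hxm hcm hm
    have hm' : ¬ (m = y ∨ m = y' ∨ m = s ∨ m = q) := fun h3 => by
      have := h1 m h3
      grind
    have : x = y ∨ x = y' ∨ x = s ∨ x = q := by grind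
    obtain rfl | rfl | rfl | rfl := this
    · have := (hNy m).1 hxm
      grind
    · have := he m hxm (by grind)
      have : m = e := by grind
      subst this
      exact ⟨not_special h.adm huy'.symm (by grind), hsp hxm⟩
    · have := hos m (by cases k <;> grind) hxm
      grind
    · have := hq m hxm (by cases k <;> grind)
      grind
  · intro x hxe hx
    have : x = y ∨ x = y' ∨ x = s ∨ x = q := by
      obtain hx | ⟨f, hf, hf1, hf2⟩ := hx.cases
      · grind
      · have : f = y ∨ f = y' ∨ f = s ∨ f = q := by grind
        obtain rfl | rfl | rfl | rfl := this
        · have := (hNy x).1 hf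
          grind
        · have := he x hf (by grind)
          grind
        · have := hos x (by cases k <;> grind) hf
          grind
        · have := hq x hf (by cases k <;> grind)
          grind
    obtain rfl | rfl | rfl | rfl := this
    · exact p.not_bad_y (by grind) (by grind) (by grind) fun _ => ⟨q, by grind, by grind⟩
    · exact p.symm.not_bad_y (by grind) (by grind) (by grind) fun _ => ⟨q, by grind, by grind⟩
    · refine not_bad_of x y hsy (by grind) fun t ht hts hct => ?_
      obtain rfl | rfl | rfl := (hNy t).1 ht
      · exact ⟨w, by grind, by grind⟩
      · exact absurd rfl hts
      · exact ⟨y', by grind, by grind [G.adj_comm]⟩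
    · refine not_bad_of x y hyq.symm (by grind) fun t ht hts hct => ?_
      exact ⟨y', by grind, by grind [G.adj_comm]⟩
  · exact p.repaired (by grind) (by grind) (by grind) (by grind)

end
end LD

namespace LD
variable {V : Type*} {G : SimpleGraph V} {c c' : V → Bool} {k : Bool} {u v w y y' s : V}

/-- A third neighbour of `y` is not a twin. -/
theorem PConf.nt_third (h : Adm G c) (p : PConf G c k u v w y y' s) {q : V}
    (hN : ∀ z, G.Adj y z ↔ z = u ∨ z = s ∨ z = q) (hcq : c q = !k) : ∀ x, ¬ Twin G q x := by
  intro x hx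
  have h3 := h.twin q x hx
  have h4 := (hN x).1 ((hx.2 y).1 ((hN q).2 (by simp)).symm).symm
  have h5 := hx.1
  have h6 := p.cs
  have : x = u := by grind
  subst this
  exact p.nt_u q hx.symm

section
variable [Fintype V]

theorem PConf.flip_five (hG : Ctx G) (h : Opt G c) (p : PConf G c k u v w y y' s) {q q' : V}
    (hyq : G.Adj y q) (hqs : q ≠ s) (hcq : c q = !k) (hq : ∀ x, G.Adj q x → c x = k → x = y)
    (hyq' : G.Adj y' q') (hqs' : q' ≠ s) (hcq' : c q' = !k)
    (hq' : ∀ x, G.Adj q' x → c x = k → x = y') : False := by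
  obtain ⟨c', h1, h2⟩ := exists_flip c (fun x => x = y ∨ x = y' ∨ x = s ∨ x = q ∨ x = q')
  have hnsw := p.not_sw hG
  have hnts := p.nt_s
  have p0 := p
  obtain ⟨huv, hs, hut, hnty, hnty', hN, hu, hv, hw, hy, hy', hcs, hyy, hsw, huv', hvw, hvy, hvy',
    hsy, hsy', hos, hcom⟩ := p
  have p := p0
  have hd := p.distinct
  have e0 := h1 y' (by simp)
  have e1 := h1 y (by simp)
  have hqu : q ≠ u := by grind
  have hqu' : q' ≠ u := by grind
  have e2 := h2 u (by grind)
  have e3 := h2 v (by grind)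
  have e4 := h1 s (by simp)
  have e5 := h1 q (by simp)
  have e7 := h1 q' (by simp)
  have hus := p.ne_us
  have huy := (hN y).2 (by simp)
  have huy' := (hN y').2 (by simp)
  have hNy := hG.nbr3 huy.symm hsy.symm hyq hus hqu.symm hqs.symm
  have hNy' := hG.nbr3 huy'.symm hsy'.symm hyq' hus hqu'.symm hqs'.symm
  have hwq : w ≠ q := by
    rintro rfl
    have := hq u ((hN w).2 (by simp)).symm hu
    grind
  have hwq' : w ≠ q' := by
    rintro rfl
    have := hq' u ((hN w).2 (by simp)).symm hu
    grind
  have hqq : q ≠ q' := by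
    rintro rfl
    have := hcom q hyq hyq'
    grind
  have e6 := h2 w (by grind)
  simp only [hu, hv, hw, hy, hy', hcs, hcq, hcq', Bool.not_not] at e0 e1 e2 e3 e4 e5 e6 e7
  have hntq := p.nt_third h.adm hNy hcq
  have hntq' := p.symm.nt_third h.adm hNy' hcq'
  have hyy1 : ¬ G.Adj y y' := by grind
  have hloser : ∀ x m, c' x = (!c x) → G.Adj x m → c m = (!c x) →
      m = y ∨ m = y' ∨ m = s ∨ m = q ∨ m = q' := by
    intro x m hx hxm hcm
    have : x = y ∨ x = y' ∨ x = s ∨ x = q ∨ x = q' := by grind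
    obtain rfl | rfl | rfl | rfl | rfl := this
    · have := (hNy m).1 hxm
      grind
    · have := (hNy' m).1 hxm
      grind
    · have := hos m (by rw [hcm, hcs, Bool.not_not]) hxm
      grind
    · have := hq m hxm (by rw [hcm, hcq, Bool.not_not])
      grind
    · have := hq' m hxm (by rw [hcm, hcq', Bool.not_not])
      grind
  refine h.improve (c' := c') (adm_of_losers h.adm ?_ ?_) ?_ ?_
  · intro x t hx
    have : x = y ∨ x = y' ∨ x = s ∨ x = q ∨ x = q' := by grind
    obtain rfl | rfl | rfl | rfl | rfl := this
    · exact hnty t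
    · exact hnty' t
    · exact hnts t
    · exact hntq t
    · exact hntq' t
  · intro x m hx hxm hcm hm
    have := h1 m (hloser x m hx hxm hcm)
    grind
  · intro x hx
    have : x = y ∨ x = y' ∨ x = s ∨ x = q ∨ x = q' := by
      obtain hx | ⟨f, hf, hf1, hf2⟩ := hx.cases
      · grind
      · exact hloser f x hf1 hf hf2
    obtain rfl | rfl | rfl | rfl | rfl := this
    · exact p.not_bad_y (by grind) (by grind) (by grind) fun _ => ⟨q, by grind, by grind⟩
    · exact p.symm.not_bad_y (by grind) (by grind) (by grind) fun _ => ⟨q, by grind, by grind⟩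
    · refine not_bad_of x y hsy (by grind) fun t ht hts hct => ?_
      obtain rfl | rfl | rfl := (hNy t).1 ht
      · exact ⟨w, by grind, by grind⟩
      · exact absurd rfl hts
      · exact ⟨y', by grind, by grind [G.adj_comm]⟩
    · refine not_bad_of x y hyq.symm (by grind) fun t ht hts hct => ?_
      exact ⟨y', by grind, by grind [G.adj_comm]⟩
    · refine not_bad_of x y' hyq'.symm (by grind) fun t ht hts hct => ?_
      exact ⟨y, by grind, by grind [G.adj_comm]⟩
  · exact p.repaired (by grind) (by grind) (by grind) (by grind)

theorem PConf.third_adj (hG : Ctx G) (h : Opt G c) (p : PConf G c k u v w y y' s) {q q' r r' : V}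
    (hyq : G.Adj y q) (hqs : q ≠ s) (hcq : c q = !k) (hqr : G.Adj q r)
    (hry : r ≠ y)
    (hyq' : G.Adj y' q') (hqs' : q' ≠ s) (hcq' : c q' = !k) (hqr' : G.Adj q' r') (hcr' : c r' = k)
    (hry' : r' ≠ y') : q ≠ w ∧ G.Adj w q := by
  obtain ⟨c', h1, h2⟩ := exists_flip c (fun x => x = y)
  have hnsw := p.not_sw hG
  have hnts := p.nt_s
  have p0 := p
  obtain ⟨huv, hs, hut, hnty, hnty', hN, hu, hv, hw, hy, hy', hcs, hyy, hsw, huv', hvw, hvy, hvy',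
    hsy, hsy', hos, hcom⟩ := p
  have p := p0
  have hd := p.distinct
  have hqy : ∀ x, c x = (!k) → x ≠ y := by
    rintro x hx rfl
    grind
  have e0 := h2 y' (by grind)
  have e1 := h1 y rfl
  have hqu : q ≠ u := by grind
  have hqu' : q' ≠ u := by grind
  have e2 := h2 u (by grind)
  have e3 := h2 v (by grind)
  have e4 := h2 s (by grind)
  have e5 := h2 q (by grind)
  have e6 := h2 w (by grind)
  have e7 := h2 q' (by grind)
  have hus := p.ne_us
  have huy := (hN y).2 (by simp)
  have huy' := (hN y').2 (by simp)
  have hNy := hG.nbr3 huy.symm hsy.symm hyq hus hqu.symm hqs.symm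
  have hNy' := hG.nbr3 huy'.symm hsy'.symm hyq' hus hqu'.symm hqs'.symm
  have hqq : q ≠ q' := by
    rintro rfl
    have := hcom q hyq hyq'
    grind
  simp only [hu, hv, hw, hy, hy', hcs, hcq, hcq'] at e0 e1 e2 e3 e4 e5 e6 e7
  have hntq := p.nt_third h.adm hNy hcq
  have hloser : ∀ x m, c' x = (!c x) → G.Adj x m → c m = (!c x) → x = y ∧ (m = s ∨ m = q) := by
    intro x m hx hxm hcm
    have : x = y := by grind
    subst this
    have := (hNy m).1 hxm
    grind
  have hnsupp : ¬ Supp G y := by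
    rintro ⟨l, hl, hl'⟩
    obtain rfl | rfl | rfl := (hNy l).1 hl
    · exact not_leaf huy huy' hyy hl'
    · exact not_leaf hsy hsy' hyy hl'
    · exact not_leaf hqr hyq.symm hry hl'
  have hstep := h.step (c' := c') (adm_of_losers h.adm ?_ ?_) q ?_ ?_
  · obtain ⟨h', -, hb⟩ := hstep
    have hqw : q ≠ w := by
      rintro rfl
      refine not_bad_of q u ((hN q).2 (by simp)).symm (by grind) (fun t ht htq htc => ?_) hb
      obtain rfl | rfl | rfl := (hN t).1 ht
      · exact absurd rfl htq
      · exact ⟨v, by grind, by grind [G.adj_comm]⟩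
      · grind
    refine ⟨hqw, ?_⟩
    obtain ⟨-, -, -, -, t, ht1, -, ht3⟩ := h'.flip_bad hb hyq.symm (by grind) hntq
    have ht4 := (ht3 y (by grind) hyq.ne).2 hyq.symm
    have : t = u := by
      have := (hNy t).1 ht4.symm
      grind
    subst this
    exact ((ht3 w (by grind) hqw.symm).1 ((hN w).2 (by simp))).symm
  · intro x t hx
    have : x = y := by grind
    subst this
    exact hnty t
  · intro x m hx hxm hcm hm
    obtain ⟨rfl, hm⟩ := hloser x m hx hxm hcm
    refine ⟨not_special h.adm huy.symm (by grind), fun hsp => hnsupp (hsp x hxm.symm)⟩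
  · intro x hxe hx
    have : x = y ∨ x = s := by
      obtain hx | ⟨f, hf, hf1, hf2⟩ := hx.cases
      · grind
      · have := hloser f x hf1 hf hf2
        grind
    obtain rfl | rfl := this
    · exact p.not_bad_y (by grind) (by grind) (by grind) (by grind)
    · refine not_bad_of x y' hsy' (by grind) fun t ht hts hct => ?_
      obtain rfl | rfl | rfl := (hNy' t).1 ht
      · grind
      · exact absurd rfl hts
      · have hr'y : r' ≠ y := by
          rintro rfl
          have := hcom t hqr'.symm hyq'
          grind
        have := h2 r' hr'y
        have := hos r' hcr'
        exact ⟨r', by grind, by grind⟩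
  · exact p.repaired (by grind) (by grind) (by grind) (by grind)

theorem PConf.absurd_of_priv (hG : Ctx G) (h : Opt G c) (p : PConf G c k u v w y y' s) {q q' : V}
    (hyq : G.Adj y q) (hqs : q ≠ s) (hcq : c q = !k) (hq : ∀ x, G.Adj q x → c x = k → x = y)
    (hyq' : G.Adj y' q') (hqs' : q' ≠ s) (hcq' : c q' = !k) : False := by
  by_cases hpr : ∃ r, G.Adj q' r ∧ c r = k ∧ r ≠ y'
  · obtain ⟨r', hqr', hcr', hry'⟩ := hpr
    have p0 := p
    obtain ⟨huv, hs, hut, hnty, hnty', hN, hu, hv, hw, hy, hy', hcs, hyy, hsw, huv', hvw, hvy,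
      hvy', hsy, hsy', hos, hcom⟩ := p
    have p := p0
    have hd := p.distinct
    have huy' := (hN y').2 (by simp)
    have hqu' : q' ≠ u := by grind
    have hNy' := hG.nbr3 huy'.symm hsy'.symm hyq' p.ne_us hqu'.symm hqs'.symm
    have hqq : q' ≠ q := by
      rintro rfl
      have := hcom q' hyq hyq'
      grind
    have hyy1 : q' ≠ y := by grind
    have hyy2 : q' ≠ y' := by grind
    obtain ⟨c', h', h1, h2, -, hb⟩ := p.flip_four hG h hyq hqs hcq hq (e := q')
      (fun x hx hcx => by grind) hcq' hqs' hqq (fun _ hsp => by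
        obtain ⟨l, hl, hl'⟩ := hsp y' hyq'.symm
        obtain rfl | rfl | rfl := (hNy' l).1 hl
        · exact not_leaf ((hN w).2 (by simp)) hl.symm (by grind) hl'
        · exact not_leaf hsy hsy' hyy hl'
        · exact not_leaf hqr' hyq'.symm hry' hl')
    have e0 := h1 y' (by simp)
    have e1 := h1 y (by simp)
    have e2 := h2 q' (by grind)
    simp only [hy, hy', hcq'] at e0 e1 e2
    obtain ⟨-, -, -, -, t, ht1, -, ht3⟩ := h'.flip_bad hb hyq'.symm (by grind)
      (p.symm.nt_third h.adm hNy' hcq')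
    have ht4 := (ht3 y' (by grind) hyq'.ne).2 hyq'.symm
    have hty : G.Adj t y := by
      have := (hNy' t).1 ht4.symm
      have := (hN y).2 (by simp)
      grind
    have := hcom q' ((ht3 y (by grind) hyy1.symm).1 hty).symm hyq'
    grind
  · push Not at hpr
    exact p.flip_five hG h hyq hqs hcq hq hyq' hqs' hcq' hpr

/-- The configuration does not occur for an optimal colouring. -/
theorem PConf.elim (hG : Ctx G) (h : Opt G c) (p : PConf G c k u v w y y' s) : False := by
  have free : ∀ {y y'}, PConf G c k u v w y y' s → (∀ x, G.Adj y' x → c x = !k → x = s) →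
      False := by
    intro y y' p hno
    obtain ⟨q, hyq, hqs, hcq, hq⟩ := p.priv_of_free h hno
    have hd := p.distinct
    have hqw : w ≠ q := by
      rintro rfl
      have := hq u ((p.nbr_u w).2 (by simp)).symm p.cu
      grind
    have hyw : ¬ G.Adj y' w := fun h3 => p.ne_sw (hno w h3 p.cw).symm
    obtain ⟨c', -, h1, h2, ht, -⟩ := p.flip_four hG h hyq hqs hcq hq (e := w)
      (fun x hx hcx => Or.inl (hno x hx hcx)) p.cw p.ne_sw.symm hqw (fun h3 => absurd h3 hyw)
    have hN := hG.nbr3 ((p.nbr_u y).2 (by simp)).symm p.sy.symm hyq p.ne_us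
      (by have := p.cu; grind) hqs.symm
    have hcw := p.cw
    have hcs := p.cs
    have hsw := p.ne_sw
    have hcy := p.cy
    have hcy' := p.cy'
    obtain h3 | ⟨f, hf, hf1, hf2⟩ := ht.cases
    · have := h2 w (by grind)
      grind
    · have : f = y ∨ f = y' ∨ f = s ∨ f = q := by grind
      obtain rfl | rfl | rfl | rfl := this <;> grind
  by_cases h1 : ∃ q, G.Adj y q ∧ c q = (!k) ∧ q ≠ s
  · by_cases h2 : ∃ q, G.Adj y' q ∧ c q = (!k) ∧ q ≠ s
    · obtain ⟨q, hyq, hcq, hqs⟩ := h1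
      obtain ⟨q', hyq', hcq', hqs'⟩ := h2
      by_cases h3 : ∃ r, G.Adj q r ∧ c r = k ∧ r ≠ y
      · by_cases h4 : ∃ r, G.Adj q' r ∧ c r = k ∧ r ≠ y'
        · obtain ⟨r, hqr, hcr, hry⟩ := h3
          obtain ⟨r', hqr', hcr', hry'⟩ := h4
          have h5 := p.third_adj hG h hyq hqs hcq hqr hry hyq' hqs' hcq' hqr' hcr' hry'
          have h6 := p.symm.third_adj hG h hyq' hqs' hcq' hqr' hry' hyq hqs hcq hqr hcr hry
          have h7 := ((p.nbr_u w).2 (by simp)).symm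
          have hqq : q ≠ q' := by
            rintro rfl
            have := p.common q hyq hyq'
            have := p.cu
            clear free
            grind
          have h8 := p.cu
          have h9 := p.cv
          have := hG.sub w u v q q' h7 p.vw.symm h5.2 h6.2 p.ne_uv (by grind) (by grind)
          grind
        · push Not at h4
          exact p.symm.absurd_of_priv hG h hyq' hqs' hcq' h4 hyq hqs hcq
      · push Not at h3
        exact p.absurd_of_priv hG h hyq hqs hcq h3 hyq' hqs' hcq'
    · push Not at h2
      exact free p h2
  · push Not at h1
    exact free p.symm h1

/-- A non-twin in an unlocated pair does not have two neighbours of its own colour. -/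
theorem Opt.conflict_one_two (hG : Ctx G) (h : Opt G c) {u v w y y' : V} (huv : u ≠ v)
    (hs : Same G c u v) (hut : ∀ x, ¬ Twin G u x)
    (hN : ∀ x, G.Adj u x ↔ x = w ∨ x = y ∨ x = y') (hyy : y ≠ y')
    (hcw : c w ≠ c u) (hcy : c y = c u) (hcy' : c y' = c u) : False := by
  obtain ⟨s, p⟩ := h.pconf hG huv hs hut hN hyy hcw hcy hcy'
  exact p.elim hG h

end
end LD

namespace LD
variable {V : Type*} {G : SimpleGraph V} {c c' : V → Bool}

section
variable [Fintype V]

/-- A vertex in an unlocated pair with two neighbours of the other colour has no third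
neighbour. -/
theorem Opt.conflict_two_one (hG : Ctx G) (h : Opt G c) {u v w w' y : V} (huv : u ≠ v)
    (hs : Same G c u v) (hN : ∀ x, G.Adj u x ↔ x = w ∨ x = w' ∨ x = y) (hww : w ≠ w')
    (hcw : c w ≠ c u) (hcw' : c w' ≠ c u) (hcy : c y = c u) : False := by
  have huw := (hN w).2 (by simp)
  have huw' := (hN w').2 (by simp)
  have huy := (hN y).2 (by simp)
  by_cases htu : ∃ u', Twin G u u'
  · obtain ⟨u', hu'⟩ := htu
    have h1 := h.adm.twin u u' hu'
    have h2 := hs.1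
    have h3 : u' ≠ v := by rintro rfl; exact h1 h2
    have h4 := hG.nbr3 huw.symm ((hu'.2 w).1 huw).symm ((hs.2 w hcw).1 huw).symm hu'.1 huv h3
    have h5 := hG.nbr3 huw'.symm ((hu'.2 w').1 huw').symm ((hs.2 w' hcw').1 huw').symm hu'.1
      huv h3
    exact h.adm.twin w w' ⟨hww, fun z => by rw [h4, h5]⟩ (bool_eq hcw hcw')
  · push Not at htu
    obtain ⟨c', h', e1, e2, s, hs1, hs2, -⟩ := h.flip_bad (Or.inr ⟨v, huv.symm, hs⟩) huy hcy htu
    have hus : u ≠ s := by rintro rfl; exact hs1 rfl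
    have := huw.ne
    have := huw'.ne
    have := huy.ne
    refine h'.conflict_one_two hG (w := y) (y := w) (y' := w') hus hs2 htu
      (fun x => by rw [hN]; tauto) hww ?_ ?_ ?_
    · rw [e1, e2 y huy.ne']; simp [hcy]
    · rw [e1, e2 w huw.ne']; exact Bool.eq_not_of_ne hcw
    · rw [e1, e2 w' huw'.ne']; exact Bool.eq_not_of_ne hcw'

/-- A non-isolated vertex without open twin is dominated. -/
theorem Opt.not_emp_of_not_twin (hG : Ctx G) (h : Opt G c) {x m : V} (hm : G.Adj x m)
    (hx : Emp G c x) (ht : ∀ y, ¬ Twin G x y) : False := by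
  obtain ⟨c', h', e1, e2, s, hs1, hs2, hs3⟩ := h.flip_bad (Or.inl hx) hm (hx m hm) ht
  have hsz : ∀ z, G.Adj x z → G.Adj s z := fun z hz => (hs3 z (hx z hz) hz.ne').2 hz
  have hxs : x ≠ s := by rintro rfl; exact hs1 rfl
  have hnxs : ¬ G.Adj x s := fun hxs => hs1 (hx s hxs)
  by_cases h1 : ∃ a, G.Adj x a ∧ a ≠ m
  · obtain ⟨a, ha, ham⟩ := h1
    obtain h2 | ⟨d, hdm, hda, h2⟩ := hG.nbr2 hm ha ham.symm
    · obtain h3 | ⟨d, hdm, hda, h3⟩ := hG.nbr2 (hsz m hm) (hsz a ha) ham.symm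
      · exact ht s ⟨hxs, fun z => by rw [h2, h3]⟩
      · have hcd : c d ≠ c x := by
          intro hcd
          have hdx : d ≠ x := by
            rintro rfl
            exact hnxs ((h3 d).2 (by simp)).symm
          have := (h2 d).1 ((hs3 d hcd hdx).1 ((h3 d).2 (by simp)))
          grind
        have hdx : d ≠ x := by rintro rfl; exact hcd rfl
        refine h'.conflict_two_one hG hxs.symm (same_symm hs2) h3 ham.symm ?_ ?_ ?_
        · rw [e2 s hxs.symm, e2 m hm.ne', hx m hm]; exact hs1.symm
        · rw [e2 s hxs.symm, e2 a ha.ne', hx a ha]; exact hs1.symm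
        · rw [e2 s hxs.symm, e2 d hdx]; exact bool_eq hcd hs1
    · have hd := (h2 d).2 (by simp)
      have h3 := hG.nbr3 (hsz m hm) (hsz a ha) (hsz d hd) ham.symm hdm.symm hda.symm
      exact ht s ⟨hxs, fun z => by rw [h2, h3]⟩
  · push Not at h1
    refine leaf_opp h.adm (l := x) ⟨m, fun z => ⟨h1 z, ?_⟩⟩ hm (hx m hm).symm
    rintro rfl
    exact hm

end

/-- An unlocated pair of vertices of degree two with exactly one common neighbour. -/
structure ZConf (G : SimpleGraph V) (c : V → Bool) (k : Bool) (u v w y z : V) : Prop where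
  ne_uv : u ≠ v
  ne_yz : y ≠ z
  same : Same G c u v
  nt_u : ∀ x, ¬ Twin G u x
  nt_v : ∀ x, ¬ Twin G v x
  nt_w : ∀ x, ¬ Twin G w x
  nt_y : ∀ x, ¬ Twin G y x
  nbr_u : ∀ x, G.Adj u x ↔ x = w ∨ x = y
  nbr_v : ∀ x, G.Adj v x ↔ x = w ∨ x = z
  cu : c u = k
  cv : c v = k
  cw : c w = !k
  cy : c y = k
  cz : c z = k
  nadj : ¬ G.Adj u v
  nt_z : ∀ x, ¬ Twin G z x

theorem ZConf.symm {k : Bool} {u v w y z : V} (p : ZConf G c k u v w y z) :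
    ZConf G c k v u w z y :=
  ⟨p.ne_uv.symm, p.ne_yz.symm, same_symm p.same, p.nt_v, p.nt_u, p.nt_w, p.nt_z, p.nbr_v,
    p.nbr_u, p.cv, p.cu, p.cw, p.cz, p.cy, fun h => p.nadj h.symm, p.nt_y⟩

theorem ZConf.distinct {k : Bool} {u v w y z : V} (p : ZConf G c k u v w y z) :
    u ≠ w ∧ v ≠ w ∧ y ≠ w ∧ z ≠ w ∧ u ≠ y ∧ v ≠ z ∧ v ≠ y ∧ u ≠ z := by
  have h1 := ((p.nbr_u w).2 (by simp)).ne
  have h2 := ((p.nbr_v w).2 (by simp)).ne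
  have h3 := ((p.nbr_u y).2 (by simp)).ne
  have h4 := ((p.nbr_v z).2 (by simp)).ne
  have h5 := p.cw
  have h6 := p.cy
  have h7 := p.cz
  have h8 := p.nadj
  have h9 := p.nbr_u
  have h10 := p.nbr_v
  have h11 := G.adj_comm u v
  have : y ≠ w := by rintro rfl; rw [h5] at h6; simp at h6
  have : z ≠ w := by rintro rfl; rw [h5] at h7; simp at h7
  have : v ≠ y := by rintro rfl; exact h8 ((h9 v).2 (by simp))
  have : u ≠ z := by rintro rfl; exact h8 ((h10 u).2 (by simp)).symm
  exact ⟨h1, h2, by assumption, by assumption, h3, h4, by assumption, by assumption⟩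

section
variable {k : Bool} {u v w y z : V}

theorem ZConf.repaired (p : ZConf G c k u v w y z) {A : V → Prop} (hAu : A u) (hAv : A v)
    (hu : c' y ≠ c' u) : Repaired G c c' A := by
  refine Or.inr ⟨u, v, hAu, hAv, p.same, fun he => ?_, fun h' => ?_⟩
  · have := he w ((p.nbr_u w).2 (by simp))
    rw [p.cw, p.cu] at this
    simp at this
  · have h1 := (h'.2 y hu).1 ((p.nbr_u y).2 (by simp))
    have h2 := (p.nbr_v y).1 h1
    have h3 := p.distinct
    have h4 := p.ne_yz
    grind

variable [Fintype V]

theorem ZConf.exists_s (h : Opt G c) (p : ZConf G c k u v w y z) :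
    ∃ c', Opt G c' ∧ c' u = (!k) ∧ (∀ x, x ≠ u → c' x = c x) ∧ ∃ s, c s = (!k) ∧ G.Adj s y ∧
      s ≠ w ∧ ∀ x, c x = k → G.Adj s x → x = y := by
  have huy := (p.nbr_u y).2 (by simp)
  obtain ⟨c', h', e1, e2, s, hs1, hs2, hs3⟩ := h.flip_bad (Or.inr ⟨v, p.ne_uv.symm, p.same⟩)
    huy (p.cy.trans p.cu.symm) p.nt_u
  have hcu := p.cu
  have hvw := (p.nbr_v w).2 (by simp)
  have hsw : s ≠ w := by
    rintro rfl
    exact p.nadj ((hs3 v (p.cv.trans p.cu.symm) p.ne_uv.symm).1 hvw.symm)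
  refine ⟨c', h', by rw [e1, hcu], e2, s, by rw [← hcu]; exact Bool.eq_not_of_ne hs1,
    (hs3 y (p.cy.trans p.cu.symm) huy.ne').2 huy, hsw, fun x hx hsx => ?_⟩
  by_cases hxu : x = u
  · subst hxu
    have h1 := (p.nbr_u s).1 hsx.symm
    have h2 := p.cy
    grind
  · have h1 := (p.nbr_u x).1 ((hs3 x (hx.trans hcu.symm) hxu).1 hsx)
    have h2 := p.cw
    have : x ≠ w := by rintro rfl; rw [hx] at h2; simp at h2
    tauto

/-- The common neighbour of an unlocated pair of vertices of degree two has no neighbour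
that would look like one of them after recolouring. -/
theorem ZConf.no_clone (hG : Ctx G) (h : Opt G c) (p : ZConf G c k u v w y z) {x : V}
    (hxw : G.Adj w x) (hxy : G.Adj x y) (hcx : c x = !k)
    (hx : ∀ q, G.Adj x q → c q = k → q = y) : False := by
  have hd := p.distinct
  have hcu := p.cu
  have hcv := p.cv
  have hcw := p.cw
  have hcy := p.cy
  have hxu : x ≠ u := by rintro rfl; rw [hcu] at hcx; simp at hcx
  have hxv : x ≠ v := by rintro rfl; rw [hcv] at hcx; simp at hcx
  have hNw := hG.nbr3 ((p.nbr_u w).2 (by simp)).symm ((p.nbr_v w).2 (by simp)).symm hxw p.ne_uv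
    hxu.symm hxv.symm
  have ht : ∀ t, ¬ Twin G x t := by
    intro t ht
    obtain rfl | rfl | rfl := (hNw t).1 ((ht.2 w).1 hxw.symm).symm
    · exact p.nt_u _ ht.symm
    · exact p.nt_v _ ht.symm
    · exact ht.1 rfl
  obtain h1 | ⟨q, hqw, hqy, h1⟩ := hG.nbr2 hxw.symm hxy hd.2.2.1.symm
  · exact p.nt_u x ⟨hxu.symm, fun q => by rw [h1, p.nbr_u]⟩
  · obtain ⟨c', h', e1, e2, -⟩ := p.exists_s h
    have hqx : G.Adj x q := (h1 q).2 (by simp)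
    have hcq : c q ≠ k := fun hcq => hqy (hx q hqx hcq)
    have hqu : q ≠ u := by rintro rfl; exact hcq hcu
    have hcq := Bool.eq_not_of_ne hcq
    refine h'.conflict_one_two hG (u := x) (v := u) (w := y) (y := w) (y' := q) hxu
      ⟨by rw [e1, e2 x hxu, hcx], fun b hb => ?_⟩ ht (fun b => by rw [h1]; tauto) hqw.symm ?_ ?_ ?_
    · have hcb : b ≠ u → c b = k := by
        intro hbu
        rw [e2 b hbu, e2 x hxu, hcx] at hb
        simpa using Bool.eq_not_of_ne hb
      rw [p.nbr_u, h1]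
      have : b ≠ u := by rintro rfl; rw [e1, e2 x hxu, hcx] at hb; exact hb rfl
      have hcb := hcb this
      have : b ≠ w := by rintro rfl; rw [hcw] at hcb; simp at hcb
      have : b ≠ q := by rintro rfl; rw [hcq] at hcb; simp at hcb
      tauto
    · rw [e2 y hd.2.2.2.2.1.symm, e2 x hxu, hcx, hcy]; simp
    · rw [e2 w hd.1.symm, e2 x hxu, hcx, hcw]
    · rw [e2 q hqu, e2 x hxu, hcx, hcq]

/-- The outcome for `u` of recolouring `u`, `v`, `w`, and possibly a leaf at `w`. -/
theorem ZConf.not_bad_left (hG : Ctx G) (h : Opt G c) (p : ZConf G c k u v w y z)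
    (h1 : ∀ x, x = u ∨ x = v ∨ x = w → c' x = !c x)
    (h2 : ∀ x, ¬ (x = u ∨ x = v ∨ x = w) → c' x = c x ∨ ∀ b, G.Adj x b → b = w) :
    ¬ Bad G c' u := by
  have hd := p.distinct
  have hyz := p.ne_yz
  have hcu := p.cu
  have hcv := p.cv
  have hcw := p.cw
  have hcy := p.cy
  have hcz := p.cz
  have e1 := h1 u (by simp)
  have e2 := h1 v (by simp)
  have e3 := h1 w (by simp)
  have hNu := p.nbr_u
  have hNv := p.nbr_v
  simp only [hcu, hcv, hcw, Bool.not_not] at e1 e2 e3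
  have e4 : c' y = k := by
    have := h2 y (by grind)
    have := fun (e : ∀ b, G.Adj y b → b = w) => e u ((hNu y).2 (by simp)).symm
    grind
  refine not_bad_of u w ((hNu w).2 (by simp)) (by rw [e1, e3]; simp) fun x hx hxu hcx => ?_
  rw [e1] at hcx
  by_contra hcon
  push Not at hcon
  have hNx : ∀ b, c' b = k → (G.Adj u b ↔ G.Adj x b) := fun b hb =>
    hcon b (by rw [hb, e1]; simp)
  have hxy := (hNx y e4).1 ((hNu y).2 (by simp))
  by_cases hxv : x = v
  · subst hxv
    grind
  · obtain h3 | h3 := h2 x (by have := hx.ne; grind)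
    · refine p.no_clone hG h hx hxy (by rw [← h3, hcx]) fun q hxq hcq => ?_
      obtain h4 | h4 := h2 q (by have := G.adj_comm x q; grind)
      · have := (hNx q (by rw [h4, hcq])).2 hxq
        grind
      · have := h4 x hxq.symm
        grind
    · have := h3 y hxy
      grind

theorem ZConf.not_bad (hG : Ctx G) (h : Opt G c) (p : ZConf G c k u v w y z)
    (h1 : ∀ x, x = u ∨ x = v ∨ x = w → c' x = !c x)
    (h2 : ∀ x, ¬ (x = u ∨ x = v ∨ x = w) → c' x = c x ∨ ∀ b, G.Adj x b → b = w) :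
    (¬ Bad G c' u ∧ ¬ Bad G c' v ∧ ¬ Bad G c' w) ∧ c' y ≠ c' u := by
  have hd := p.distinct
  have hyz := p.ne_yz
  have hcu := p.cu
  have hcv := p.cv
  have hcw := p.cw
  have e1 := h1 u (by simp)
  have e2 := h1 v (by simp)
  have e3 := h1 w (by simp)
  have hNu := p.nbr_u
  have hNv := p.nbr_v
  simp only [hcu, hcv, hcw, Bool.not_not] at e1 e2 e3
  refine ⟨⟨p.not_bad_left hG h h1 h2, p.symm.not_bad_left hG h (by grind) (by grind), ?_⟩, ?_⟩
  · refine not_bad_of w u ((hNu w).2 (by simp)).symm (by rw [e1, e3]; simp) fun x hx hxw hcx => ?_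
    exact ⟨v, by rw [e2, e3]; simp, by grind [G.adj_comm]⟩
  · have := h2 y (by grind)
    have := fun (e : ∀ b, G.Adj y b → b = w) => e u ((hNu y).2 (by simp)).symm
    have := p.cy
    rw [e1]
    cases k <;> grind

theorem ZConf.third (hG : Ctx G) (h : Opt G c) (p : ZConf G c k u v w y z) :
    ∃ e, e ≠ u ∧ e ≠ v ∧ (∀ b, G.Adj w b ↔ b = u ∨ b = v ∨ b = e) ∧ c e = k ∧
      ∃ m, G.Adj e m ∧ m ≠ w := by
  have hd := p.distinct
  have hcu := p.cu
  have hcv := p.cv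
  have hcw := p.cw
  have hcy := p.cy
  have hNu := p.nbr_u
  have hNv := p.nbr_v
  have hwu := ((hNu w).2 (by simp)).symm
  have hwv := ((hNv w).2 (by simp)).symm
  by_cases hA : ∃ e, G.Adj w e ∧ e ≠ u ∧ e ≠ v ∧ c e = k
  · obtain ⟨e, he, heu, hev, hce⟩ := hA
    have hNw := hG.nbr3 hwu hwv he p.ne_uv heu.symm hev.symm
    refine ⟨e, heu, hev, hNw, hce, ?_⟩
    by_contra hleaf
    push Not at hleaf
    obtain ⟨c', h1, h2⟩ := exists_flip c (fun x => x = u ∨ x = v ∨ x = w ∨ x = e)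
    have e1 := h1 u (by simp)
    have e2 := h1 v (by simp)
    have e3 := h1 w (by simp)
    have e4 := h1 e (by simp)
    have hew := he.ne'
    obtain ⟨hb, hr⟩ := p.not_bad hG h (c' := c') (fun x hx => h1 x (by tauto)) fun x hx => by
      by_cases hxe : x = e
      · subst hxe; exact Or.inr hleaf
      · exact Or.inl (h2 x (by tauto))
    have hte : ∀ t, ¬ Twin G e t := by
      intro t ht
      obtain ⟨a, b, d, h3, -, -, h4⟩ := hG.tw e t ht
      exact h3 ((hleaf a ((h4 a).2 (by simp))).trans (hleaf b ((h4 b).2 (by simp))).symm)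
    have hlos : ∀ f x, c' f = (!c f) → G.Adj f x → c x = (!c f) →
        x = u ∨ x = v ∨ x = w ∨ x = e := by
      intro f x hf hfx hcx
      by_contra hxx
      have hff : f = u ∨ f = v ∨ f = w ∨ f = e := by
        by_contra hff
        have := h2 f hff
        grind
      have hcz := p.cz
      obtain rfl | rfl | rfl | rfl := hff <;> grind
    refine h.improve (c' := c') (adm_of_losers h.adm ?_ ?_) ?_
      (p.repaired trivial trivial hr)
    · intro x t hx
      have : x = u ∨ x = v ∨ x = w ∨ x = e := by
        by_contra hxx
        exact hx (h2 x hxx)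
      obtain rfl | rfl | rfl | rfl := this
      · exact p.nt_u t
      · exact p.nt_v t
      · exact p.nt_w t
      · exact hte t
    · intro x m hx hxm hcm hm
      have := hlos x m hx hxm hcm
      have := h1 m this
      grind
    · intro x hx
      have : x = u ∨ x = v ∨ x = w ∨ x = e := by
        by_contra hxx
        obtain h3 | ⟨f, hf, hf1, hf2⟩ := hx.cases
        · have := h2 x hxx
          grind
        · exact hxx (hlos f x hf1 hf hf2)
      obtain rfl | rfl | rfl | rfl := this
      · exact hb.1
      · exact hb.2.1
      · exact hb.2.2
      · refine not_bad_of _ w he.symm (by rw [e3, e4, hcw, hce]; simp) fun b hb hbx hcb => ?_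
        obtain rfl | rfl | rfl := (hNw b).1 hb
        · refine ⟨y, ?_, ?_⟩
          · rw [← hcb]; exact hr
          · have := hleaf y
            grind
        · refine ⟨z, ?_, ?_⟩
          · rw [← hcb]
            have h5 : z ≠ x := fun hzx =>
              hd.2.1 (hleaf b (hzx ▸ ((hNv z).2 (by simp)).symm))
            have h6 := h2 z (by have := p.ne_yz; grind)
            rw [h6, e2, hcv, p.cz]; simp
          · have := hleaf z
            grind
        · exact absurd rfl hbx
  · push Not at hA
    exfalso
    obtain ⟨c', h1, h2⟩ := exists_flip c (fun x => x = u ∨ x = v ∨ x = w)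
    obtain ⟨hb, hr⟩ := p.not_bad hG h (c' := c') h1 fun x hx => Or.inl (h2 x hx)
    have hlos : ∀ f x, c' f = (!c f) → G.Adj f x → c x = (!c f) →
        x = u ∨ x = v ∨ x = w := by
      intro f x hf hfx hcx
      by_contra hxx
      have hff : f = u ∨ f = v ∨ f = w := by
        by_contra hff
        have := h2 f hff
        grind
      obtain rfl | rfl | rfl := hff
      · grind
      · have := p.cz
        grind
      · have := hA x hfx
        rw [hcw, Bool.not_not] at hcx
        grind
    refine h.improve (c' := c') (adm_of_losers h.adm ?_ ?_) ?_
      (p.repaired trivial trivial hr)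
    · intro x t hx
      have : x = u ∨ x = v ∨ x = w := by
        by_contra hxx
        exact hx (h2 x hxx)
      obtain rfl | rfl | rfl := this
      · exact p.nt_u t
      · exact p.nt_v t
      · exact p.nt_w t
    · intro x m hx hxm hcm hm
      have := hlos x m hx hxm hcm
      have := h1 m this
      grind
    · intro x hx
      have : x = u ∨ x = v ∨ x = w := by
        by_contra hxx
        obtain h3 | ⟨f, hf, hf1, hf2⟩ := hx.cases
        · have := h2 x hxx
          grind
        · exact hxx (hlos f x hf1 hf hf2)
      obtain rfl | rfl | rfl := this
      · exact hb.1
      · exact hb.2.1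
      · exact hb.2.2

/-- Recolouring `y` and `s` when all neighbours of `y` are known. -/
theorem ZConf.flip_two (hG : Ctx G) (h : Opt G c) (p : ZConf G c k u v w y z) {e : V}
    (heu : e ≠ u) (hev : e ≠ v) (hNw : ∀ b, G.Adj w b ↔ b = u ∨ b = v ∨ b = e) (hce : c e = k)
    (hye : G.Adj y e) : False := by
  have hd := p.distinct
  have hcu := p.cu
  have hcv := p.cv
  have hcw := p.cw
  have hcy := p.cy
  have hNu := p.nbr_u
  have hNv := p.nbr_v
  obtain ⟨-, -, -, -, s, hcs, hsy, hsw, hs⟩ := p.exists_s h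
  have hsu : s ≠ u := by rintro rfl; rw [hcu] at hcs; simp at hcs
  have hsv : s ≠ v := by rintro rfl; rw [hcv] at hcs; simp at hcs
  have hse : s ≠ e := by rintro rfl; rw [hce] at hcs; simp at hcs
  have hNy := hG.nbr3 ((hNu y).2 (by simp)).symm hsy.symm hye hsu.symm heu.symm hse
  obtain ⟨c', h1, h2⟩ := exists_flip c (fun x => x = y ∨ x = s)
  have e1 := h1 y (by simp)
  have e2 := h1 s (by simp)
  have e3 := h2 w (by grind)
  have e4 := h2 u (by grind)
  have e5 := h2 e (by have := hye.ne; grind)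
  simp only [hcu, hcw, hcy, hcs, hce, Bool.not_not] at e1 e2 e3 e4 e5
  have hts : ∀ t, ¬ Twin G s t := by
    intro t ht
    obtain rfl | rfl | rfl := (hNy t).1 ((ht.2 y).1 hsy).symm
    · exact p.nt_u _ ht.symm
    · exact ht.1 rfl
    · have := (hNw s).1 ((ht.2 w).2 ((hNw t).2 (by simp)).symm).symm
      grind
  have hlos : ∀ f x, c' f = (!c f) → G.Adj f x → c x = (!c f) → x = y ∨ x = s := by
    intro f x hf hfx hcx
    by_contra hxx
    have hff : f = y ∨ f = s := by
      by_contra hff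
      have := h2 f hff
      grind
    obtain rfl | rfl := hff
    · grind
    · have := hs x
      grind
  have hr : Repaired G c c' (fun _ => True) :=
    p.repaired trivial trivial (by rw [e1, e4]; simp)
  refine h.improve (c' := c') (adm_of_losers h.adm ?_ ?_) ?_ hr
  · intro x t hx
    have : x = y ∨ x = s := by
      by_contra hxx
      exact hx (h2 x hxx)
    obtain rfl | rfl := this
    · exact p.nt_y t
    · exact hts t
  · intro x m hx hxm hcm hm
    have := hlos x m hx hxm hcm
    have := h1 m this
    grind
  · intro x hx
    have : x = y ∨ x = s := by
      by_contra hxx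
      obtain h3 | ⟨f, hf, hf1, hf2⟩ := hx.cases
      · have := h2 x hxx
        grind
      · exact hxx (hlos f x hf1 hf hf2)
    have hsw' : ¬ G.Adj s w := fun hsw' => by
      have := (hNw s).1 hsw'.symm
      grind
    obtain rfl | rfl := this
    · refine not_bad_of x u ((hNu x).2 (by simp)).symm (by rw [e1, e4]; simp) fun b hb hbx hcb => ?_
      refine ⟨s, by rw [e1, e2]; simp, ?_⟩
      have := (hNu b).1 hb
      have := hsy.symm
      have := G.adj_comm s w
      grind
    · refine not_bad_of x y hsy (by rw [e1, e2]; simp) fun b hb hbx hcb => ?_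
      refine ⟨w, by rw [e2, e3]; simp, ?_⟩
      have := (hNy b).1 hb
      have := (hNu w).2 (by simp)
      have := ((hNw e).2 (by simp)).symm
      grind

theorem ZConf.not_adj_wy (hG : Ctx G) (h : Opt G c) (p : ZConf G c k u v w y z)
    (hwy : G.Adj w y) (hb : ∀ c' : V → Bool, (∀ x, x = u ∨ x = v ∨ x = w → c' x = !c x) →
      (∀ x, ¬ (x = u ∨ x = v ∨ x = w) → c' x = c x) → Bad G c' y) : False := by
  obtain ⟨-, -, -, -, s, hcs, hsy, hsw, hs⟩ := p.exists_s h
  have hd := p.distinct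
  have hcu := p.cu
  have hcv := p.cv
  have hcw := p.cw
  have hcy := p.cy
  have hNu := p.nbr_u
  have hNw := hG.nbr3 ((p.nbr_u w).2 (by simp)).symm ((p.nbr_v w).2 (by simp)).symm hwy p.ne_uv
    hd.2.2.2.2.1 hd.2.2.2.2.2.2.1
  have hsu : s ≠ u := by rintro rfl; rw [hcu] at hcs; simp at hcs
  have hsv : s ≠ v := by rintro rfl; rw [hcv] at hcs; simp at hcs
  obtain ⟨c', h1, h2⟩ := exists_flip c (fun x => x = u ∨ x = v ∨ x = w)
  refine not_bad_of y u ((hNu y).2 (by simp)).symm ?_ (fun b hb hby hcb => ?_) (hb c' h1 h2)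
  · rw [h1 u (by simp), h2 y (by grind), hcu, hcy]; simp
  · refine ⟨s, ?_, ?_⟩
    · rw [h2 s (by grind), h2 y (by grind), hcs, hcy]; simp
    · have := (hNu b).1 hb
      have := hsy.symm
      have := (hNw s).1
      have := G.adj_comm s w
      have := hsy.ne
      grind

theorem ZConf.elim (hG : Ctx G) (h : Opt G c) (p : ZConf G c k u v w y z) : False := by
  obtain ⟨e, heu, hev, hNw, hce, m, hem, hmw⟩ := p.third hG h
  have hd := p.distinct
  have hcu := p.cu
  have hcv := p.cv
  have hcw := p.cw
  have hcy := p.cy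
  have hcz := p.cz
  have hNu := p.nbr_u
  have hNv := p.nbr_v
  have hwe := (hNw e).2 (by simp)
  have hlos : ∀ c' : V → Bool, (∀ x, ¬ (x = u ∨ x = v ∨ x = w) → c' x = c x) →
      ∀ f x, c' f = (!c f) → G.Adj f x → c x = (!c f) → 
      (x = u ∨ x = v ∨ x = w) ∨ f = w ∧ x = e := by
    intro c' h2 f x hf hfx hcx
    by_contra hxx
    have hff : f = u ∨ f = v ∨ f = w := by
      by_contra hff
      have := h2 f hff
      grind
    obtain rfl | rfl | rfl := hff <;> grind
  have hstep : ∀ c' : V → Bool, (∀ x, x = u ∨ x = v ∨ x = w → c' x = !c x) →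
      (∀ x, ¬ (x = u ∨ x = v ∨ x = w) → c' x = c x) → Opt G c' ∧ Bad G c' e := by
    intro c' h1 h2
    obtain ⟨hb, hr⟩ := p.not_bad hG h (c' := c') h1 fun x hx => Or.inl (h2 x hx)
    have := h.step (c' := c') (adm_of_losers h.adm ?_ ?_) e ?_ (p.repaired heu.symm hev.symm hr)
    · exact ⟨this.1, this.2.2⟩
    · intro x t hx
      have : x = u ∨ x = v ∨ x = w := by
        by_contra hxx
        exact hx (h2 x hxx)
      obtain rfl | rfl | rfl := this
      · exact p.nt_u t
      · exact p.nt_v t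
      · exact p.nt_w t
    · intro x m' hx hxm hcm hm
      have h3 := hlos c' h2 x m' hx hxm hcm
      have h4 := h1 m'
      obtain ⟨rfl, rfl⟩ : x = w ∧ m' = e := by grind
      constructor
      · intro hsp
        exact not_supp_of_bad h.adm (Or.inr ⟨v, p.ne_uv.symm, p.same⟩)
          (hsp u ((hNu x).2 (by simp)).symm)
      · intro hsp
        obtain ⟨l, hl, hl'⟩ := hsp x hwe.symm
        obtain rfl | rfl | rfl := (hNw l).1 hl
        · exact not_leaf ((hNu x).2 (by simp)) ((hNu y).2 (by simp)) hd.2.2.1.symm hl'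
        · exact not_leaf ((hNv x).2 (by simp)) ((hNv z).2 (by simp)) hd.2.2.2.1.symm hl'
        · exact not_leaf hem hwe.symm hmw hl'
    · intro x hxe hx
      have : x = u ∨ x = v ∨ x = w := by
        by_contra hxx
        obtain h3 | ⟨f, hf, hf1, hf2⟩ := hx.cases
        · have := h2 x hxx
          grind
        · have := hlos c' h2 f x hf1 hf hf2
          grind
      obtain rfl | rfl | rfl := this
      · exact hb.1
      · exact hb.2.1
      · exact hb.2.2
  have hey : e ≠ y := by
    rintro rfl
    exact p.not_adj_wy hG h hwe fun c' h1 h2 => (hstep c' h1 h2).2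
  have hez : e ≠ z := by
    rintro rfl
    exact p.symm.not_adj_wy hG h hwe fun c' h1 h2 =>
      (hstep c' (fun x hx => h1 x (by tauto)) (fun x hx => h2 x (by tauto))).2
  have hte : ∀ t, ¬ Twin G e t := by
    intro t ht
    obtain rfl | rfl | rfl := (hNw t).1 ((ht.2 w).1 hwe.symm).symm
    · exact p.nt_u _ ht.symm
    · exact p.nt_v _ ht.symm
    · exact ht.1 rfl
  obtain ⟨c', h1, h2⟩ := exists_flip c (fun x => x = u ∨ x = v ∨ x = w)
  obtain ⟨h', hbe⟩ := hstep c' h1 h2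
  have e1 := h1 u (by simp)
  have e2 := h1 v (by simp)
  have e3 := h1 w (by simp)
  have e4 := h2 e (by have := hwe.ne; grind)
  have e5 := h2 y (by grind)
  have e6 := h2 z (by have := p.ne_yz; grind)
  simp only [hcu, hcv, hcw, hcy, hcz, hce, Bool.not_not] at e1 e2 e3 e4 e5 e6
  obtain ⟨-, -, -, -, r, hr1, -, hr3⟩ := h'.flip_bad hbe hwe.symm (by rw [e3, e4]) hte
  obtain rfl | rfl | rfl := (hNw r).1 ((hr3 w (by rw [e3, e4]) hwe.ne).2 hwe.symm).symm
  · exact p.flip_two hG h heu hev hNw hce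
      ((hr3 y (by rw [e5, e4]) hey.symm).1 ((hNu y).2 (by simp))).symm
  · exact p.symm.flip_two hG h hev heu (fun b => by rw [hNw]; tauto) hce
      ((hr3 z (by rw [e6, e4]) hez.symm).1 ((hNv z).2 (by simp))).symm
  · exact hr1 rfl

/-- Two vertices of degree two are located if each has one neighbour of either colour. -/
theorem Opt.conflict_one_one (hG : Ctx G) (h : Opt G c) (huv : u ≠ v) (hs : Same G c u v)
    (hNu : ∀ x, G.Adj u x ↔ x = w ∨ x = y) (hNv : ∀ x, G.Adj v x ↔ x = w ∨ x = z)
    (hcw : c w ≠ c u) (hcy : c y = c u) (hcz : c z = c u) : False := by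
  have hnt : ∀ x a b t, (∀ x', G.Adj x x' ↔ x' = a ∨ x' = b) → ¬ Twin G x t := by
    intro x a b t hN ht
    obtain ⟨p, q, r, h1, h2, h3, h4⟩ := hG.tw x t ht
    have := (hN p).1 ((h4 p).2 (by simp))
    have := (hN q).1 ((h4 q).2 (by simp))
    have := (hN r).1 ((h4 r).2 (by simp))
    grind
  have hadj : ∀ x y, G.Adj u x → ¬ Twin G x y := fun x y hx ht =>
    h.conflict_not_adj_twin hG huv hs ht hx.symm
  have hadj' : ∀ x y, G.Adj v x → ¬ Twin G x y := fun x y hx ht =>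
    h.conflict_not_adj_twin hG huv.symm (same_symm hs) ht hx.symm
  have hyz : y ≠ z := by
    rintro rfl
    exact hnt u w y v hNu ⟨huv, fun x => by rw [hNu, hNv]⟩
  have p : ZConf G c (c u) u v w y z := ⟨huv, hyz, hs, fun t => hnt u w y t hNu,
    fun t => hnt v w z t hNv, fun t => hadj w t ((hNu w).2 (by simp)),
    fun t => hadj y t ((hNu y).2 (by simp)), hNu, hNv, rfl, hs.1.symm, Bool.eq_not_of_ne hcw,
    hcy, hcz, fun e => h.conflict_not_adj hG hs e, fun t => hadj' z t ((hNv z).2 (by simp))⟩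
  exact p.elim hG h

end
end LD

namespace LD
variable {V : Type*} {G : SimpleGraph V} {c c' : V → Bool}

/-- Twins `t`, `t'` such that `t` is not dominated, with their neighbours and the third
neighbours of those. -/
structure EConf (G : SimpleGraph V) (c : V → Bool) (k : Bool) (t t' a b d a' b' d' : V) :
    Prop where
  tw : Twin G t t'
  nbr_t : ∀ x, G.Adj t x ↔ x = a ∨ x = b ∨ x = d
  nbr_a : ∀ x, G.Adj a x ↔ x = t ∨ x = t' ∨ x = a'
  nbr_b : ∀ x, G.Adj b x ↔ x = t ∨ x = t' ∨ x = b'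
  nbr_d : ∀ x, G.Adj d x ↔ x = t ∨ x = t' ∨ x = d'
  ct : c t = k
  ct' : c t' = !k
  ca : c a = k
  cb : c b = k
  cd : c d = k
  ca' : c a' = !k
  cb' : c b' = !k
  cd' : c d' = !k
  ab : a ≠ b
  ad : a ≠ d
  bd : b ≠ d
  ab' : a' ≠ b'
  ad' : a' ≠ d'
  bd' : b' ≠ d'
  at' : a' ≠ t'
  bt' : b' ≠ t'
  dt' : d' ≠ t'

section
variable {k : Bool} {t t' a b d a' b' d' : V}

theorem EConf.symm (p : EConf G c k t t' a b d a' b' d') : EConf G c k t t' b a d b' a' d' :=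
  { tw := p.tw, nbr_t := fun x => by rw [p.nbr_t]; tauto, nbr_a := p.nbr_b, nbr_b := p.nbr_a,
    nbr_d := p.nbr_d, ct := p.ct, ct' := p.ct', ca := p.cb, cb := p.ca, cd := p.cd, ca' := p.cb',
    cb' := p.ca', cd' := p.cd', ab := p.ab.symm, ad := p.bd, bd := p.ad, ab' := p.ab'.symm,
    ad' := p.bd', bd' := p.ad', at' := p.bt', bt' := p.at', dt' := p.dt' }

theorem EConf.rotate (p : EConf G c k t t' a b d a' b' d') : EConf G c k t t' b d a b' d' a' :=
  { tw := p.tw, nbr_t := fun x => by rw [p.nbr_t]; tauto, nbr_a := p.nbr_b, nbr_b := p.nbr_d,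
    nbr_d := p.nbr_a, ct := p.ct, ct' := p.ct', ca := p.cb, cb := p.cd, cd := p.ca, ca' := p.cb',
    cb' := p.cd', cd' := p.ca', ab := p.bd, ad := p.ab.symm, bd := p.ad.symm, ab' := p.bd',
    ad' := p.ab'.symm, bd' := p.ad'.symm, at' := p.bt', bt' := p.dt', dt' := p.at' }

theorem EConf.not_special (h : Adm G c) (p : EConf G c k t t' a b d a' b' d') :
    ¬ Special G t ∧ ¬ Special G t' ∧ ¬ Special G a := by
  have h1 := LD.not_special h ((p.nbr_t a).2 (by simp)) (p.ca.trans p.ct.symm)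
  exact ⟨h1, fun h2 => h1 fun m hm => h2 m ((p.tw.2 m).1 hm),
    LD.not_special h ((p.nbr_a t).2 (by simp)) (p.ct.trans p.ca.symm)⟩

theorem EConf.emp (p : EConf G c k t t' a b d a' b' d') : Emp G c t := by
  intro x hx
  have h1 := p.ct
  have h2 := p.ca
  have h3 := p.cb
  have h4 := p.cd
  have := (p.nbr_t x).1 hx
  grind

theorem EConf.nt_a (h : Adm G c) (p : EConf G c k t t' a b d a' b' d') : ∀ x, ¬ Twin G a x := by
  intro x hx
  have h1 := (p.nbr_t x).1 ((hx.2 t).1 ((p.nbr_a t).2 (by simp))).symm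
  have h2 := h.twin a x hx
  have h3 := p.ca
  have h4 := p.cb
  have h5 := p.cd
  grind

theorem EConf.nbr_t' (p : EConf G c k t t' a b d a' b' d') :
    ∀ x, G.Adj t' x ↔ x = a ∨ x = b ∨ x = d := fun x => by rw [← p.tw.2, p.nbr_t]

theorem EConf.distinct (p : EConf G c k t t' a b d a' b' d') :
    t ≠ t' ∧ (t ≠ a ∧ t ≠ b ∧ t ≠ d) ∧ (t' ≠ a ∧ t' ≠ b ∧ t' ≠ d) ∧ (a' ≠ t ∧ b' ≠ t ∧ d' ≠ t) ∧
      (a' ≠ a ∧ a' ≠ b ∧ a' ≠ d) ∧ (b' ≠ a ∧ b' ≠ b ∧ b' ≠ d) ∧ (d' ≠ a ∧ d' ≠ b ∧ d' ≠ d) := by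
  have h1 := p.tw.1
  have h2 := ((p.nbr_t a).2 (by simp)).ne
  have h3 := ((p.nbr_t b).2 (by simp)).ne
  have h4 := ((p.nbr_t d).2 (by simp)).ne
  have h5 := ((p.nbr_t' a).2 (by simp)).ne
  have h6 := ((p.nbr_t' b).2 (by simp)).ne
  have h7 := ((p.nbr_t' d).2 (by simp)).ne
  have hne : ∀ x y, c x = k → c y = (!k) → y ≠ x := by
    rintro x y hx hy rfl
    rw [hx] at hy
    simp at hy
  exact ⟨h1, ⟨h2, h3, h4⟩, ⟨h5, h6, h7⟩,
    ⟨hne _ _ p.ct p.ca', hne _ _ p.ct p.cb', hne _ _ p.ct p.cd'⟩,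
    ⟨hne _ _ p.ca p.ca', hne _ _ p.cb p.ca', hne _ _ p.cd p.ca'⟩,
    ⟨hne _ _ p.ca p.cb', hne _ _ p.cb p.cb', hne _ _ p.cd p.cb'⟩,
    hne _ _ p.ca p.cd', hne _ _ p.cb p.cd', hne _ _ p.cd p.cd'⟩

variable [Fintype V]

/-- The third neighbour of a neighbour of `t` is a leaf or has degree two. -/
theorem EConf.connector (hG : Ctx G) (h : Opt G c) (p : EConf G c k t t' a b d a' b' d') {m : V}
    (hm : G.Adj b' m) (hmb : m ≠ b) :
    ∃ w r, w ≠ b ∧ (∀ x, G.Adj b' x ↔ x = b ∨ x = w) ∧ c w = k ∧ r ≠ b' ∧ c r = (!k) ∧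
      G.Adj r w ∧ ∀ x, G.Adj r x → c x = k → x = w := by
  obtain ⟨c', h1, h2⟩ := exists_flip c (fun x => x = b)
  have h1 := h1 b rfl
  have hd := p.distinct
  have hct := p.ct
  have hct' := p.ct'
  have hca := p.ca
  have hcb := p.cb
  have hcd := p.cd
  have hcb' := p.cb'
  have hab := p.ab
  have hbd := p.bd
  have had := p.ad
  have had' := p.ad'
  have hab' := p.ab'
  have hbd' := p.bd'
  have hNt := p.nbr_t
  have hNt' := p.nbr_t'
  have hNa := p.nbr_a
  have hNb := p.nbr_b
  have hNd := p.nbr_d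
  have hbb' := ((hNb b').2 (by simp)).symm
  have e1 := h2 t (by grind)
  have e2 := h2 t' (by grind)
  have e3 := h2 a (by grind)
  have e4 := h2 d (by grind)
  have e5 := h2 b' (by grind)
  rw [hcb] at h1
  rw [hct] at e1
  rw [hct'] at e2
  rw [hca] at e3
  rw [hcd] at e4
  rw [hcb'] at e5
  have hb : ¬ Leaf G b' := not_leaf hm hbb' hmb
  have hlos : ∀ f x, c' f = (!c f) → G.Adj f x → c x = (!c f) → f = b ∧ (x = t' ∨ x = b') := by
    intro f x hf hfx hcx
    have hff : f = b := by
      by_contra hff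
      have := h2 f hff
      grind
    subst hff
    grind
  have hstep := h.step (c' := c') (adm_of_losers h.adm ?_ ?_) b' ?_
    (Or.inl ⟨t, hd.2.2.2.1.2.1.symm, p.emp, fun he => ?_⟩)
  rotate_left
  · intro x y hx
    by_cases hxb : x = b
    · subst hxb; exact p.symm.nt_a h.adm y
    · exact absurd (h2 x hxb) hx
  · intro x m' hx hxm hcm hm'
    obtain ⟨rfl, rfl | rfl⟩ := hlos x m' hx hxm hcm
    · exact ⟨(p.symm.not_special h.adm).2.2, (p.not_special h.adm).2.1⟩
    · refine ⟨(p.symm.not_special h.adm).2.2, fun hs => ?_⟩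
      obtain ⟨l, hl, hl'⟩ := hs x hbb'
      obtain rfl | rfl | rfl := (hNb l).1 hl
      · exact not_leaf ((hNt a).2 (by simp)) ((hNt x).2 (by simp)) hab hl'
      · exact not_leaf ((hNt' a).2 (by simp)) ((hNt' x).2 (by simp)) hab hl'
      · exact hb hl'
  · intro x hxb' hx
    have : x = b ∨ x = t' := by
      obtain h3 | ⟨f, hf, hf1, hf2⟩ := hx.cases
      · by_contra hxx
        have := h2 x (by tauto)
        grind
      · have := hlos f x hf1 hf hf2
        tauto
    obtain rfl | rfl := this
    · refine not_bad_of x t ((hNb t).2 (by simp)) (by rw [e1, h1]; simp) fun y hy hyb hcy => ?_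
      rw [h1] at hcy
      have := (hNt y).1 hy
      grind
    · refine not_bad_of x a ((hNt' a).2 (by simp)) (by rw [e2, e3]; simp) fun y hy hyb hcy => ?_
      refine ⟨d, by rw [e4, e2]; simp, ?_⟩
      have := (hNa y).1 hy
      have := G.adj_comm y d
      grind
  · have := he b ((hNt b).2 (by simp))
    rw [h1, e1] at this
    simp at this
  obtain ⟨h', -, hbad⟩ := hstep
  have hnt : ∀ x, ¬ Twin G b' x := by
    intro x hx
    obtain rfl | rfl | rfl := (hNb x).1 ((hx.2 b).1 hbb').symm
    · have := (hNa b').1 ((hx.2 a).2 ((hNt a).2 (by simp))).symm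
      have := p.at'
      have := p.bt'
      grind
    · have := (hNa b').1 ((hx.2 a).2 ((hNt' a).2 (by simp))).symm
      have := p.at'
      have := p.bt'
      grind
    · exact hx.1 rfl
  have hne : ¬ Emp G c' b' := fun he => h'.not_emp_of_not_twin hG hm he hnt
  obtain hbad | ⟨r, hr, hs⟩ := hbad
  · exact absurd hbad hne
  obtain ⟨w, hw, hcw⟩ : ∃ w, G.Adj b' w ∧ c' w ≠ c' b' := by
    by_contra hcon
    push Not at hcon
    exact hne hcon
  have hwb : w ≠ b := by rintro rfl; exact hcw (by rw [h1, e5])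
  have hcw' : c w = k := by
    rw [h2 w hwb, e5] at hcw
    simpa using Bool.eq_not_of_ne hcw
  have hNb' : ∀ x, G.Adj b' x ↔ x = b ∨ x = w := by
    obtain h3 | ⟨y, hyb, hyw, h3⟩ := hG.nbr2 hbb' hw hwb.symm
    · exact h3
    · exfalso
      by_cases hcy : c' y = c' b'
      · exact h'.conflict_one_two hG hr.symm hs hnt (w := w) (y := b) (y' := y)
          (fun x => by rw [h3]; tauto) hyb.symm hcw (by rw [h1, e5]) hcy
      · exact h'.conflict_two_one hG hr.symm hs (w := w) (w' := y) (y := b)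
          (fun x => by rw [h3]; tauto) hyw.symm hcw hcy (by rw [h1, e5])
  have hrw := (hs.2 w hcw).1 hw
  have hcr := hs.1
  rw [e5] at hcr
  have hOr : ∀ x, G.Adj r x → c' x = k → x = w := by
    intro x hx hcx
    have h3 := (hNb' x).1 ((hs.2 x (by rw [hcx, e5]; simp)).2 hx)
    have : x ≠ b := by rintro rfl; rw [h1] at hcx; simp at hcx
    tauto
  have hwt : w ≠ t := by
    rintro rfl
    have := (hNt b').1 hw.symm
    grind
  have hrb : r ≠ b := by
    rintro rfl
    have := hOr t ((hNb t).2 (by simp)) e1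
    exact hwt this.symm
  have hrt : r ≠ t' := by
    rintro rfl
    have h3 := hOr a ((hNt' a).2 (by simp)) e3
    have h4 := hOr d ((hNt' d).2 (by simp)) e4
    exact had (h3.trans h4.symm)
  refine ⟨w, r, hwb, hNb', hcw', hr, by rw [← h2 r hrb, hcr], hrw, fun x hx hcx => hOr x hx ?_⟩
  by_cases hxb : x = b
  · subst hxb
    have := (hNb r).1 hx.symm
    have : r ≠ t := by rintro rfl; rw [e1] at hcr; simp at hcr
    tauto
  · rw [h2 x hxb, hcx]

/-- The outcome of recolouring `a`, `a'`, `d`, `d'` for `a'` and its neighbour. -/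
theorem EConf.outcome (hG : Ctx G) (h : Opt G c) (p : EConf G c k t t' a b d a' b' d')
    (h1 : ∀ x, x = a ∨ x = a' ∨ x = d ∨ x = d' → c' x = !c x)
    (h2 : ∀ x, ¬ (x = a ∨ x = a' ∨ x = d ∨ x = d') → c' x = c x) :
    ¬ Bad G c' a ∧ ¬ Bad G c' a' ∧ (∀ x, ¬ Twin G a' x) ∧
      ∀ w, G.Adj a' w → w ≠ a → ¬ Bad G c' w ∧ ¬ Special G a' ∧ ¬ Special G w := by
  have hd := p.distinct
  have hct := p.ct
  have hct' := p.ct'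
  have hca := p.ca
  have hcb := p.cb
  have hcd := p.cd
  have hca' := p.ca'
  have hcd' := p.cd'
  have hab := p.ab
  have hbd := p.bd
  have had := p.ad
  have had' := p.ad'
  have hab' := p.ab'
  have hbd' := p.bd'
  have hdt' := p.dt'
  have hat' := p.at'
  have hNt := p.nbr_t
  have hNt' := p.nbr_t'
  have hNa := p.nbr_a
  have hNb := p.nbr_b
  have hNd := p.nbr_d
  have haa' := ((hNa a').2 (by simp)).symm
  have e1 := h2 t (by grind)
  have e2 := h2 t' (by grind)
  have e3 := h1 a (by grind)
  have e4 := h1 d (by grind)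
  have e5 := h1 a' (by grind)
  have e6 := h1 d' (by grind)
  have e7 := h2 b (by grind)
  simp only [hct, hct', hca, hcd, hca', hcd', hcb, Bool.not_not] at e1 e2 e3 e4 e5 e6 e7
  refine ⟨?_, ?_, ?_, ?_⟩
  · refine not_bad_of a t ((hNa t).2 (by simp)) (by rw [e1, e3]; simp) fun y hy hya hcy => ?_
    refine ⟨a', by rw [e5, e3]; simp, ?_⟩
    have := (hNt y).1 hy
    rw [e3] at hcy
    cases k <;> grind
  · refine not_bad_of a' a haa' (by rw [e5, e3]; simp) fun y hy hya hcy => ?_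
    refine ⟨d, by rw [e5, e4]; simp, ?_⟩
    have := (hNa y).1 hy
    rw [e5] at hcy
    have := G.adj_comm a' d
    have := (hNt d).2 (by simp)
    cases k <;> grind
  · intro x hx
    obtain ⟨p1, p2, p3, h3, h4, h5, h6⟩ := hG.tw a' x hx
    by_cases hc : ∃ w, G.Adj a' w ∧ w ≠ a
    · obtain ⟨w, hw, hwa⟩ := hc
      obtain ⟨w, r, hwa, hN, -⟩ := p.symm.connector hG h hw hwa
      have := (hN p1).1 ((h6 p1).2 (by simp))
      have := (hN p2).1 ((h6 p2).2 (by simp))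
      have := (hN p3).1 ((h6 p3).2 (by simp))
      grind
    · push Not at hc
      have := hc p1 ((h6 p1).2 (by simp))
      have := hc p2 ((h6 p2).2 (by simp))
      grind
  · intro x hx hxa
    obtain ⟨w, r, hwa, hN, hcw, hra, hcr, hrw, hr⟩ := p.symm.connector hG h hx hxa
    obtain rfl : x = w := by have := (hN x).1 hx; tauto
    have hna' : ¬ Leaf G a' := not_leaf hx haa' hxa
    refine ⟨?_, fun hs => ?_, fun hs => ?_⟩
    · have hxd : x ≠ d := by
        rintro rfl
        have := (hNd a').1 hx.symm
        grind
      have hrd : r ≠ d' := by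
        rintro rfl
        exact hxd (hr d ((hNd r).2 (by simp)).symm hcd).symm
      have hcx' := h2 x (by cases k <;> grind)
      have hcr' := h2 r (by cases k <;> grind)
      refine not_bad_of x r hrw.symm (by rw [hcx', hcr', hcw, hcr]; simp) fun y hy hyx hcy => ?_
      rw [hcx', hcw] at hcy
      have hcy' : c y ≠ k := fun hcy' => hyx (hr y hy hcy')
      have h3 : y = a' ∨ y = d' := by
        have := h2 y
        grind
      exfalso
      obtain rfl | rfl := h3
      · have := (hN r).1 hy.symm
        cases k <;> grind
      · by_cases hrd : r = d
        · rw [hrd, hcd] at hcr; simp at hcr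
        · obtain ⟨w', r', -, hN', hcw', -⟩ := p.rotate.connector hG h hy.symm hrd
          have := (hN' r).1 hy.symm
          cases k <;> grind
    · obtain ⟨l, hl, hl'⟩ := hs a haa'
      obtain rfl | rfl | rfl := (hNa l).1 hl
      · exact not_leaf ((hNt a).2 (by simp)) ((hNt b).2 (by simp)) hab hl'
      · exact not_leaf ((hNt' a).2 (by simp)) ((hNt' b).2 (by simp)) hab hl'
      · exact hna' hl'
    · obtain ⟨l, hl, hl'⟩ := hs a' hx.symm
      obtain rfl | rfl := (hN l).1 hl
      · exact not_leaf ((hNa t).2 (by simp)) ((hNa t').2 (by simp)) hd.1 hl'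
      · exact not_leaf hx.symm hrw.symm hra.symm hl'

theorem EConf.elim_of_not_leaf (hG : Ctx G) (h : Opt G c)
    (p : EConf G c k t t' a b d a' b' d') {m : V} (hm : G.Adj b' m) (hmb : m ≠ b) : False := by
  obtain ⟨c', h1, h2⟩ := exists_flip c (fun x => x = a ∨ x = a' ∨ x = d ∨ x = d')
  have hd := p.distinct
  have hct := p.ct
  have hct' := p.ct'
  have hca := p.ca
  have hcb := p.cb
  have hcd := p.cd
  have hca' := p.ca'
  have hcb' := p.cb'
  have hcd' := p.cd'
  have hab := p.ab
  have hbd := p.bd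
  have had := p.ad
  have had' := p.ad'
  have hab' := p.ab'
  have hbd' := p.bd'
  have hdt' := p.dt'
  have hat' := p.at'
  have hNt := p.nbr_t
  have hNt' := p.nbr_t'
  have hNa := p.nbr_a
  have hNb := p.nbr_b
  have hNd := p.nbr_d
  have e1 := h2 t (by grind)
  have e2 := h2 t' (by grind)
  have e3 := h1 a (by grind)
  have e4 := h1 d (by grind)
  have e5 := h1 a' (by grind)
  have e6 := h1 d' (by grind)
  have e7 := h2 b (by grind)
  simp only [hct, hct', hca, hcd, hca', hcd', hcb, Bool.not_not] at e1 e2 e3 e4 e5 e6 e7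
  obtain ⟨ha1, ha2, ha3, ha4⟩ := p.outcome hG h h1 h2
  obtain ⟨hd1, hd2, hd3, hd4⟩ := p.rotate.symm.outcome hG h (c' := c')
    (fun x hx => h1 x (by tauto)) (fun x hx => h2 x (by tauto))
  have hlos : ∀ f x, c' f = (!c f) → G.Adj f x → c x = (!c f) → c' x = c x →
      (f = a ∧ x = t') ∨ (f = d ∧ x = t') ∨ (f = a' ∧ G.Adj a' x ∧ x ≠ a) ∨
        (f = d' ∧ G.Adj d' x ∧ x ≠ d) := by
    intro f x hf hfx hcx hx
    have hff : f = a ∨ f = a' ∨ f = d ∨ f = d' := by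
      by_contra hff
      have := h2 f hff
      grind
    obtain rfl | rfl | rfl | rfl := hff <;> cases k <;> grind
  refine h.improve (c' := c') (adm_of_losers h.adm ?_ ?_) ?_
    (Or.inl ⟨t, trivial, p.emp, fun he => ?_⟩)
  · intro x y hx
    have : x = a ∨ x = a' ∨ x = d ∨ x = d' := by
      by_contra hxx
      exact hx (h2 x hxx)
    obtain rfl | rfl | rfl | rfl := this
    · exact p.nt_a h.adm y
    · exact ha3 y
    · exact p.rotate.rotate.nt_a h.adm y
    · exact hd3 y
  · intro x m' hx hxm hcm hm'
    obtain ⟨rfl, rfl⟩ | ⟨rfl, rfl⟩ | ⟨rfl, h3, h4⟩ | ⟨rfl, h3, h4⟩ := hlos x m' hx hxm hcm hm'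
    · exact ⟨(p.not_special h.adm).2.2, (p.not_special h.adm).2.1⟩
    · exact ⟨(p.rotate.rotate.not_special h.adm).2.2, (p.not_special h.adm).2.1⟩
    · exact (ha4 m' h3 h4).2
    · exact (hd4 m' h3 h4).2
  · intro x hx
    by_cases hcx : c' x = c x
    · obtain h3 | ⟨f, hf, hf1, hf2⟩ := hx.cases
      · grind
      obtain ⟨rfl, rfl⟩ | ⟨rfl, rfl⟩ | ⟨rfl, h3, h4⟩ | ⟨rfl, h3, h4⟩ := hlos f x hf1 hf hf2 hcx
      iterate 2
        · obtain ⟨w, r, hwb, hN, hcw, -⟩ := p.connector hG h hm hmb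
          refine not_bad_of x b ((hNt' b).2 (by simp)) (by rw [e7, e2]; simp) fun y hy hyt hcy => ?_
          rw [e2] at hcy
          have : y = b' := by
            have := (hNb y).1 hy
            cases k <;> grind
          subst this
          have := (hN w).2 (by simp)
          refine ⟨w, ?_, ?_⟩
          · rw [h2 w (by have := G.adj_comm y w; cases k <;> grind), e2, hcw]; simp
          · have := G.adj_comm y w
            cases k <;> grind
      · exact (ha4 x h3 h4).1
      · exact (hd4 x h3 h4).1
    · have : x = a ∨ x = a' ∨ x = d ∨ x = d' := by
        by_contra hxx
        exact hcx (h2 x hxx)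
      obtain rfl | rfl | rfl | rfl := this
      · exact ha1
      · exact ha2
      · exact hd1
      · exact hd2
  · have := he a ((hNt a).2 (by simp))
    rw [e3, e1] at this
    simp at this

theorem EConf.elim (hG : Ctx G) (h : Opt G c) (p : EConf G c k t t' a b d a' b' d') : False := by
  have hleaf : ∀ {a b d a' b' d'}, EConf G c k t t' a b d a' b' d' → Supp G b := by
    intro a b d a' b' d' p
    refine ⟨b', (p.nbr_b b').2 (by simp), b, fun x => ⟨fun hx => ?_, ?_⟩⟩
    · by_contra hxb
      exact p.elim_of_not_leaf hG h hx hxb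
    · rintro rfl
      exact ((p.nbr_b b').2 (by simp)).symm
  refine (p.not_special h.adm).1 fun m hm => ?_
  obtain rfl | rfl | rfl := (p.nbr_t m).1 hm
  · exact hleaf p.symm
  · exact hleaf p
  · exact hleaf p.rotate

end

end LD

namespace LD
variable {V : Type*} {G : SimpleGraph V} {c c' : V → Bool}

section
variable [Fintype V] {t t' a b d : V}

theorem Opt.exists_third (hG : Ctx G) (h : Opt G c) (ht : Twin G t t')
    (hN : ∀ x, G.Adj t x ↔ x = a ∨ x = b ∨ x = d) (hab : a ≠ b) (had : a ≠ d) (hbd : b ≠ d)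
    (hemp : Emp G c t) :
    ∃ a', a' ≠ t' ∧ c a' = (!c t) ∧ ∀ x, G.Adj a x ↔ x = t ∨ x = t' ∨ x = a' := by
  obtain ⟨k, hct⟩ : ∃ k, c t = k := ⟨_, rfl⟩
  have hct' := Bool.eq_not_of_ne (h.adm.twin t t' ht).symm
  have hN' : ∀ x, G.Adj t' x ↔ x = a ∨ x = b ∨ x = d := fun x => by rw [← ht.2, hN]
  have hca := hemp a ((hN a).2 (by simp))
  have hcb := hemp b ((hN b).2 (by simp))
  have hcd := hemp d ((hN d).2 (by simp))
  have hat := ((hN a).2 (by simp)).symm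
  have hat' := ((hN' a).2 (by simp)).symm
  have hbt := ((hN b).2 (by simp)).symm
  have hbt' := ((hN' b).2 (by simp)).symm
  have hdt := ((hN d).2 (by simp)).symm
  have hdt' := ((hN' d).2 (by simp)).symm
  rw [hct] at hct' hca hcb hcd ⊢
  have htt := ht.1
  by_contra hcon
  have hno : ∀ x, G.Adj a x → x ≠ t' → c x = k := by
    intro x hx hxt'
    by_contra hcx
    have hxt : x ≠ t := by rintro rfl; exact hcx hct
    exact hcon ⟨x, hxt', Bool.eq_not_of_ne hcx, hG.nbr3 hat hat' hx htt hxt.symm hxt'.symm⟩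
  obtain ⟨c', h1, h2⟩ := exists_flip c (fun x => x = a)
  have h1 := h1 a rfl
  have e1 := h2 t hat.ne'
  have e2 := h2 t' hat'.ne'
  have e3 := h2 b hab.symm
  have e4 := h2 d had.symm
  rw [hca] at h1
  rw [hct] at e1
  rw [hct'] at e2
  rw [hcb] at e3
  rw [hcd] at e4
  have hlos : ∀ f x, c' f = (!c f) → G.Adj f x → c x = (!c f) → f = a ∧ x = t' := by
    intro f x hf hfx hcx
    have hff : f = a := by
      by_contra hff
      have := h2 f hff
      grind
    subst hff
    have := hno x hfx
    grind
  have hnta : ∀ x y, G.Adj t x → G.Adj t y → ¬ Twin G x y := fun x y hx hy hxy =>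
    h.adm.twin x y hxy ((hemp x hx).trans (hemp y hy).symm)
  have hnst := not_special h.adm hat.symm (hca.trans hct.symm)
  refine h.improve (c' := c') (adm_of_losers h.adm ?_ ?_) ?_
    (Or.inl ⟨t, trivial, hemp, fun he => ?_⟩)
  · intro x y hx hxy
    have : x = a := by
      by_contra hxx
      exact hx (h2 x hxx)
    subst this
    exact hnta x y hat.symm ((hxy.2 t).1 hat).symm hxy
  · intro x m hx hxm hcm hm
    obtain ⟨rfl, rfl⟩ := hlos x m hx hxm hcm
    exact ⟨not_special h.adm hat (hct.trans hca.symm),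
      fun hs => hnst fun m hm => hs m ((ht.2 m).1 hm)⟩
  · intro x hx
    have : x = a ∨ x = t' := by
      obtain h3 | ⟨f, hf, hf1, hf2⟩ := hx.cases
      · by_contra hxx
        have := h2 x (by tauto)
        grind
      · have := hlos f x hf1 hf hf2
        tauto
    obtain rfl | rfl := this
    · refine not_bad_of x t hat (by rw [e1, h1]; simp) fun y hy hyb hcy => ?_
      rw [h1] at hcy
      have := (hN y).1 hy
      grind
    · refine not_bad_of x b hbt'.symm (by rw [e2, e3]; simp) fun y hy hyb hcy => ?_
      refine ⟨d, by rw [e4, e2]; simp, fun hiff => ?_⟩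
      have hyd := (hiff.1 hdt'.symm).symm
      have hyt : y ≠ t := by rintro rfl; rw [e2, e1] at hcy; simp at hcy
      have h3 := hG.nbr3 hbt hbt' hy htt hyt.symm hyb.symm
      have h4 := hG.nbr3 hdt hdt' hyd htt hyt.symm hyb.symm
      exact hnta b d hbt.symm hdt.symm ⟨hbd, fun x => by rw [h3, h4]⟩
  · have := he a hat.symm
    rw [h1, e1] at this
    simp at this

theorem Opt.not_emp_of_twin (hG : Ctx G) (h : Opt G c) (ht : Twin G t t') (hemp : Emp G c t) :
    False := by
  obtain ⟨a, b, d, hab, had, hbd, hN⟩ := hG.tw t t' ht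
  obtain ⟨a', ha1, ha2, ha3⟩ := h.exists_third hG ht hN hab had hbd hemp
  obtain ⟨b', hb1, hb2, hb3⟩ := h.exists_third hG ht (a := b) (b := a) (d := d)
    (fun x => by rw [hN]; tauto) hab.symm hbd had hemp
  obtain ⟨d', hd1, hd2, hd3⟩ := h.exists_third hG ht (a := d) (b := a) (d := b)
    (fun x => by rw [hN]; tauto) had.symm hbd.symm hab hemp
  have hca := hemp a ((hN a).2 (by simp))
  have hcb := hemp b ((hN b).2 (by simp))
  have hcd := hemp d ((hN d).2 (by simp))
  have hne : ∀ x y x' y', c x = c t → c y = c t → x ≠ y →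
      (∀ z, G.Adj x z ↔ z = t ∨ z = t' ∨ z = x') →
      (∀ z, G.Adj y z ↔ z = t ∨ z = t' ∨ z = y') → x' ≠ y' := by
    rintro x y x' y' hx hy hxy h1 h2 rfl
    exact h.adm.twin x y ⟨hxy, fun z => by rw [h1, h2]⟩ (hx.trans hy.symm)
  have p : EConf G c (c t) t t' a b d a' b' d' := ⟨ht, hN, ha3, hb3, hd3, rfl,
    Bool.eq_not_of_ne (h.adm.twin t t' ht).symm, hca, hcb, hcd, ha2, hb2, hd2, hab, had, hbd,
    hne a b a' b' hca hcb hab ha3 hb3, hne a d a' d' hca hcd had ha3 hd3,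
    hne b d b' d' hcb hcd hbd hb3 hd3, ha1, hb1, hd1⟩
  exact p.elim hG h

theorem Opt.of_bad (h : Opt G c) (h' : Adm G c') {t : V} (ht : Bad G c t)
    (key : ∀ x, x ≠ t → Touched G c c' x → ¬ Bad G c' x) : Opt G c' := by
  classical
  refine ⟨h', fun c'' h'' => ?_⟩
  have h1 := (mono_of_touched (A := Finset.univ.erase t)
    fun x hx => key x (by simpa using hx)).1
  have h2 : D G c Finset.univ ≤ D G c (Finset.univ.erase t) := by
    refine D_erase_bad G c _ t ?_
    obtain ht | ⟨v, hv, hv'⟩ := ht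
    · exact Or.inl ht
    · exact Or.inr ⟨v, Finset.mem_univ _, hv, hv'⟩
  have h3 : D G c' (Finset.univ.erase t) ≤ D G c' Finset.univ := by
    unfold D
    exact Finset.card_le_card (Finset.image_subset_image
      (Finset.filter_subset_filter _ (Finset.erase_subset _ _)))
  have := h.max c'' h''
  omega

theorem Opt.conflict_twin_single (hG : Ctx G) (h : Opt G c) {x : V} (ht : Twin G t t') (htx : t ≠ x)
    (hs : Same G c t x) (hN : ∀ z, G.Adj t z ↔ z = a ∨ z = b ∨ z = d) (hab : a ≠ b) (had : a ≠ d)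
    (hbd : b ≠ d) (hca : c a ≠ c t) (hcb : c b = c t) (hcd : c d = c t) : False := by
  obtain ⟨k, hct⟩ : ∃ k, c t = k := ⟨_, rfl⟩
  have hct' := Bool.eq_not_of_ne (h.adm.twin t t' ht).symm
  have hN' : ∀ x, G.Adj t' x ↔ x = a ∨ x = b ∨ x = d := fun x => by rw [← ht.2, hN]
  have hat := ((hN a).2 (by simp)).symm
  have hat' := ((hN' a).2 (by simp)).symm
  have hbt := ((hN b).2 (by simp)).symm
  have hbt' := ((hN' b).2 (by simp)).symm
  have hdt := ((hN d).2 (by simp)).symm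
  have hdt' := ((hN' d).2 (by simp)).symm
  have hax := ((hs.2 a hca).1 hat.symm).symm
  have hcx := hs.1.symm
  have hO : ∀ z, G.Adj x z → c z ≠ c t → z = a := by
    intro z hz hcz
    have := (hN z).1 ((hs.2 z hcz).2 hz)
    grind
  have hca := Bool.eq_not_of_ne hca
  rw [hct] at hct' hca hcb hcd hcx hO
  have htt := ht.1
  have hxt' : x ≠ t' := by rintro rfl; rw [hcx] at hct'; simp at hct'
  have hNa := hG.nbr3 hat hat' hax htt htx hxt'.symm
  have hntx : ∀ y, ¬ Twin G x y := by
    intro y hy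
    have h1 := h.adm.twin x y hy
    obtain rfl | rfl | rfl := (hNa y).1 ((hy.2 a).1 hax.symm).symm
    · exact h1 (hcx.trans hct.symm)
    · refine h.adm.twin x t ⟨htx.symm, fun z => by rw [hy.2, ht.2]⟩ (hcx.trans hct.symm)
    · exact h1 rfl
  have hM : ∀ y y', G.Adj x y → G.Adj x y' → y ≠ a → y' ≠ a → y = y' := by
    intro y y' hy hy' hya hya'
    by_contra hyy
    have h1 := hG.nbr3 hax.symm hy hy' hya.symm hya'.symm hyy
    refine h.conflict_one_two hG htx.symm (same_symm hs) hntx h1 hyy ?_ ?_ ?_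
    · rw [hca, hcx]; simp
    · by_contra hcy; exact hya (hO y hy (by rwa [hcx] at hcy))
    · by_contra hcy; exact hya' (hO y' hy' (by rwa [hcx] at hcy))
  have hxbd : ∀ b d, G.Adj t' b → G.Adj t' d → G.Adj b t → c b = k → c d = k → b ≠ a → d ≠ a →
      b ≠ d → d ≠ x → ¬ G.Adj x b := by
    intro b d hbt' hdt' hbt hcb hcd hba hda hbd hdx hxb
    obtain ⟨-, -, -, -, s, hs1, -, hs3⟩ := h.flip_bad (Or.inr ⟨t, htx, same_symm hs⟩) hxb
      (hcb.trans hcx.symm) hntx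
    have hNb := hG.nbr3 hbt hbt'.symm hxb.symm htt htx hxt'.symm
    rw [hcx] at hs1 hs3
    obtain rfl | rfl | rfl := (hNb s).1 ((hs3 b hcb hxb.ne').2 hxb).symm
    · exact hs1 hct
    · exact hbd (hM b d hxb ((hs3 d hcd hdx).1 hdt') hba hda)
    · exact hs1 hcx
  have hbx : b ≠ x := by
    rintro rfl
    have := (hN a).1
    exact h.conflict_not_adj hG hs hbt.symm
  have hdx : d ≠ x := by
    rintro rfl
    exact h.conflict_not_adj hG hs hdt.symm
  have hxb := hxbd b d hbt'.symm hdt'.symm hbt hcb hcd hab.symm had.symm hbd hdx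
  have hxd := hxbd d b hdt'.symm hbt'.symm hdt hcd hcb had.symm hab.symm hbd.symm hbx
  obtain ⟨c', h1, h2⟩ := exists_flip c (fun z => z = a ∨ z = x)
  have e1 := h1 a (by simp)
  have e2 := h1 x (by simp)
  have e3 := h2 t (by have := hat.ne; grind)
  have e4 := h2 t' (by have := hat'.ne; grind)
  have e5 := h2 b (by grind)
  have e6 := h2 d (by grind)
  simp only [hct, hct', hca, hcb, hcd, hcx, Bool.not_not] at e1 e2 e3 e4 e5 e6
  have hlos : ∀ f z, c' f = (!c f) → G.Adj f z → c z = (!c f) →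
      (z = a ∨ z = x) ∨ f = a ∧ z = t := by
    intro f z hf hfz hcz
    have hff : f = a ∨ f = x := by
      by_contra hff
      have := h2 f hff
      grind
    obtain rfl | rfl := hff
    · grind
    · have := hO z hfz
      grind
  have hnst := not_special h.adm hbt.symm (hcb.trans hct.symm)
  have h' := h.of_bad (c' := c') (t := t) (adm_of_losers h.adm ?_ ?_) (Or.inr ⟨x, htx.symm, hs⟩) ?_
  · refine h'.not_emp_of_twin hG ht fun z hz => ?_
    obtain rfl | rfl | rfl := (hN z).1 hz
    · rw [e1, e3]
    · rw [e5, e3]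
    · rw [e6, e3]
  · intro z y hz hzy
    have : z = a ∨ z = x := by
      by_contra hxx
      exact hz (h2 z hxx)
    obtain rfl | rfl := this
    · have h3 := (hN y).1 ((hzy.2 t).1 hat).symm
      have h4 := ((hzy.2 x).1 hax).symm
      have := hzy.1
      grind
    · exact hntx y hzy
  · intro z m hz hzm hcm hm
    have h3 := hlos z m hz hzm hcm
    have h4 := h1 m
    obtain ⟨rfl, rfl⟩ : z = a ∧ m = t := by grind
    refine ⟨fun hs => ?_, hnst⟩
    obtain ⟨l, hl, hl'⟩ := hs m hat
    obtain rfl | rfl | rfl := (hN l).1 hl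
    · exact not_leaf hat hat' htt hl'
    · exact not_leaf hbt hbt' htt hl'
    · exact not_leaf hdt hdt' htt hl'
  · intro z hzt hz
    have : z = a ∨ z = x := by
      obtain h3 | ⟨f, hf, hf1, hf2⟩ := hz.cases
      · by_contra hxx
        have := h2 z (by tauto)
        grind
      · have := hlos f z hf1 hf hf2
        tauto
    obtain rfl | rfl := this
    · refine not_bad_of z t' hat' (by rw [e1, e4]; simp) fun y hy hyb hcy => ?_
      refine ⟨x, by rw [e2, e1]; simp, ?_⟩
      have := (hN' y).1 hy
      have := G.adj_comm x b
      have := G.adj_comm x d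
      grind
    · refine not_bad_of z a hax.symm (by rw [e1, e2]; simp) fun y hy hyb hcy => ?_
      refine ⟨b, by rw [e5, e2]; simp, ?_⟩
      have := (hNa y).1 hy
      have : y ≠ t := by rintro rfl; rw [e2, e3] at hcy; simp at hcy
      have := hbt'.symm
      grind

/-- A vertex with an open twin is located. -/
theorem Opt.conflict_twin (hG : Ctx G) (h : Opt G c) {x : V} (ht : Twin G t t') (htx : t ≠ x)
    (hs : Same G c t x) : False := by
  obtain ⟨a, b, d, hab, had, hbd, hN⟩ := hG.tw t t' ht
  have hne : ¬ Emp G c t := fun he => h.not_emp_of_twin hG ht he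
  have key : ∀ a b d, a ≠ b → a ≠ d → b ≠ d → (∀ x, G.Adj t x ↔ x = a ∨ x = b ∨ x = d) →
      c a ≠ c t → False := by
    clear hab had hbd hN a b d
    intro a b d hab had hbd hN hca
    by_cases hcb : c b = c t
    · by_cases hcd : c d = c t
      · exact h.conflict_twin_single hG ht htx hs hN hab had hbd hca hcb hcd
      · exact h.conflict_two_one hG htx hs (w := a) (w' := d) (y := b)
          (fun x => by rw [hN]; tauto) had hca hcd hcb
    · by_cases hcd : c d = c t
      · exact h.conflict_two_one hG htx hs hN hab hca hcb hcd
      · have h1 := hG.nbr3 ((hs.2 a hca).1 ((hN a).2 (by simp)))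
          ((hs.2 b hcb).1 ((hN b).2 (by simp))) ((hs.2 d hcd).1 ((hN d).2 (by simp))) hab had hbd
        exact h.adm.twin t x ⟨htx, fun z => by rw [hN, h1]⟩ hs.1
  by_cases hca : c a = c t
  · by_cases hcb : c b = c t
    · by_cases hcd : c d = c t
      · refine hne fun z hz => ?_
        obtain rfl | rfl | rfl := (hN z).1 hz <;> assumption
      · exact key d a b had.symm hbd.symm hab (fun x => by rw [hN]; tauto) hcd
    · exact key b a d hab.symm hbd had (fun x => by rw [hN]; tauto) hcb
  · exact key a b d hab had hbd hN hca
end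

end LD

namespace LD
variable {V : Type*} {G : SimpleGraph V} {c c' : V → Bool}

section
variable [Fintype V]

theorem Opt.conflict_shape (hG : Ctx G) (h : Opt G c) {u v : V} (huv : u ≠ v) (hs : Same G c u v)
    (hut : ∀ x, ¬ Twin G u x) {w : V} (hw : G.Adj u w) (hcw : c w ≠ c u) :
    (∀ x, G.Adj u x → c x ≠ c u) ∨ ∃ y, c y = c u ∧ ∀ x, G.Adj u x ↔ x = w ∨ x = y := by
  by_cases hy : ∃ y, G.Adj u y ∧ c y = c u
  · obtain ⟨y, hy, hcy⟩ := hy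
    have hwy : w ≠ y := by rintro rfl; exact hcw hcy
    obtain hN | ⟨d, hdw, hdy, hN⟩ := hG.nbr2 hw hy hwy
    · exact Or.inr ⟨y, hcy, hN⟩
    · by_cases hcd : c d = c u
      · exact (h.conflict_one_two hG huv hs hut hN hdy.symm hcw hcy hcd).elim
      · exact (h.conflict_two_one hG huv hs (w := w) (w' := d) (y := y)
          (fun x => by rw [hN]; tauto) hdw.symm hcw hcd hcy).elim
  · push Not at hy
    exact Or.inl hy

theorem Opt.conflict_leaf (hG : Ctx G) (h : Opt G c) {u v w y : V} (huv : u ≠ v)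
    (hs : Same G c u v) (hut : ∀ x, ¬ Twin G u x) (hN : ∀ x, G.Adj u x ↔ x = w ∨ x = y)
    (hcw : c w ≠ c u) (hcy : c y = c u) (hv : ∀ x, G.Adj v x → c x ≠ c v) : False := by
  have hNv : ∀ x, G.Adj v x ↔ x = w := by
    intro x
    constructor
    · intro hx
      have h1 := hv x hx
      rw [← hs.1] at h1
      have h2 := (hN x).1 ((hs.2 x h1).2 hx)
      rcases h2 with rfl | rfl
      · rfl
      · exact (h1 hcy).elim
    · rintro rfl
      exact (hs.2 x hcw).1 ((hN x).2 (Or.inl rfl))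
  have huy : G.Adj u y := (hN y).2 (Or.inr rfl)
  obtain ⟨c', h', hcu, hc, s, hsu, hss, -⟩ :=
    h.flip_bad (Or.inr ⟨v, huv.symm, hs⟩) huy hcy hut
  have hus : u ≠ s := by rintro rfl; exact hsu rfl
  have hst : ∀ x, ¬ Twin G s x := fun x hx => h'.conflict_twin hG hx hus.symm (same_symm hss)
  have hyu : y ≠ u := huy.ne'
  have hwu : w ≠ u := ((hN w).2 (Or.inl rfl)).ne'
  have hcy' : c' y ≠ c' u := by rw [hcu, hc y hyu, hcy]; simp
  have hcw' : c' w = c' u := by rw [hcu, hc w hwu]; exact Bool.eq_not_of_ne hcw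
  have hsy : G.Adj s y := (hss.2 y hcy').1 huy
  obtain hA | ⟨z, hz, hNs⟩ := h'.conflict_shape hG hus.symm (same_symm hss) hst hsy
    (by rw [← hss.1]; exact hcy')
  · have hl : Leaf G s := by
      refine ⟨y, fun x => ⟨fun hx => ?_, ?_⟩⟩
      · have h1 := hA x hx
        rw [← hss.1] at h1
        rcases (hN x).1 ((hss.2 x h1).2 hx) with rfl | rfl
        · exact (h1 hcw').elim
        · rfl
      · rintro rfl; exact hsy
    refine not_special h.adm huy hcy fun m hm => ?_
    rcases (hN m).1 hm with rfl | rfl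
    · exact ⟨v, ((hNv m).2 rfl).symm, m, hNv⟩
    · exact ⟨s, hsy.symm, hl⟩
  · exact h'.conflict_one_one hG hus hss (w := y) (y := w) (z := z)
      (fun x => by rw [hN]; tauto) hNs hcy' hcw' (hz.trans hss.1.symm)

theorem Opt.no_conflict (hG : Ctx G) (h : Opt G c) {u v : V} (huv : u ≠ v)
    (hs : Same G c u v) (hE : ∀ x, ∃ y, G.Adj x y) : False := by
  have hut : ∀ x, ¬ Twin G u x := fun x hx => h.conflict_twin hG hx huv hs
  have hvt : ∀ x, ¬ Twin G v x := fun x hx => h.conflict_twin hG hx huv.symm (same_symm hs)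
  have hw : ∃ w, G.Adj u w ∧ c w ≠ c u := by
    by_contra! hw
    obtain ⟨m, hm⟩ := hE u
    exact h.not_emp_of_not_twin hG hm hw hut
  obtain ⟨w, hw, hcw⟩ := hw
  have hwv := (hs.2 w hcw).1 hw
  have hcwv : c w ≠ c v := hs.1 ▸ hcw
  obtain hA | ⟨y, hy, hN⟩ := h.conflict_shape hG huv hs hut hw hcw <;>
  obtain hB | ⟨z, hz, hN'⟩ := h.conflict_shape hG huv.symm (same_symm hs) hvt hwv hcwv
  · refine hut v ⟨huv, fun x => ⟨fun hx => (hs.2 x (hA x hx)).1 hx, fun hx => ?_⟩⟩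
    have := hB x hx
    rw [← hs.1] at this
    exact (hs.2 x this).2 hx
  · exact h.conflict_leaf hG huv.symm (same_symm hs) hvt hN' hcwv hz hA
  · exact h.conflict_leaf hG huv hs hut hN hcw hy hB
  · exact h.conflict_one_one hG huv hs hN hN' hcw hy (hz.trans hs.1.symm)

theorem Opt.not_bad (hG : Ctx G) (h : Opt G c) (hE : ∀ x, ∃ y, G.Adj x y) (x : V) :
    ¬ Bad G c x := by
  rintro (hx | ⟨v, hv, hs⟩)
  · by_cases ht : ∃ y, Twin G x y
    · obtain ⟨y, ht⟩ := ht
      exact h.not_emp_of_twin hG ht hx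
    · push Not at ht
      obtain ⟨m, hm⟩ := hE x
      exact h.not_emp_of_not_twin hG hm hx ht
  · exact h.no_conflict hG hv.symm hs hE

end
end LD

namespace LD
variable {V : Type*} {G : SimpleGraph V} {c c' : V → Bool}

theorem isLDSet_of_not_bad (h : ∀ x, ¬ Bad G c x) (k : Bool) : IsLDSet G {x | c x = k} := by
  refine ⟨fun v => ?_, fun u hu v hv huv heq => ?_⟩
  · by_cases hv : c v = k
    · exact ⟨v, Or.inl rfl, hv⟩
    · have : ¬ Emp G c v := fun he => h v (Or.inl he)
      unfold Emp at this
      push Not at this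
      obtain ⟨x, hx, hcx⟩ := this
      exact ⟨x, Or.inr hx, bool_eq hcx (Ne.symm hv)⟩
  · refine h u (Or.inr ⟨v, huv.symm, bool_eq hu hv, fun x hx => ?_⟩)
    have hxk : c x = k := bool_eq hx (Ne.symm hu)
    have := Set.ext_iff.1 heq x
    have hxu : x ≠ u := by rintro rfl; exact hx rfl
    have hxv : x ≠ v := by rintro rfl; exact hv hxk
    simpa [closedNbhd, hxk, hxu, hxv] using this

theorem exists_opt [Fintype V] (h : Adm G c) : ∃ c', Opt G c' := by
  obtain ⟨c', hc', hmax⟩ := (Set.toFinite {c' | Adm G c'}).exists_maximalFor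
    (fun c' => D G c' Finset.univ) _ ⟨c, h⟩
  exact ⟨c', hc', fun c'' h'' => (le_total _ _).elim id (hmax h'')⟩

theorem mem_of_closed (hconn : G.Connected) {S : Set V} {a : V} (ha : a ∈ S)
    (hS : ∀ x ∈ S, ∀ y, G.Adj x y → y ∈ S) (b : V) : b ∈ S := by
  obtain ⟨w⟩ := hconn.preconnected a b
  induction w with
  | nil => exact ha
  | cons hadj _ ih => exact ih (hS _ ha _ hadj)

theorem exists_adm [Finite V] (hG : Ctx G) (hspec : ∀ t t', Twin G t t' → ¬ Special G t)
    (htriple : ∀ t t' t'', Twin G t t' → Twin G t t'' → t' = t'') : ∃ c, Adm G c := by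
  classical
  obtain ⟨n, ⟨f⟩⟩ := Finite.exists_equiv_fin V
  refine ⟨fun x => decide (Supp G x ∨ ∃ y, Twin G x y ∧ f y < f x), fun p m hp hpm => ?_,
    fun t t' ht => ?_⟩
  · have hm : Supp G m := hp m hpm
    have h1 : ¬ Supp G p := by
      rintro ⟨l, hpl, m', hl⟩
      obtain ⟨l', hl', m'', hm''⟩ := hp l hpl
      have e1 := (hl p).1 hpl.symm
      have e2 := (hl l').1 hl'
      have e3 := (hm'' l).1 hl'.symm
      subst e1 e2 e3
      refine hG.small l' l l' l fun x y hx hxy => ?_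
      rcases hx with rfl | rfl | rfl | rfl
      · simp [(hm'' y).1 hxy]
      · simp [(hl y).1 hxy]
      · simp [(hm'' y).1 hxy]
      · simp [(hl y).1 hxy]
    have h2 : ¬ ∃ y, Twin G p y ∧ f y < f p := fun ⟨y, hy, _⟩ => hspec p y hy hp
    simp [h1, h2, hm]
  · have hs : ∀ t t', Twin G t t' → ¬ Supp G t := by
      rintro t t' ht ⟨l, htl, m, hl⟩
      exact ht.1 (((hl t).1 htl.symm).trans ((hl t').1 ((ht.2 l).1 htl).symm).symm)
    have key : ∀ t t', Twin G t t' →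
        ((Supp G t ∨ ∃ y, Twin G t y ∧ f y < f t) ↔ f t' < f t) := by
      intro t t' ht
      constructor
      · rintro (h | ⟨y, hy, hlt⟩)
        · exact (hs t t' ht h).elim
        · rwa [htriple t t' y ht hy]
      · exact fun h => Or.inr ⟨t', ht, h⟩
    have hne : f t ≠ f t' := fun h => ht.1 (f.injective h)
    simp only [key t t' ht, key t' t ht.symm, ne_eq, decide_eq_decide]
    intro h
    rcases lt_or_gt_of_ne hne with h1 | h1
    · exact lt_asymm h1 (h.2 h1)
    · exact lt_asymm h1 (h.1 h1)

theorem two_mul_ldNum_le_of_special_twin [Fintype V] (hconn : G.Connected) (hG : Ctx G) {t t' : V}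
    (ht : Twin G t t') (hs : Special G t) : 2 * ldNum G ≤ Fintype.card V := by
  classical
  obtain ⟨a, b, d, hab, had, hbd, hN⟩ := hG.tw t t' ht
  have aux : ∀ a, G.Adj t a → ∃ l, (∀ x, G.Adj l x ↔ x = a) ∧
      ∀ x, G.Adj a x ↔ x = t ∨ x = t' ∨ x = l := by
    intro z hz
    obtain ⟨l, hl, m, hm⟩ := hs z hz
    obtain rfl := (hm z).1 hl.symm
    have hz' := (ht.2 z).1 hz
    have h1 : ∀ y, Twin G t y ∨ y = t → y ≠ l := by
      rintro y hy rfl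
      have h2 : ∀ x, G.Adj t x ↔ G.Adj y x := by
        rcases hy with hy | rfl
        · exact hy.2
        · exact fun _ => Iff.rfl
      exact hab (((hm a).1 ((h2 a).1 ((hN a).2 (by simp)))).trans
        ((hm b).1 ((h2 b).1 ((hN b).2 (by simp)))).symm)
    exact ⟨l, hm, hG.nbr3 hz.symm hz'.symm hl ht.1 (h1 t (Or.inr rfl)) (h1 t' (Or.inl ht))⟩
  have hta := (hN a).2 (by simp)
  have htb := (hN b).2 (by simp)
  have htd := (hN d).2 (by simp)
  obtain ⟨a', ha', hNa⟩ := aux a hta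
  obtain ⟨b', hb', hNb⟩ := aux b htb
  obtain ⟨d', hd', hNd⟩ := aux d htd
  have hNt' : ∀ x, G.Adj t' x ↔ x = a ∨ x = b ∨ x = d := fun x => by rw [← ht.2, hN]
  have hall : ∀ x, x = t ∨ x = a ∨ x = b ∨ x = d ∨ x = t' ∨ x = a' ∨ x = b' ∨ x = d' := by
    refine mem_of_closed hconn (S := {x | x = t ∨ x = a ∨ x = b ∨ x = d ∨ x = t' ∨ x = a' ∨ x = b' ∨
      x = d'}) (a := t) (Or.inl rfl) ?_
    rintro x (rfl | rfl | rfl | rfl | rfl | rfl | rfl | rfl) y hy <;> simp only [Set.mem_ofPred_eq]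
    · have := (hN y).1 hy; tauto
    · have := (hNa y).1 hy; tauto
    · have := (hNb y).1 hy; tauto
    · have := (hNd y).1 hy; tauto
    · have := (hNt' y).1 hy; tauto
    · have := (ha' y).1 hy; tauto
    · have := (hb' y).1 hy; tauto
    · have := (hd' y).1 hy; tauto
  have n1 := ht.1
  have hirr : ∀ x, ¬ G.Adj x x := fun x => G.loopless.irrefl x
  have hcard : ({t, a, b, d, t', a', b', d'} : Finset V).card = 8 := by
    have hl : ∀ {l m}, (∀ x, G.Adj l x ↔ x = m) → ∀ {z p q}, G.Adj z p → G.Adj z q → p ≠ q →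
        z ≠ l := by
      rintro l m hl z p q hp hq hpq rfl
      exact hpq (((hl p).1 hp).trans ((hl q).1 hq).symm)
    have hta' := (ht.2 a).1 hta
    have htb' := (ht.2 b).1 htb
    have htd' := (ht.2 d).1 htd
    have p1 := hta.ne
    have p2 := htb.ne
    have p3 := htd.ne
    have p4 := hta'.ne
    have p5 := htb'.ne
    have p6 := htd'.ne
    have q : ∀ l m, (∀ x, G.Adj l x ↔ x = m) → l ≠ t ∧ l ≠ t' ∧ l ≠ a ∧ l ≠ b ∧ l ≠ d :=
      fun l m h => ⟨(hl h hta htb hab).symm, (hl h hta' htb' hab).symm,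
        (hl h hta.symm hta'.symm n1).symm, (hl h htb.symm htb'.symm n1).symm,
        (hl h htd.symm htd'.symm n1).symm⟩
    have qa := q a' a ha'
    have qb := q b' b hb'
    have qd := q d' d hd'
    have r1 : a' ≠ b' := by rintro rfl; exact hab ((hb' a).1 ((ha' a).2 rfl))
    have r2 : a' ≠ d' := by rintro rfl; exact had ((hd' a).1 ((ha' a).2 rfl))
    have r3 : b' ≠ d' := by rintro rfl; exact hbd ((hd' b).1 ((hb' b).2 rfl))
    clear q hl hirr ha' hb' hd' hNa hNb hNd hNt' hall hN aux
    have m1 : t ∉ ({a, b, d, t', a', b', d'} : Finset V) := by simp; grind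
    have m2 : a ∉ ({b, d, t', a', b', d'} : Finset V) := by simp; grind
    have m3 : b ∉ ({d, t', a', b', d'} : Finset V) := by simp; grind
    have m4 : d ∉ ({t', a', b', d'} : Finset V) := by simp; grind
    have m5 : t' ∉ ({a', b', d'} : Finset V) := by simp; grind
    have m6 : a' ∉ ({b', d'} : Finset V) := by simp; grind
    have m7 : b' ∉ ({d'} : Finset V) := by simp; grind
    simp only [Finset.card_insert_of_notMem, m1, m2, m3, m4, m5, m6, m7, not_false_eq_true,
      Finset.card_singleton]
  have h8 : 8 ≤ Fintype.card V := hcard ▸ Finset.card_le_univ _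
  have hLD : IsLDSet G (({t, a, b, d} : Finset V) : Set V) := by
    have hm : ∀ x y, x ∈ closedNbhd G y ∩ (({t, a, b, d} : Finset V) : Set V) ↔
      (x = y ∨ G.Adj y x) ∧ (x = t ∨ x = a ∨ x = b ∨ x = d) := by
      intro x y; simp [closedNbhd]
    constructor
    · intro x
      have : ∃ y, (y = x ∨ G.Adj x y) ∧ (y = t ∨ y = a ∨ y = b ∨ y = d) := by
        rcases hall x with rfl | rfl | rfl | rfl | rfl | rfl | rfl | rfl
        · exact ⟨x, by simp⟩
        · exact ⟨x, by simp⟩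
        · exact ⟨x, by simp⟩
        · exact ⟨x, by simp⟩
        · exact ⟨a, by simp [hNt']⟩
        · exact ⟨a, by simp [ha']⟩
        · exact ⟨b, by simp [hb']⟩
        · exact ⟨d, by simp [hd']⟩
      obtain ⟨y, hy⟩ := this
      exact ⟨y, (hm y x).2 hy⟩
    · intro u hu v hv huv heq
      have key : ∀ x, (x = a ∨ x = b ∨ x = d) → (G.Adj u x ↔ G.Adj v x) := by
        intro x hx
        have := Set.ext_iff.1 heq x
        rw [hm, hm] at this
        have hxS : x = t ∨ x = a ∨ x = b ∨ x = d := Or.inr hx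
        have hxu : x ≠ u := by rintro rfl; exact hu (by simpa using hxS)
        have hxv : x ≠ v := by rintro rfl; exact hv (by simpa using hxS)
        simpa [hxS, hxu, hxv] using this
      have ka := key a (by simp)
      have kb := key b (by simp)
      have kd := key d (by simp)
      simp only [Finset.coe_insert, Finset.coe_singleton, Set.mem_insert_iff,
        Set.mem_singleton_iff] at hu hv
      have code : ∀ x, ¬ (x = t ∨ x = a ∨ x = b ∨ x = d) →
          (x = t' ∧ G.Adj x a ∧ G.Adj x b ∧ G.Adj x d) ∨
          (x = a' ∧ G.Adj x a ∧ ¬ G.Adj x b ∧ ¬ G.Adj x d) ∨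
          (x = b' ∧ ¬ G.Adj x a ∧ G.Adj x b ∧ ¬ G.Adj x d) ∨
          (x = d' ∧ ¬ G.Adj x a ∧ ¬ G.Adj x b ∧ G.Adj x d) := by
        intro x hx
        rcases hall x with h | h | h | h | rfl | rfl | rfl | rfl
        · exact (hx (Or.inl h)).elim
        · exact (hx (Or.inr (Or.inl h))).elim
        · exact (hx (Or.inr (Or.inr (Or.inl h)))).elim
        · exact (hx (Or.inr (Or.inr (Or.inr h)))).elim
        · simp [hNt']
        · simp [ha', hab.symm, had.symm]
        · simp [hb', hab, hbd.symm]
        · simp [hd', had, hbd]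
      have hcu := code u hu
      have hcv := code v hv
      clear * - hcu hcv ka kb kd huv
      grind
  have := Nat.sInf_le (s := {k : ℕ | ∃ S : Set V, IsLDSet G S ∧ S.ncard = k}) ⟨_, hLD, rfl⟩
  rw [Set.ncard_coe_finset] at this
  have h4 : ({t, a, b, d} : Finset V).card ≤ 4 := Finset.card_le_four
  unfold ldNum
  omega

theorem not_three_twins (hconn : G.Connected) (hG : Ctx G)
    (hK33 : ¬ Nonempty (G ≃g completeBipartiteGraph (Fin 3) (Fin 3))) {t t' t'' : V}
    (h : Twin G t t') (h' : Twin G t t'') : t' = t'' := by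
  by_contra hne
  obtain ⟨a, b, d, hab, had, hbd, hN⟩ := hG.tw t t' h
  have hN' : ∀ x, G.Adj t' x ↔ x = a ∨ x = b ∨ x = d := fun x => by rw [← h.2, hN]
  have hN'' : ∀ x, G.Adj t'' x ↔ x = a ∨ x = b ∨ x = d := fun x => by rw [← h'.2, hN]
  have aux : ∀ x, G.Adj t x → ∀ y, G.Adj x y ↔ y = t ∨ y = t' ∨ y = t'' := fun x hx =>
    hG.nbr3 hx.symm ((h.2 x).1 hx).symm ((h'.2 x).1 hx).symm h.1 h'.1 hne
  have hNa := aux a ((hN a).2 (by simp))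
  have hNb := aux b ((hN b).2 (by simp))
  have hNd := aux d ((hN d).2 (by simp))
  have hall : ∀ x, x = t ∨ x = t' ∨ x = t'' ∨ x = a ∨ x = b ∨ x = d := by
    refine mem_of_closed hconn (S := {x | x = t ∨ x = t' ∨ x = t'' ∨ x = a ∨ x = b ∨ x = d})
      (a := t) (Or.inl rfl) ?_
    rintro x (rfl | rfl | rfl | rfl | rfl | rfl) y hy <;> simp only [Set.mem_ofPred_eq]
    · have := (hN y).1 hy; tauto
    · have := (hN' y).1 hy; tauto
    · have := (hN'' y).1 hy; tauto
    · have := (hNa y).1 hy; tauto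
    · have := (hNb y).1 hy; tauto
    · have := (hNd y).1 hy; tauto
  have hirr : ∀ x, ¬ G.Adj x x := fun x => G.loopless.irrefl x
  have h1 := h.1
  have h2 := h'.1
  have hne' : ∀ x, G.Adj t x → t ≠ x ∧ t' ≠ x ∧ t'' ≠ x := fun x hx =>
    ⟨hx.ne, ((h.2 x).1 hx).ne, ((h'.2 x).1 hx).ne⟩
  have ea := hne' a ((hN a).2 (by simp))
  have eb := hne' b ((hN b).2 (by simp))
  have ed := hne' d ((hN d).2 (by simp))
  have hbij : Function.Bijective (Sum.elim ![t, t', t''] ![a, b, d]) := by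
    constructor
    · rintro (i | i) (j | j) hij <;> fin_cases i <;> fin_cases j <;>
        simp at hij ⊢ <;> grind
    · intro x
      rcases hall x with rfl | rfl | rfl | rfl | rfl | rfl
      · exact ⟨.inl 0, rfl⟩
      · exact ⟨.inl 1, rfl⟩
      · exact ⟨.inl 2, rfl⟩
      · exact ⟨.inr 0, rfl⟩
      · exact ⟨.inr 1, rfl⟩
      · exact ⟨.inr 2, rfl⟩
  refine hK33 ⟨RelIso.symm ⟨Equiv.ofBijective _ hbij, ?_⟩⟩
  rintro (i | i) (j | j) <;> fin_cases i <;> fin_cases j <;>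
    simp [completeBipartiteGraph] <;> grind

theorem adj_iff_of_deg_eq_zero [Finite V] {x : V} (h : deg G x = 0) (y : V) : ¬ G.Adj x y := by
  have := (Set.ncard_eq_zero (Set.toFinite _)).1 h
  intro hy
  have : y ∈ G.neighborSet x := hy
  simp_all

theorem ctx_of_subcubic [Fintype V] (hconn : G.Connected) (hsub : Subcubic G)
    (hedges : 7 ≤ G.edgeSet.ncard)
    (hot : ¬ ∃ u v : V, OpenTwins G u v ∧ (deg G u = 1 ∨ deg G u = 2))
    (hE : ∀ x, ∃ y, G.Adj x y) : Ctx G := by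
  classical
  refine ⟨fun x a b d e ha hb hd he hab had hbd => ?_, fun t t' ht => ?_,
    fun a b d e hS => ?_⟩
  · by_contra! hne
    have h1 : ({a, b, d, e} : Finset V).card = 4 := by
      rw [Finset.card_insert_of_notMem (by simp; grind),
        Finset.card_insert_of_notMem (by simp; grind),
        Finset.card_insert_of_notMem (by simp; grind), Finset.card_singleton]
    have h2 : (({a, b, d, e} : Finset V) : Set V) ⊆ G.neighborSet x := by
      intro y
      simp only [Finset.coe_insert, Finset.coe_singleton, Set.mem_insert_iff,
        Set.mem_singleton_iff, mem_neighborSet]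
      rintro (rfl | rfl | rfl | rfl) <;> assumption
    have h3 := Set.ncard_le_ncard h2 (Set.toFinite _)
    rw [Set.ncard_coe_finset, h1] at h3
    have := hsub x
    unfold deg at this
    omega
  · have h0 : deg G t ≠ 0 := fun h => by
      obtain ⟨y, hy⟩ := hE t
      exact adj_iff_of_deg_eq_zero h y hy
    have h3 := hsub t
    have h12 : ¬ (deg G t = 1 ∨ deg G t = 2) := fun h =>
      hot ⟨t, t', ⟨ht.1, Set.ext ht.2⟩, h⟩
    have : deg G t = 3 := by omega
    obtain ⟨a, b, d, hab, had, hbd, hN⟩ := Set.ncard_eq_three.1 this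
    exact ⟨a, b, d, hab, had, hbd, fun x => by simpa using Set.ext_iff.1 hN x⟩
  · have hall := mem_of_closed hconn (S := {x | x = a ∨ x = b ∨ x = d ∨ x = e}) (a := a)
      (Or.inl rfl) (fun x hx y hxy => hS x y hx hxy)
    have h4 : Fintype.card V ≤ 4 := by
      have : (Finset.univ : Finset V) ⊆ {a, b, d, e} := fun x _ => by
        simpa using hall x
      exact (Finset.card_le_card this).trans Finset.card_le_four
    have h5 := G.card_edgeFinset_le_card_choose_two
    have h6 : (Fintype.card V).choose 2 ≤ Nat.choose 4 2 := Nat.choose_le_choose 2 h4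
    rw [← Set.ncard_coe_finset, coe_edgeFinset] at h5
    have : Nat.choose 4 2 = 6 := rfl
    omega

end LD

/-- A connected subcubic graph with at least 7 edges, not isomorphic to
`K_{3,3}`, and with no open twins of degree 1 or 2, satisfies `γ^LD(G) ≤ n/2`. -/
theorem stmt2 {V : Type*} [Fintype V] (G : SimpleGraph V)
    (hconn : G.Connected) (hsub : Subcubic G)
    (hedges : 7 ≤ G.edgeSet.ncard)
    (hK33 : ¬ Nonempty (G ≃g completeBipartiteGraph (Fin 3) (Fin 3)))
    (hot : ¬ ∃ u v : V, OpenTwins G u v ∧ (deg G u = 1 ∨ deg G u = 2)) :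
    2 * ldNum G ≤ Fintype.card V := by
  have hE : ∀ x, ∃ y, G.Adj x y := by
    intro x
    by_contra! hx
    have hall := LD.mem_of_closed hconn (S := {x}) (a := x) rfl (by
      rintro _ rfl y hy
      exact (hx y hy).elim)
    have : G.edgeSet = ∅ := by
      ext e
      induction e with
      | _ u v =>
        have h1 := hx v
        rw [← show u = x from hall u] at h1
        simpa using h1
    simp [this] at hedges
  have hG := LD.ctx_of_subcubic hconn hsub hedges hot hE
  by_cases hs : ∃ t t', LD.Twin G t t' ∧ LD.Special G t
  · obtain ⟨t, t', ht, hs⟩ := hs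
    exact LD.two_mul_ldNum_le_of_special_twin hconn hG ht hs
  push Not at hs
  obtain ⟨c, hc⟩ := LD.exists_adm hG hs fun t t' t'' h h' =>
    LD.not_three_twins hconn hG hK33 h h'
  obtain ⟨c, hc⟩ := LD.exists_opt hc
  have hLD := fun k => Nat.sInf_le (s := {k : ℕ | ∃ S : Set V, IsLDSet G S ∧ S.ncard = k})
    ⟨_, LD.isLDSet_of_not_bad (hc.not_bad hG hE) k, rfl⟩
  have h1 := hLD true
  have h2 := hLD false
  have h3 := Set.ncard_add_ncard_compl {x | c x = true}
  have h4 : {x | c x = true}ᶜ = {x | c x = false} := by ext; simp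
  rw [h4, Nat.card_eq_fintype_card] at h3
  unfold ldNum
  omega
end

section
/- Every connected cubic graph G on n vertices other than K_4 and K_{3,3} satisfies γ^LD(G) ≤ n/2 (twins are allowed). -/
open SimpleGraph

/-- `p` has exactly the three distinct neighbours `a`, `b`, `c`. -/
def HasNbrs {V : Type*} (G : SimpleGraph V) (p a b c : V) : Prop :=
  a ≠ b ∧ a ≠ c ∧ b ≠ c ∧ G.Adj p a ∧ G.Adj p b ∧ G.Adj p c ∧
    ∀ v, G.Adj p v → v = a ∨ v = b ∨ v = c

/-- `a b d e` is a 4-cycle of `G` that is properly coloured by `c`. -/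
def IsAlternating {V : Type*} (G : SimpleGraph V) (c : V → Bool) (a b d e : V) : Prop :=
  (G.Adj a b ∧ G.Adj b d ∧ G.Adj d e ∧ G.Adj e a ∧ a ≠ d ∧ b ≠ e) ∧
    c a ≠ c b ∧ c a = c d ∧ c b = c e

/-- The set `U` is perfectly matched by bichromatic edges, and every colouring extending `c`
from `U` leaves no alternating 4-cycle inside `X` through a vertex of `U`. -/
def IsSafe {V : Type*} (G : SimpleGraph V) (X U : Set V) (c : V → Bool) : Prop :=
  (∃ m : V → V, ∀ w ∈ U, m w ∈ U ∧ m (m w) = w ∧ G.Adj w (m w) ∧ c w ≠ c (m w)) ∧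
    ∀ c' : V → Bool, (∀ w ∈ U, c' w = c w) →
      ∀ a ∈ U, ∀ b ∈ X, ∀ d ∈ X, ∀ e ∈ X, ¬ IsAlternating G c' a b d e

/-- `X` contains a nonempty safely colourable set. -/
def HasSafe {V : Type*} (G : SimpleGraph V) (X : Set V) : Prop :=
  ∃ U ⊆ X, U.Nonempty ∧ ∃ c, IsSafe G X U c

lemma HasNbrs.irrefl {V : Type*} {G : SimpleGraph V} {p a b c : V} (h : HasNbrs G p a b c) :
    p ≠ a ∧ p ≠ b ∧ p ≠ c := by
  exact ⟨h.2.2.2.1.ne, h.2.2.2.2.1.ne, h.2.2.2.2.2.1.ne⟩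

lemma hasSafe_of_square {V : Type*} (G : SimpleGraph V) (X : Set V) {p q r s p' q' r' s' : V}
    (hp : HasNbrs G p q s p') (hq : HasNbrs G q p r q')
    (hr : HasNbrs G r q s r') (hs : HasNbrs G s p r s')
    (hpX : p ∈ X) (hqX : q ∈ X) (hrX : r ∈ X) (hsX : s ∈ X)
    (h₁ : ¬ (p' ∈ X ∧ s' ∈ X ∧ G.Adj p' s')) (h₂ : ¬ (q' ∈ X ∧ r' ∈ X ∧ G.Adj q' r')) :
    HasSafe G X := by
  have := Classical.decEq V
  have ip := hp.irrefl
  have iq := hq.irrefl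
  have ir := hr.irrefl
  have is := hs.irrefl
  have sym : ∀ a b, G.Adj a b → G.Adj b a := fun a b h => h.symm
  refine ⟨{p, q, r, s}, ?_, ⟨p, by simp⟩, fun v => decide (v = p ∨ v = q), ⟨fun v =>
    if v = p then s else if v = s then p else if v = q then r else q, ?_⟩, ?_⟩
  · rintro v (rfl | rfl | rfl | rfl) <;> assumption
  · unfold HasNbrs at *
    rintro v (rfl | rfl | rfl | rfl) <;> grind
  · intro c' hc
    have cp : c' p = true := by rw [hc p (by simp)]; simp
    have cq : c' q = true := by rw [hc q (by simp)]; simp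
    have cr : c' r = false := by rw [hc r (by simp)]; unfold HasNbrs at *; simp; grind
    have cs : c' s = false := by rw [hc s (by simp)]; unfold HasNbrs at *; simp; grind
    clear hc
    unfold HasNbrs at *
    rintro a (rfl | rfl | rfl | rfl) b hb d hd e he ⟨⟨h1, h2, h3, h4, h5, h6⟩, h7, h8, h9⟩
    · grind
    · grind
    · grind
    · grind

lemma hasSafe_of_domino {V : Type*} (G : SimpleGraph V) (X : Set V) {p q r s x y z w x' z' : V}
    (hp : HasNbrs G p q s x) (hq : HasNbrs G q p r y) (hr : HasNbrs G r q s z)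
    (hs : HasNbrs G s p r w) (hx : HasNbrs G x p y x') (hy : HasNbrs G y q x z)
    (hz : HasNbrs G z r y z')
    (hpX : p ∈ X) (hqX : q ∈ X) (hrX : r ∈ X) (hxX : x ∈ X) (hyX : y ∈ X) (hzX : z ∈ X)
    (h : w ∈ X → ¬ G.Adj w x ∧ ¬ G.Adj w z) :
    HasSafe G X := by
  have := Classical.decEq V
  have ip := hp.irrefl
  have iq := hq.irrefl
  have ir := hr.irrefl
  have is := hs.irrefl
  have ix := hx.irrefl
  have iy := hy.irrefl
  have iz := hz.irrefl
  have sym : ∀ a b, G.Adj a b → G.Adj b a := fun a b h => h.symm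
  unfold HasNbrs at *
  have d1 : p ≠ r := by grind
  have d2 : p ≠ y := by grind
  have d3 : p ≠ z := by grind
  have d4 : q ≠ x := by grind
  have d5 : q ≠ z := by grind
  have d6 : r ≠ x := by grind
  have d7 : r ≠ y := by grind
  have d8 : x ≠ z := by grind
  refine ⟨{p, q, r, x, y, z}, ?_, ⟨p, by simp⟩, fun v => decide (v = p ∨ v = q ∨ v = r), ⟨fun v =>
    if v = p then x else if v = x then p else if v = q then y else if v = y then q else
    if v = r then z else r, ?_⟩, ?_⟩
  · rintro v (rfl | rfl | rfl | rfl | rfl | rfl) <;> assumption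
  · rintro v (rfl | rfl | rfl | rfl | rfl | rfl) <;> grind
  · intro c' hc
    have cp : c' p = true := by rw [hc p (by simp)]; simp
    have cq : c' q = true := by rw [hc q (by simp)]; simp
    have cr : c' r = true := by rw [hc r (by simp)]; simp
    have cx : c' x = false := by rw [hc x (by simp)]; simp; grind
    have cy : c' y = false := by rw [hc y (by simp)]; simp; grind
    have cz : c' z = false := by rw [hc z (by simp)]; simp; grind
    clear hc
    rintro a (rfl | rfl | rfl | rfl | rfl | rfl) b hb d hd e he ⟨⟨h1, h2, h3, h4, h5, h6⟩, h7, h8, h9⟩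
    · grind
    · grind
    · grind
    · grind
    · grind
    · grind

lemma hasSafe_of_domino_of_adj {V : Type*} (G : SimpleGraph V) (X : Set V)
    {p q r s x y z w z' w' : V}
    (hp : HasNbrs G p q s x) (hq : HasNbrs G q p r y) (hr : HasNbrs G r q s z)
    (hs : HasNbrs G s p r w) (hx : HasNbrs G x p y w) (hy : HasNbrs G y q x z)
    (hz : HasNbrs G z r y z') (hw : HasNbrs G w s x w')
    (hpX : p ∈ X) (hqX : q ∈ X) (hrX : r ∈ X) (hsX : s ∈ X) (hxX : x ∈ X) (hyX : y ∈ X)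
    (hzX : z ∈ X) (hwX : w ∈ X) (hrx : r ≠ x) :
    HasSafe G X := by
  have := Classical.decEq V
  have ip := hp.irrefl
  have iq := hq.irrefl
  have ir := hr.irrefl
  have is := hs.irrefl
  have ix := hx.irrefl
  have iy := hy.irrefl
  have iz := hz.irrefl
  have iw := hw.irrefl
  have sym : ∀ a b, G.Adj a b → G.Adj b a := fun a b h => h.symm
  unfold HasNbrs at *
  have d1 : p ≠ r := by grind
  have d2 : p ≠ y := by grind
  have d3 : p ≠ z := by grind
  have d4 : q ≠ x := by grind
  have d5 : q ≠ z := by grind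
  have d6 : r ≠ x := by grind
  have d7 : r ≠ y := by grind
  have d8 : x ≠ z := by grind
  have e1 : s ≠ q := by grind
  have e2 : s ≠ x := by grind
  have e3 : s ≠ y := by grind
  have e4 : s ≠ z := by grind
  have f1 : w ≠ p := by grind
  have f2 : w ≠ q := by grind
  have f3 : w ≠ r := by grind
  have f4 : w ≠ x := by grind
  have f5 : w ≠ y := by grind
  have f6 : w ≠ z := by grind
  refine ⟨{p, q, r, s, x, y, z, w}, ?_, ⟨p, by simp⟩,
    fun v => decide (v = p ∨ v = q ∨ v = r ∨ v = s), ⟨fun v =>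
    if v = p then x else if v = x then p else if v = q then y else if v = y then q else
    if v = r then z else if v = z then r else if v = s then w else s, ?_⟩, ?_⟩
  · rintro v (rfl | rfl | rfl | rfl | rfl | rfl | rfl | rfl) <;> assumption
  · rintro v (rfl | rfl | rfl | rfl | rfl | rfl | rfl | rfl) <;> grind (ematch := 10)
  · intro c' hc
    have cp : c' p = true := by rw [hc p (by simp)]; simp
    have cq : c' q = true := by rw [hc q (by simp)]; simp
    have cr : c' r = true := by rw [hc r (by simp)]; simp
    have cs : c' s = true := by rw [hc s (by simp)]; simp
    have cx : c' x = false := by rw [hc x (by simp)]; simp; grind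
    have cy : c' y = false := by rw [hc y (by simp)]; simp; grind
    have cz : c' z = false := by rw [hc z (by simp)]; simp; grind
    have cw : c' w = false := by rw [hc w (by simp)]; simp; grind
    clear hc
    rintro a (rfl | rfl | rfl | rfl | rfl | rfl | rfl | rfl)
      b hb d hd e he ⟨⟨h1, h2, h3, h4, h5, h6⟩, h7, h8, h9⟩
    · grind
    · grind
    · grind
    · grind
    · grind
    · grind
    · grind
    · grind

lemma exists_hasNbrs {V : Type*} {G : SimpleGraph V} {p a b : V} (hd : deg G p = 3)
    (ha : G.Adj p a) (hb : G.Adj p b) (hab : a ≠ b) : ∃ c, HasNbrs G p a b c := by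
  obtain ⟨x, y, z, hxy, hxz, hyz, h⟩ := Set.ncard_eq_three.1 hd
  have hN : ∀ v, G.Adj p v ↔ v = x ∨ v = y ∨ v = z := fun v => by
    rw [← SimpleGraph.mem_neighborSet, h]; simp
  unfold HasNbrs
  have h1 := (hN a).1 ha
  have h2 := (hN b).1 hb
  have hx := (hN x).2 (by simp)
  have hy := (hN y).2 (by simp)
  have hz := (hN z).2 (by simp)
  have : ∃ c, (c = x ∨ c = y ∨ c = z) ∧ c ≠ a ∧ c ≠ b := by
    by_contra! hcon
    have c1 := hcon x
    have c2 := hcon y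
    have c3 := hcon z
    grind
  obtain ⟨c, hc⟩ := this
  refine ⟨c, ?_⟩
  grind

/-- No component of `G` is a `K_4`. -/
def NoK4 {V : Type*} (G : SimpleGraph V) : Prop :=
  ∀ a b c d, HasNbrs G a b c d → HasNbrs G b a c d → HasNbrs G c a b d → ¬ HasNbrs G d a b c

/-- No component of `G` is a `K_{3,3}`. -/
def NoK33 {V : Type*} (G : SimpleGraph V) : Prop :=
  ∀ a b c d e f, HasNbrs G a d e f → HasNbrs G b d e f → HasNbrs G c d e f →
    HasNbrs G d a b c → HasNbrs G e a b c → ¬ HasNbrs G f a b c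

lemma hasSafe_of_corner {V : Type*} (G : SimpleGraph V) (hcubic : ∀ v, deg G v = 3)
    (hK4 : NoK4 G) (hK33 : NoK33 G) (X : Set V) {p q r s x y z w : V}
    (hp : HasNbrs G p q s x) (hq : HasNbrs G q p r y) (hr : HasNbrs G r q s z)
    (hs : HasNbrs G s p r w) (hyx : G.Adj y x) (hyz : G.Adj y z)
    (hpX : p ∈ X) (hqX : q ∈ X) (hrX : r ∈ X) (hsX : s ∈ X)
    (hxX : x ∈ X) (hyX : y ∈ X) (hzX : z ∈ X) : HasSafe G X := by
  have hyq : G.Adj y q := hq.2.2.2.2.2.1.symm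
  have hqx : q ≠ x := hp.2.1
  have hqz : q ≠ z := hr.2.1
  have hpy : p ≠ y := hq.2.1
  have hry : r ≠ y := hq.2.2.1
  have hxp : G.Adj x p := hp.2.2.2.2.2.1.symm
  have hzr : G.Adj z r := hr.2.2.2.2.2.1.symm
  have sym : ∀ a b, G.Adj a b → G.Adj b a := fun a b h => h.symm
  have hrx : r ≠ x := by
    rintro rfl
    have iq := hq.irrefl
    have iy : y ≠ z := hyz.ne
    unfold HasNbrs at *
    obtain rfl : y = s := by grind
    obtain rfl : w = q := by grind
    exact hK4 p w r y (by unfold HasNbrs; grind) (by unfold HasNbrs; grind)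
      (by unfold HasNbrs; grind) (by unfold HasNbrs; grind)
  obtain ⟨x', hx⟩ := exists_hasNbrs (hcubic x) hxp hyx.symm hpy
  obtain ⟨z', hz⟩ := exists_hasNbrs (hcubic z) hzr hyz.symm hry
  by_cases hxz : x = z
  · subst hxz
    obtain ⟨y', hy⟩ := exists_hasNbrs (hcubic y) hyq hyx hqx
    by_cases hsy : G.Adj s y
    · obtain rfl : w = y := by unfold HasNbrs at *; grind
      refine (hK33 p r w q s x ?_ ?_ ?_ ?_ ?_ ?_).elim <;> unfold HasNbrs at * <;> grind
    · have e1 : HasNbrs G p q x s := by unfold HasNbrs at *; grind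
      have e2 : HasNbrs G r q x s := by unfold HasNbrs at *; grind
      have e3 : HasNbrs G x p r y := by unfold HasNbrs at *; grind
      exact hasSafe_of_square G X e1 hq e2 e3 hpX hqX hrX hxX (fun h => hsy h.2.2)
        (fun h => hsy h.2.2.symm)
  · obtain ⟨y', hy'⟩ := exists_hasNbrs (hcubic y) hyx hyz hxz
    have hy : HasNbrs G y q x z := by unfold HasNbrs at *; grind
    have iz := hz.irrefl
    have ix := hx.irrefl
    have iy := hy.irrefl
    have is := hs.irrefl
    have ip := hp.irrefl
    have ir := hr.irrefl
    have hws : G.Adj w s := hs.2.2.2.2.2.1.symm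
    by_cases h1 : w ∈ X ∧ G.Adj w x
    · have hx2 : HasNbrs G x p y w := by unfold HasNbrs at *; grind
      obtain ⟨w', hw⟩ := exists_hasNbrs (hcubic w) hws h1.2 hp.2.2.1
      exact hasSafe_of_domino_of_adj G X hp hq hr hs hx2 hy hz hw hpX hqX hrX hsX hxX hyX hzX
        h1.1 hrx
    by_cases h2 : w ∈ X ∧ G.Adj w z
    · have hz2 : HasNbrs G z r y w := by unfold HasNbrs at *; grind
      have hq2 : HasNbrs G q r p y := by unfold HasNbrs at *; grind
      have hs2 : HasNbrs G s r p w := by unfold HasNbrs at *; grind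
      have hy2 : HasNbrs G y q z x := by unfold HasNbrs at *; grind
      obtain ⟨w', hw⟩ := exists_hasNbrs (hcubic w) hws h2.2 hr.2.2.1
      refine hasSafe_of_domino_of_adj G X hr hq2 hp hs2 hz2 hy2 hx hw hrX hqX hpX hsX hzX hyX hxX
        h2.1 ?_
      unfold HasNbrs at *; grind
    exact hasSafe_of_domino G X hp hq hr hs hx hy hz hpX hqX hrX hxX hyX hzX
      (fun h => ⟨fun h' => h1 ⟨h, h'⟩, fun h' => h2 ⟨h, h'⟩⟩)

lemma HasNbrs.swap {V : Type*} {G : SimpleGraph V} {p a b c : V} (h : HasNbrs G p a b c) :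
    HasNbrs G p b a c := by
  unfold HasNbrs at *
  grind

/-- Every 4-cycle inside `X` yields a safely colourable subset of `X`. -/
lemma hasSafe_of_cycle {V : Type*} (G : SimpleGraph V) (hcubic : ∀ v, deg G v = 3)
    (hK4 : NoK4 G) (hK33 : NoK33 G) (X : Set V) {p q r s : V}
    (hpq : G.Adj p q) (hqr : G.Adj q r) (hrs : G.Adj r s) (hsp : G.Adj s p)
    (hpr : p ≠ r) (hqs : q ≠ s)
    (hpX : p ∈ X) (hqX : q ∈ X) (hrX : r ∈ X) (hsX : s ∈ X) : HasSafe G X := by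
  obtain ⟨p', hp⟩ := exists_hasNbrs (hcubic p) hpq hsp.symm hqs
  obtain ⟨q', hq⟩ := exists_hasNbrs (hcubic q) hpq.symm hqr hpr
  obtain ⟨r', hr⟩ := exists_hasNbrs (hcubic r) hqr.symm hrs hqs
  obtain ⟨s', hs⟩ := exists_hasNbrs (hcubic s) hsp hrs.symm hpr
  by_cases h1 : p' ∈ X ∧ s' ∈ X ∧ G.Adj p' s'
  · obtain ⟨hp'X, hs'X, hps⟩ := h1
    by_cases h3 : p' ∈ X ∧ q' ∈ X ∧ G.Adj p' q'
    · exact hasSafe_of_corner G hcubic hK4 hK33 X hq hp hs hr h3.2.2 hps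
        hqX hpX hsX hrX h3.2.1 hp'X hs'X
    by_cases h4 : s' ∈ X ∧ r' ∈ X ∧ G.Adj s' r'
    · exact hasSafe_of_corner G hcubic hK4 hK33 X hp.swap hs hr.swap hq hps.symm h4.2.2
        hpX hsX hrX hqX hp'X hs'X h4.2.1
    exact hasSafe_of_square G X hp.swap hs hr.swap hq hpX hsX hrX hqX h3 h4
  by_cases h2 : q' ∈ X ∧ r' ∈ X ∧ G.Adj q' r'
  · obtain ⟨hq'X, hr'X, hqr'⟩ := h2
    by_cases h3 : p' ∈ X ∧ q' ∈ X ∧ G.Adj p' q'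
    · exact hasSafe_of_corner G hcubic hK4 hK33 X hp hq hr hs h3.2.2.symm hqr'
        hpX hqX hrX hsX h3.1 hq'X hr'X
    by_cases h4 : s' ∈ X ∧ r' ∈ X ∧ G.Adj s' r'
    · exact hasSafe_of_corner G hcubic hK4 hK33 X hq.swap hr hs.swap hp hqr'.symm
        h4.2.2.symm hqX hrX hsX hpX hq'X hr'X h4.1
    exact hasSafe_of_square G X hp.swap hs hr.swap hq hpX hsX hrX hqX h3 h4
  exact hasSafe_of_square G X hp hq hr hs hpX hqX hrX hsX h1 h2

lemma mem_of_adj_closed {V : Type*} {G : SimpleGraph V} (hconn : G.Connected) {S : Set V}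
    (hS : ∀ u ∈ S, ∀ v, G.Adj u v → v ∈ S) {a : V} (ha : a ∈ S) (v : V) : v ∈ S := by
  obtain ⟨w⟩ := hconn.preconnected a v
  induction w with
  | nil => exact ha
  | cons h _ ih => exact ih (hS _ ha _ h)

lemma noK4_of_not_iso {V : Type*} {G : SimpleGraph V} (hconn : G.Connected)
    (h : ¬ Nonempty (G ≃g completeGraph (Fin 4))) : NoK4 G := by
  intro a b c d ha hb hc hd
  have hall := mem_of_adj_closed hconn (S := {a, b, c, d}) (a := a) (by
    unfold HasNbrs at *
    rintro u (rfl | rfl | rfl | rfl) v hv <;>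
      simp only [Set.mem_insert_iff, Set.mem_singleton_iff] <;> grind) (by simp)
  have ia := ha.irrefl
  have ib := hb.irrefl
  have ic := hc.irrefl
  refine h ⟨RelIso.symm ⟨Equiv.ofBijective ![a, b, c, d] ⟨?_, ?_⟩, ?_⟩⟩
  · intro i j hij
    fin_cases i <;> fin_cases j <;> simp_all
  · intro v
    rcases hall v with rfl | rfl | rfl | rfl
    exacts [⟨0, rfl⟩, ⟨1, rfl⟩, ⟨2, rfl⟩, ⟨3, rfl⟩]
  · unfold HasNbrs at *
    intro i j
    change G.Adj (![a, b, c, d] i) (![a, b, c, d] j) ↔ _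
    fin_cases i <;> fin_cases j <;> simp_all

lemma noK33_of_not_iso {V : Type*} {G : SimpleGraph V} (hconn : G.Connected)
    (h : ¬ Nonempty (G ≃g completeBipartiteGraph (Fin 3) (Fin 3))) : NoK33 G := by
  intro a b c d e f ha hb hc hd he hf
  have hall := mem_of_adj_closed hconn (S := {a, b, c, d, e, f}) (a := a) (by
    unfold HasNbrs at *
    rintro u (rfl | rfl | rfl | rfl | rfl | rfl) v hv <;>
      simp only [Set.mem_insert_iff, Set.mem_singleton_iff] <;> grind) (by simp)
  have ia := ha.irrefl
  have ib := hb.irrefl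
  have ic := hc.irrefl
  have id := hd.irrefl
  have ie := he.irrefl
  have hif := hf.irrefl
  have nab : ¬ G.Adj a b := fun h => by unfold HasNbrs at *; grind
  have nac : ¬ G.Adj a c := fun h => by unfold HasNbrs at *; grind
  have nbc : ¬ G.Adj b c := fun h => by unfold HasNbrs at *; grind
  have nde : ¬ G.Adj d e := fun h => by unfold HasNbrs at *; grind
  have ndf : ¬ G.Adj d f := fun h => by unfold HasNbrs at *; grind
  have nef : ¬ G.Adj e f := fun h => by unfold HasNbrs at *; grind
  have sym := G.adj_comm
  refine h ⟨RelIso.symm ⟨Equiv.ofBijective (Sum.elim ![a, b, c] ![d, e, f]) ⟨?_, ?_⟩, ?_⟩⟩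
  · unfold HasNbrs at *
    rintro (i | i) (j | j) hij <;> fin_cases i <;> fin_cases j <;> simp_all
  · intro v
    rcases hall v with rfl | rfl | rfl | rfl | rfl | rfl
    exacts [⟨.inl 0, rfl⟩, ⟨.inl 1, rfl⟩, ⟨.inl 2, rfl⟩, ⟨.inr 0, rfl⟩, ⟨.inr 1, rfl⟩,
      ⟨.inr 2, rfl⟩]
  · unfold HasNbrs at *
    intro i j
    change G.Adj (Sum.elim ![a, b, c] ![d, e, f] i) (Sum.elim ![a, b, c] ![d, e, f] j) ↔ _
    rcases i with i | i <;> rcases j with j | j <;> fin_cases i <;> fin_cases j <;> simp <;> grind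

lemma IsAlternating.rotate {V : Type*} {G : SimpleGraph V} {c : V → Bool} {a b d e : V}
    (h : IsAlternating G c a b d e) : IsAlternating G c b d e a := by
  obtain ⟨⟨h1, h2, h3, h4, h5, h6⟩, h7, h8, h9⟩ := h
  exact ⟨⟨h2, h3, h4, h1, h6, h5.symm⟩, fun h => h7 (h8.trans h.symm), h9, h8.symm⟩

lemma IsSafe.not_isAlternating {V : Type*} {G : SimpleGraph V} {W : Set V} {c c' : V → Bool}
    (hW : IsSafe G Set.univ W c) (hc' : ∀ w ∈ W, c' w = c w) {a b d e : V}
    (h : IsAlternating G c' a b d e) : a ∈ Wᶜ ∧ b ∈ Wᶜ ∧ d ∈ Wᶜ ∧ e ∈ Wᶜ := by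
  have key : ∀ {a b d e : V}, IsAlternating G c' a b d e → a ∈ Wᶜ := fun h ha =>
    hW.2 c' hc' _ ha _ trivial _ trivial _ trivial h
  exact ⟨key h, key h.rotate, key h.rotate.rotate, key h.rotate.rotate.rotate⟩

lemma IsSafe.union {V : Type*} {G : SimpleGraph V} {W U : Set V} {c c₁ : V → Bool}
    (hW : IsSafe G Set.univ W c) (hUW : U ⊆ Wᶜ) (hU : IsSafe G Wᶜ U c₁) :
    ∃ c₂, IsSafe G Set.univ (W ∪ U) c₂ := by
  classical
  obtain ⟨m, hm⟩ := hW.1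
  obtain ⟨m₁, hm₁⟩ := hU.1
  have hdis : ∀ w ∈ W, w ∉ U := fun w hw hu => hUW hu hw
  refine ⟨fun v => if v ∈ U then c₁ v else c v, ⟨fun v => if v ∈ U then m₁ v else m v, ?_⟩, ?_⟩
  · rintro w (hw | hw)
    · obtain ⟨h1, h2, h3, h4⟩ := hm w hw
      simp [hdis w hw, hdis _ h1, h1, h2, h3, h4]
    · obtain ⟨h1, h2, h3, h4⟩ := hm₁ w hw
      simp [hw, h1, h2, h3, h4]
  · intro c' hc' a ha b _ d _ e _ h
    have hcW : ∀ w ∈ W, c' w = c w := fun w hw => by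
      rw [hc' w (Or.inl hw)]; simp [hdis w hw]
    have hcU : ∀ w ∈ U, c' w = c₁ w := fun w hw => by
      rw [hc' w (Or.inr hw)]; simp [hw]
    obtain ⟨h1, h2, h3, h4⟩ := hW.not_isAlternating hcW h
    exact hU.2 c' hcU a (ha.resolve_left h1) b h2 d h3 e h4 h

/-- There is a set matched by bichromatic edges such that no colouring extending it has an
alternating 4-cycle. -/
lemma exists_isSafe_forall_not_isAlternating {V : Type*} [Finite V] (G : SimpleGraph V)
    (hcubic : ∀ v, deg G v = 3) (hK4 : NoK4 G) (hK33 : NoK33 G) :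
    ∃ W c, IsSafe G Set.univ W c ∧ ∀ c' : V → Bool, (∀ w ∈ W, c' w = c w) →
      ∀ a b d e, ¬ IsAlternating G c' a b d e := by
  obtain ⟨W, ⟨c, hW⟩, hmax⟩ := (Set.toFinite {W : Set V | ∃ c, IsSafe G Set.univ W c}).exists_maximal
    ⟨∅, fun _ => true, ⟨id, by simp⟩, by simp⟩
  refine ⟨W, c, hW, fun c' hc' a b d e h => ?_⟩
  obtain ⟨h1, h2, h3, h4⟩ := hW.not_isAlternating hc' h
  obtain ⟨⟨a1, a2, a3, a4, a5, a6⟩, -⟩ := h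
  obtain ⟨U, hUW, ⟨u, hu⟩, c₁, hU⟩ :=
    hasSafe_of_cycle G hcubic hK4 hK33 Wᶜ a1 a2 a3 a4 a5 a6 h1 h2 h3 h4
  exact hUW hu (hmax (hW.union hUW hU) Set.subset_union_left (Or.inr hu))

open Classical in
/-- Indicator of the pair `x`, `y` being an edge that is bichromatic under `c`. -/
noncomputable def cutPair {V : Type*} (G : SimpleGraph V) (c : V → Bool) (x y : V) : ℕ :=
  if G.Adj x y ∧ c x ≠ c y then 1 else 0

lemma cutPair_comm {V : Type*} (G : SimpleGraph V) (c : V → Bool) (x y : V) :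
    cutPair G c x y = cutPair G c y x := by
  classical
  unfold cutPair
  exact if_congr (and_congr (G.adj_comm x y) ne_comm) rfl rfl

lemma sum_cutPair_eq {V : Type*} [Fintype V] [DecidableEq V] (G : SimpleGraph V) (c : V → Bool)
    (v : V) :
    ∑ x, ∑ y, cutPair G c x y = 2 * ∑ y, cutPair G c v y +
      ∑ x ∈ Finset.univ.erase v, ∑ y ∈ Finset.univ.erase v, cutPair G c x y := by
  have hv : cutPair G c v v = 0 := by simp [cutPair]
  have h1 : ∀ x, ∑ y, cutPair G c x y =
      cutPair G c v x + ∑ y ∈ Finset.univ.erase v, cutPair G c x y := fun x => by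
    rw [← Finset.add_sum_erase _ _ (Finset.mem_univ v), cutPair_comm]
  rw [← Finset.add_sum_erase _ _ (Finset.mem_univ v), Finset.sum_congr rfl (fun x _ => h1 x),
    Finset.sum_add_distrib]
  have h2 : ∑ x ∈ Finset.univ.erase v, cutPair G c v x = ∑ x, cutPair G c v x := by
    rw [← Finset.add_sum_erase _ _ (Finset.mem_univ v), hv, zero_add]
  rw [h2]
  ring

lemma sum_cutPair_eq_card {V : Type*} [Fintype V] [DecidableEq V] (G : SimpleGraph V)
    [DecidableRel G.Adj] (c : V → Bool) (v : V) :
    ∑ y, cutPair G c v y = (Finset.univ.filter fun y => G.Adj v y ∧ c v ≠ c y).card := by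
  rw [Finset.card_filter]
  refine Finset.sum_congr rfl fun y _ => ?_
  unfold cutPair
  congr

/-- A colouring with maximum cut among those extending `c` from `W` gives every vertex outside `W`
two neighbours of the other colour. -/
lemma exists_extension_two_cut {V : Type*} [Fintype V] (G : SimpleGraph V)
    (hcubic : ∀ v, deg G v = 3) (W : Set V) (c : V → Bool) :
    ∃ c' : V → Bool, (∀ w ∈ W, c' w = c w) ∧ ∀ v ∉ W, ∃ x y, x ≠ y ∧
      G.Adj v x ∧ G.Adj v y ∧ c' v ≠ c' x ∧ c' v ≠ c' y := by
  classical
  have : Nonempty {c' : V → Bool // ∀ w ∈ W, c' w = c w} := ⟨⟨c, fun _ _ => rfl⟩⟩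
  obtain ⟨⟨c', hc'⟩, hmax⟩ := Finite.exists_max
    fun c' : {c' : V → Bool // ∀ w ∈ W, c' w = c w} => ∑ x, ∑ y, cutPair G c'.1 x y
  refine ⟨c', hc', fun v hv => ?_⟩
  suffices h : 1 < (Finset.univ.filter fun y => G.Adj v y ∧ c' v ≠ c' y).card by
    obtain ⟨x, y, hx, hy, hxy⟩ := Finset.one_lt_card_iff.1 h
    simp only [Finset.mem_filter, Finset.mem_univ, true_and] at hx hy
    exact ⟨x, y, hxy, hx.1, hy.1, hx.2, hy.2⟩
  set d : V → Bool := Function.update c' v (!c' v) with hd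
  have hdv : d v = !c' v := by simp [hd]
  have hdx : ∀ x, x ≠ v → d x = c' x := fun x hx => by simp [hd, hx]
  have hle := hmax ⟨d, fun w hw => by rw [hdx w (fun h => hv (h ▸ hw)), hc' w hw]⟩
  simp only at hle
  rw [sum_cutPair_eq G d v, sum_cutPair_eq G c' v] at hle
  have hrest : ∑ x ∈ Finset.univ.erase v, ∑ y ∈ Finset.univ.erase v, cutPair G d x y =
      ∑ x ∈ Finset.univ.erase v, ∑ y ∈ Finset.univ.erase v, cutPair G c' x y := by
    refine Finset.sum_congr rfl fun x hx => Finset.sum_congr rfl fun y hy => ?_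
    simp only [cutPair, hdx x (Finset.ne_of_mem_erase hx), hdx y (Finset.ne_of_mem_erase hy)]
  have hflip : (Finset.univ.filter fun y => G.Adj v y ∧ d v ≠ d y) =
      (G.neighborFinset v).filter fun y => ¬ c' v ≠ c' y := by
    ext y
    simp only [Finset.mem_filter, Finset.mem_univ, true_and, SimpleGraph.mem_neighborFinset]
    refine and_congr_right fun hy => ?_
    rw [hdv, hdx y hy.ne']
    cases c' v <;> cases c' y <;> simp
  have hsame : (Finset.univ.filter fun y => G.Adj v y ∧ c' v ≠ c' y) =
      (G.neighborFinset v).filter fun y => c' v ≠ c' y := by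
    ext y
    simp
  have hdeg : (G.neighborFinset v).card = 3 := by
    rw [← hcubic v, deg, SimpleGraph.neighborFinset_def, ← Set.ncard_eq_toFinset_card']
  have hsum := Finset.card_filter_add_card_filter_not (s := G.neighborFinset v)
    (fun y => c' v ≠ c' y)
  rw [hrest, sum_cutPair_eq_card, sum_cutPair_eq_card, hflip, hsame] at hle
  rw [hsame]
  omega

lemma Bool.eq_of_ne_left {x y z : Bool} : x ≠ y → x ≠ z → y = z := by
  decide +revert

/-- A colouring in which every vertex sees the other colour and same-coloured vertices are
separated by their neighbours of the other colour yields a small locating-dominating set. -/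
lemma two_mul_ldNum_le {V : Type*} [Fintype V] (G : SimpleGraph V) (c : V → Bool)
    (hdom : ∀ v, ∃ x, G.Adj v x ∧ c v ≠ c x)
    (hsep : ∀ u v, c u = c v → (∀ x, c u ≠ c x → (G.Adj u x ↔ G.Adj v x)) → u = v) :
    2 * ldNum G ≤ Fintype.card V := by
  have key : ∀ b, IsLDSet G {v | c v = b} := by
    refine fun b => ⟨fun v => ?_, fun u hu v hv huv h => huv (hsep u v ?_ fun x hx => ?_)⟩
    · by_cases hv : c v = b
      · exact ⟨v, Set.mem_insert _ _, hv⟩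
      · obtain ⟨x, hx, hc⟩ := hdom v
        refine ⟨x, Set.mem_insert_of_mem _ hx, ?_⟩
        exact Bool.eq_of_ne_left hc hv
    · simp only [Set.mem_ofPred_eq] at hu hv
      exact Bool.eq_of_ne_left (Ne.symm hu) (Ne.symm hv)
    · simp only [Set.mem_ofPred_eq] at hu hv
      have hxb : c x = b := Bool.eq_of_ne_left hx hu
      have := Set.ext_iff.1 h x
      simp only [closedNbhd, Set.mem_inter_iff, Set.mem_insert_iff, SimpleGraph.mem_neighborSet,
        Set.mem_ofPred_eq, hxb, and_true] at this
      grind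
  have h1 : ∀ b, ldNum G ≤ {v | c v = b}.ncard := fun b => Nat.sInf_le ⟨_, key b, rfl⟩
  have h2 := Set.ncard_add_ncard_compl {v | c v = true}
  have h3 : {v | c v = true}ᶜ = {v | c v = false} := by ext; simp
  rw [h3, Nat.card_eq_fintype_card] at h2
  have := h1 true
  have := h1 false
  omega

/-- Every connected cubic graph other than `K_4` and `K_{3,3}`
satisfies `γ^LD(G) ≤ n/2`. -/
theorem stmt3 {V : Type*} [Fintype V] (G : SimpleGraph V)
    (hconn : G.Connected) (hcubic : ∀ v : V, deg G v = 3)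
    (hK4 : ¬ Nonempty (G ≃g completeGraph (Fin 4)))
    (hK33 : ¬ Nonempty (G ≃g completeBipartiteGraph (Fin 3) (Fin 3))) :
    2 * ldNum G ≤ Fintype.card V := by
  obtain ⟨W, c₀, ⟨⟨m, hm⟩, -⟩, halt⟩ := exists_isSafe_forall_not_isAlternating G hcubic
    (noK4_of_not_iso hconn hK4) (noK33_of_not_iso hconn hK33)
  obtain ⟨c, hc, htwo⟩ := exists_extension_two_cut G hcubic W c₀
  have hmW : ∀ v ∈ W, G.Adj v (m v) ∧ c v ≠ c (m v) := fun v hv => by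
    obtain ⟨h1, -, h3, h4⟩ := hm v hv
    rw [hc v hv, hc _ h1]
    exact ⟨h3, h4⟩
  have hcycle : ∀ u v x y, u ≠ v → x ≠ y → c u = c v → c u ≠ c x → c u ≠ c y →
      G.Adj u x → G.Adj u y → G.Adj v x → G.Adj v y → False :=
    fun u v x y huv hxy h1 h2 h3 a1 a2 a3 a4 => halt c hc u x v y
      ⟨⟨a1, a3.symm, a4, a2.symm, huv, hxy⟩, h2, h1, Bool.eq_of_ne_left h2 h3⟩
  refine two_mul_ldNum_le G c (fun v => ?_) fun u v huv hcode => ?_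
  · by_cases hv : v ∈ W
    · exact ⟨m v, hmW v hv⟩
    · obtain ⟨x, y, -, hx, -, hcx, -⟩ := htwo v hv
      exact ⟨x, hx, hcx⟩
  · by_contra hne
    by_cases hu : u ∈ W
    · by_cases hv : v ∈ W
      · obtain ⟨a1, h1⟩ := hmW u hu
        obtain ⟨a2, h2⟩ := hmW v hv
        have hmm : m u = m v := by
          by_contra hmm
          exact hcycle u v _ _ hne hmm huv h1 (huv ▸ h2) a1 ((hcode _ (huv ▸ h2)).2 a2)
            ((hcode _ h1).1 a1) a2
        exact hne (by rw [← (hm u hu).2.1, hmm, (hm v hv).2.1])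
      · obtain ⟨x, y, hxy, hx, hy, hcx, hcy⟩ := htwo v hv
        rw [← huv] at hcx hcy
        exact hcycle u v x y hne hxy huv hcx hcy ((hcode x hcx).2 hx) ((hcode y hcy).2 hy) hx hy
    · obtain ⟨x, y, hxy, hx, hy, hcx, hcy⟩ := htwo u hu
      exact hcycle u v x y hne hxy huv hcx hcy hx hy ((hcode x hcx).1 hx) ((hcode y hcy).1 hy)
end

section
/- Every connected graph G on at least three vertices admits a locating-dominating set S of minimum cardinality (i.e., |S| = γ^LD(G)) such that every support vertex of G belongs to S. -/
open SimpleGraph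

/-- A leaf `u` adjacent to `v` has no other neighbour. -/
theorem eq_of_adj_of_deg_eq_one {V : Type*} {G : SimpleGraph V} {u v w : V}
    (hu : deg G u = 1) (huv : G.Adj u v) (huw : G.Adj u w) : w = v := by
  obtain ⟨a, ha⟩ := Set.ncard_eq_one.mp hu
  have hv : v ∈ G.neighborSet u := huv
  have hw : w ∈ G.neighborSet u := huw
  rw [ha] at hv hw
  exact hw.trans hv.symm

/-- In a connected graph on at least three vertices, no two leaves are adjacent. -/
theorem not_adj_of_deg_eq_one {V : Type*} [Fintype V] {G : SimpleGraph V}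
    (hn : 3 ≤ Fintype.card V) (hconn : G.Connected) {u v : V}
    (hu : deg G u = 1) (hv : deg G v = 1) : ¬ G.Adj u v := by
  classical
  intro huv
  have closed : ∀ {a b : V}, G.Walk a b → a = u ∨ a = v → b = u ∨ b = v := by
    intro a b p
    induction p with
    | nil => exact id
    | cons h _ ih =>
      rintro (rfl | rfl)
      · exact ih (Or.inr (eq_of_adj_of_deg_eq_one hu huv h))
      · exact ih (Or.inl (eq_of_adj_of_deg_eq_one hv huv.symm h))
  have hsub : (Finset.univ : Finset V) ⊆ {u, v} := fun w _ => by
    obtain ⟨p⟩ := hconn.preconnected u w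
    simpa using closed p (Or.inl rfl)
  have := (Finset.card_le_card hsub).trans Finset.card_le_two
  rw [Finset.card_univ] at this
  omega

/-- A leaf of a locating-dominating set may be exchanged for its support vertex. -/
theorem IsLDSet.exchange_leaf {V : Type*} {G : SimpleGraph V} {S : Set V} {u v : V}
    (hS : IsLDSet G S) (hu : deg G u = 1) (huv : G.Adj u v) (hv : v ∉ S) :
    IsLDSet G (insert v (S \ {u})) := by
  have adj_leaf : ∀ {w : V}, G.Adj w u → w = v := fun h =>
    eq_of_adj_of_deg_eq_one hu huv h.symm
  have dom : ∀ w, w ≠ u → w ≠ v → ∃ s ∈ closedNbhd G w, s ∈ S ∧ s ≠ u := by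
    intro w hwu hwv
    obtain ⟨s, hs, hsS⟩ := hS.1 w
    refine ⟨s, hs, hsS, ?_⟩
    rintro rfl
    rcases hs with rfl | hs
    · exact hwu rfl
    · exact hwv (adj_leaf hs)
  have leaf_sep : ∀ w, w ≠ u → w ≠ v →
      closedNbhd G u ∩ insert v (S \ {u}) ≠ closedNbhd G w ∩ insert v (S \ {u}) := by
    intro w hwu hwv heq
    obtain ⟨s, hs, hsS, hsu⟩ := dom w hwu hwv
    have : s ∈ closedNbhd G u ∩ insert v (S \ {u}) := by
      rw [heq]
      exact ⟨hs, Or.inr ⟨hsS, hsu⟩⟩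
    rcases this.1 with h | h
    · exact hsu h
    · exact hv (eq_of_adj_of_deg_eq_one hu huv h ▸ hsS)
  refine ⟨fun w => ?_, fun x hx y hy hxy heq => ?_⟩
  · by_cases hwu : w = u
    · exact ⟨v, Or.inr (hwu ▸ huv), Or.inl rfl⟩
    by_cases hwv : w = v
    · exact ⟨v, Or.inl hwv.symm, Or.inl rfl⟩
    obtain ⟨s, hs, hsS, hsu⟩ := dom w hwu hwv
    exact ⟨s, hs, Or.inr ⟨hsS, hsu⟩⟩
  · have hxv : x ≠ v := fun h => hx (Or.inl h)
    have hyv : y ≠ v := fun h => hy (Or.inl h)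
    by_cases hxu : x = u
    · subst hxu
      exact leaf_sep y hxy.symm hyv heq
    by_cases hyu : y = u
    · subst hyu
      exact leaf_sep x hxy hxv heq.symm
    have trace : ∀ w, w ≠ u → w ≠ v →
        closedNbhd G w ∩ S = (closedNbhd G w ∩ insert v (S \ {u})) \ {v} := by
      intro w hwu hwv
      ext s
      constructor
      · rintro ⟨hs, hsS⟩
        refine ⟨⟨hs, Or.inr ⟨hsS, ?_⟩⟩, ?_⟩
        · rintro rfl
          rcases hs with rfl | hs
          · exact hwu rfl
          · exact hwv (adj_leaf hs)
        · rintro rfl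
          exact hv hsS
      · rintro ⟨⟨hs, rfl | hsS⟩, hsv⟩
        · exact (hsv rfl).elim
        · exact ⟨hs, hsS.1⟩
    refine hS.2 x (fun h => hx (Or.inr ⟨h, hxu⟩)) y (fun h => hy (Or.inr ⟨h, hyu⟩)) hxy ?_
    rw [trace x hxu hxv, trace y hyu hyv, heq]

/-- The location-domination number is attained. -/
theorem exists_isLDSet_ncard_eq_ldNum {V : Type*} (G : SimpleGraph V) :
    ∃ S : Set V, IsLDSet G S ∧ S.ncard = ldNum G :=
  Nat.sInf_mem (s := {k : ℕ | ∃ S : Set V, IsLDSet G S ∧ S.ncard = k})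
    ⟨_, Set.univ, ⟨fun v => ⟨v, Or.inl rfl, trivial⟩, fun _ h => (h trivial).elim⟩, rfl⟩

/-- Every connected graph on at least three vertices admits a minimum
locating-dominating set containing every support vertex. -/
theorem stmt5 {V : Type*} [Fintype V] (G : SimpleGraph V)
    (hn : 3 ≤ Fintype.card V) (hconn : G.Connected) :
    ∃ S : Set V, IsLDSet G S ∧ S.ncard = ldNum G ∧
      ∀ v : V, (∃ u : V, G.Adj v u ∧ deg G u = 1) → v ∈ S := by
  obtain ⟨S, ⟨hS, hcard⟩, hmax⟩ := Set.exists_max_image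
    {S : Set V | IsLDSet G S ∧ S.ncard = ldNum G}
    (fun S => (S ∩ {v | ∃ u, G.Adj v u ∧ deg G u = 1}).ncard) (Set.toFinite _)
    (exists_isLDSet_ncard_eq_ldNum G)
  refine ⟨S, hS, hcard, ?_⟩
  rintro v ⟨u, hvu, hu⟩
  by_contra hv
  have huS : u ∈ S := by
    obtain ⟨s, rfl | hs, hsS⟩ := hS.1 u
    · exact hsS
    · exact (hv (eq_of_adj_of_deg_eq_one hu hvu.symm hs ▸ hsS)).elim
  have hle := hmax (insert v (S \ {u}))
    ⟨hS.exchange_leaf hu hvu.symm hv, (Set.ncard_exchange hv huS).trans hcard⟩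
  refine hle.not_gt (Set.ncard_lt_ncard ?_ (Set.toFinite _))
  refine Set.ssubset_iff_exists.mpr ⟨?_, v, ⟨Or.inl rfl, u, hvu, hu⟩, fun h => hv h.1⟩
  rintro w ⟨hwS, hw⟩
  refine ⟨Or.inr ⟨hwS, ?_⟩, hw⟩
  rintro rfl
  obtain ⟨x, hwx, hx⟩ := hw
  exact not_adj_of_deg_eq_one hn hconn hu hx hwx
end
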